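/- Let k ≥ 2. There exists a constant C > 0, depending only on k, such that for every integer N ≥ 3 and every set B ⊆ {1,...,N}^k with the property that (d, d², ..., d^k) ∉ B − B for every nonzero integer d, one has |B|/N^k ≤ C · (log log N / log N)^{1/(k−1)}. -/

import Mathlib

open Finset Pointwise

namespace CurveDiff

/-- The additive character `x ↦ exp (2πix)` of the reals. -/
noncomputable def e (x : ℝ) : ℂ := Complex.exp (2 * Real.pi * x * Complex.I)

lemma e_add (x y : ℝ) : e (x + y) = e x * e y := by
  simp only [e, ← Complex.exp_add]; push_cast; ring_nf

lemma e_zero : e 0 = 1 := by simp [e]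

lemma e_int (n : ℤ) : e n = 1 := by
  rw [e, Complex.exp_eq_one_iff]; exact ⟨n, by push_cast; ring⟩

lemma norm_e (x : ℝ) : ‖e x‖ = 1 := by
  have := Complex.norm_exp_ofReal_mul_I (2 * Real.pi * x)
  rw [e]; push_cast at this; exact this

lemma e_neg (x : ℝ) : e (-x) = (starRingEnd ℂ) (e x) := by
  simp only [e, ← Complex.exp_conj]; simp [Complex.conj_ofNat]

lemma e_add_int (x : ℝ) (n : ℤ) : e (x + n) = e x := by rw [e_add, e_int, mul_one]

lemma e_nat_mul (n : ℕ) (x : ℝ) : e (n * x) = e x ^ n := by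
  simp only [e, ← Complex.exp_nat_mul]; push_cast; ring_nf

lemma norm_e_sub_one_le (x : ℝ) : ‖e x - 1‖ ≤ 7 * |x| := by
  have h := Real.norm_exp_I_mul_ofReal_sub_one_le (x := 2 * Real.pi * x)
  have h2 : Complex.exp (Complex.I * ((2 * Real.pi * x : ℝ) : ℂ)) = e x := by
    rw [e]; push_cast; ring_nf
  rw [h2, Real.norm_eq_abs, abs_mul, abs_of_pos Real.two_pi_pos] at h
  have := Real.pi_lt_d2
  nlinarith [abs_nonneg x]

lemma norm_e_sub_e_le (x y : ℝ) (n : ℤ) : ‖e x - e y‖ ≤ 7 * |x - y - n| := by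
  have h : e x - e y = e y * (e (x - y - n) - 1) := by
    rw [mul_sub, ← e_add, mul_one]
    congr 1
    rw [show y + (x - y - n) = x + ((-n : ℤ) : ℝ) by push_cast; ring, e_add_int]
  rw [h, norm_mul, norm_e, one_mul]
  exact norm_e_sub_one_le _

lemma four_mul_abs_sub_round_le (x : ℝ) : 4 * |x - round x| ≤ ‖e x - 1‖ := by
  set y := x - round x with hy
  have hx : e x = e y := by rw [← e_add_int y (round x)]; congr 1; rw [hy]; ring
  have hy2 : |y| ≤ 1 / 2 := abs_sub_round x
  have h : ‖e y - 1‖ = 2 * |Real.sin (Real.pi * y)| := by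
    have h := Complex.norm_exp_I_mul_ofReal_sub_one (2 * Real.pi * y)
    have h2 : Complex.exp (Complex.I * ((2 * Real.pi * y : ℝ) : ℂ)) = e y := by
      rw [e]; push_cast; ring_nf
    rw [h2] at h
    rw [h, Real.norm_eq_abs, abs_mul, abs_two]; ring_nf
  rw [hx, h]
  have h3 : |Real.sin (Real.pi * y)| = Real.sin (Real.pi * |y|) := by
    rw [Real.abs_sin_eq_sin_abs_of_abs_le_pi, abs_mul, abs_of_pos Real.pi_pos]
    rw [abs_mul, abs_of_pos Real.pi_pos]; nlinarith [Real.pi_pos]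
  rw [h3]
  have h4 := Real.mul_le_sin (x := Real.pi * |y|) (by positivity) (by nlinarith [Real.pi_pos])
  have h5 : 2 / Real.pi * (Real.pi * |y|) = 2 * |y| := by field_simp
  linarith

/-- `x` is within `ε` of an integer. -/
def NearInt (x ε : ℝ) : Prop := ∃ n : ℤ, |x - n| ≤ ε

lemma NearInt.mono {x ε ε' : ℝ} (h : NearInt x ε) (hε : ε ≤ ε') : NearInt x ε' := by
  obtain ⟨n, hn⟩ := h; exact ⟨n, hn.trans hε⟩

lemma NearInt.add {x y ε ε' : ℝ} (h : NearInt x ε) (h' : NearInt y ε') :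
    NearInt (x + y) (ε + ε') := by
  obtain ⟨n, hn⟩ := h; obtain ⟨m, hm⟩ := h'
  refine ⟨n + m, ?_⟩
  calc |x + y - ((n + m : ℤ) : ℝ)| = |(x - n) + (y - m)| := by push_cast; ring_nf
    _ ≤ _ := (abs_add_le _ _).trans (add_le_add hn hm)

lemma NearInt.int_mul {x ε : ℝ} (h : NearInt x ε) (m : ℤ) : NearInt (m * x) (|(m : ℝ)| * ε) := by
  obtain ⟨n, hn⟩ := h
  refine ⟨m * n, ?_⟩
  rw [show (m : ℝ) * x - ((m * n : ℤ) : ℝ) = m * (x - n) by push_cast; ring, abs_mul]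
  exact mul_le_mul_of_nonneg_left hn (abs_nonneg _)

lemma NearInt.nat_mul {x ε : ℝ} (h : NearInt x ε) (m : ℕ) : NearInt (m * x) (m * ε) := by
  have := h.int_mul (m : ℤ); simpa using this

lemma NearInt.neg {x ε : ℝ} (h : NearInt x ε) : NearInt (-x) ε := by
  obtain ⟨n, hn⟩ := h
  refine ⟨-n, ?_⟩
  rw [show -x - ((-n : ℤ) : ℝ) = -(x - n) by push_cast; ring, abs_neg]; exact hn

lemma NearInt.sub {x y ε ε' : ℝ} (h : NearInt x ε) (h' : NearInt y ε') :
    NearInt (x - y) (ε + ε') := by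
  rw [sub_eq_add_neg]; exact h.add h'.neg

lemma NearInt.sum {ι : Type*} (s : Finset ι) {x ε : ι → ℝ} (h : ∀ i ∈ s, NearInt (x i) (ε i)) :
    NearInt (∑ i ∈ s, x i) (∑ i ∈ s, ε i) := by
  classical
  induction s using Finset.induction_on with
  | empty => exact ⟨0, by simp⟩
  | insert a s ha ih =>
    rw [sum_insert ha, sum_insert ha]
    exact (h a (mem_insert_self _ _)).add (ih fun i hi => h i (mem_insert_of_mem hi))

lemma nearInt_half (x : ℝ) : NearInt x (1 / 2) := ⟨round x, abs_sub_round x⟩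

/-- The exponential sum of a real polynomial over `0 ≤ d < M`. -/
noncomputable def weylSum (p : Polynomial ℝ) (M : ℕ) : ℂ := ∑ d ∈ range M, e (p.eval (d : ℝ))

lemma norm_weylSum_le (p : Polynomial ℝ) (M : ℕ) : ‖weylSum p M‖ ≤ M := by
  refine (norm_sum_le _ _).trans ?_
  simp [norm_e]

/-- Linear exponential sums. -/
lemma nearInt_of_norm_geom_sum {a b δ : ℝ} {M : ℕ} (hδ : 0 < δ) (hM : 0 < M)
    (h : δ * M ≤ ‖∑ d ∈ range M, e (a * d + b)‖) : NearInt a (1 / (δ * M)) := by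
  refine ⟨round a, ?_⟩
  have h1 : (e a - 1) * ∑ d ∈ range M, e (a * d + b) = e b * (e a ^ M - 1) := by
    have : ∀ d : ℕ, e (a * d + b) = e b * e a ^ d := by
      intro d; rw [e_add, mul_comm a, e_nat_mul, mul_comm]
    simp_rw [this, ← mul_sum]
    rw [mul_left_comm, mul_geom_sum]
  have h2 : ‖e a - 1‖ * ‖∑ d ∈ range M, e (a * d + b)‖ ≤ 2 := by
    rw [← norm_mul, h1, norm_mul, norm_e, one_mul]
    refine (norm_sub_le _ _).trans ?_
    rw [norm_pow, norm_e]; norm_num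
  have h3 := four_mul_abs_sub_round_le a
  have hpos : 0 < δ * M := by positivity
  rw [le_div_iff₀ hpos]
  have h4 : ‖e a - 1‖ * (δ * M) ≤ 2 := (mul_le_mul_of_nonneg_left h (norm_nonneg _)).trans h2
  nlinarith

/-- Van der Corput's inequality for unimodular sequences. -/
lemma norm_sq_sum_le (z : ℕ → ℂ) (M : ℕ) :
    ‖∑ d ∈ range M, z d‖ ^ 2 ≤
      2 * ∑ h ∈ range M, ‖∑ d ∈ range (M - h), z (d + h) * (starRingEnd ℂ) (z d)‖ := by
  have key : ‖∑ d ∈ range M, z d‖ ^ 2 ≤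
      2 * (∑ m ∈ range M, ∑ d ∈ range (m + 1), z m * (starRingEnd ℂ) (z d)).re := by
    induction M with
    | zero => simp
    | succ M ih =>
      rw [sum_range_succ, sum_range_succ _ M]
      set S := ∑ d ∈ range M, z d with hS
      have h1 : ∑ d ∈ range (M + 1), z M * (starRingEnd ℂ) (z d)
          = z M * (starRingEnd ℂ) (S) + z M * (starRingEnd ℂ) (z M) := by
        rw [sum_range_succ, ← mul_sum, hS, map_sum]
      rw [h1]
      have h2 : ‖S + z M‖ ^ 2 = ‖S‖ ^ 2 + 2 * (z M * (starRingEnd ℂ) S).re + ‖z M‖ ^ 2 := by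
        rw [← Complex.normSq_eq_norm_sq, ← Complex.normSq_eq_norm_sq, ← Complex.normSq_eq_norm_sq,
          Complex.normSq_add]
        simp only [Complex.mul_re, Complex.conj_re, Complex.conj_im]; ring
      have h3 : (z M * (starRingEnd ℂ) (z M)).re = ‖z M‖ ^ 2 := by
        rw [Complex.mul_conj, Complex.normSq_eq_norm_sq]; norm_cast
      rw [h2, Complex.add_re, Complex.add_re, h3]
      nlinarith [sq_nonneg ‖z M‖]
  refine key.trans ?_
  refine mul_le_mul_of_nonneg_left ?_ (by norm_num)
  have h4 : ∑ m ∈ range M, ∑ d ∈ range (m + 1), z m * (starRingEnd ℂ) (z d)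
      = ∑ h ∈ range M, ∑ d ∈ range (M - h), z (d + h) * (starRingEnd ℂ) (z d) := by
    have h5 := sum_range_diag_flip M (fun d h => z (d + h) * (starRingEnd ℂ) (z d))
    have h6 : ∀ m ∈ range M, ∑ d ∈ range (m + 1), z m * (starRingEnd ℂ) (z d)
        = ∑ d ∈ range (m + 1), z (d + (m - d)) * (starRingEnd ℂ) (z d) := by
      intro m _
      refine sum_congr rfl fun d hd => ?_
      rw [Nat.add_sub_cancel' (by have := mem_range.1 hd; omega)]
    rw [sum_congr rfl h6, h5]
    refine sum_comm' fun x y => ?_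
    simp only [mem_range]; omega
  rw [h4]
  exact (Complex.re_le_norm _).trans (norm_sum_le _ _)

/-- Shifting the summation variable of a bounded sum. -/
lemma norm_sum_shift_sub_le (z : ℕ → ℂ) (hz : ∀ d, ‖z d‖ ≤ 1) (M s : ℕ) :
    ‖∑ d ∈ range M, z (d + s) - ∑ d ∈ range M, z d‖ ≤ 2 * s := by
  have h : ∑ d ∈ range M, z (d + s) - ∑ d ∈ range M, z d
      = ∑ d ∈ range s, z (d + M) - ∑ d ∈ range s, z d := by
    have h1 := sum_range_add z s M
    have h2 := sum_range_add z M s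
    rw [add_comm s M, h2] at h1
    simp only [add_comm _ s, add_comm _ M]
    linear_combination -h1
  rw [h]
  refine (norm_sub_le _ _).trans ?_
  have : ∀ w : ℕ → ℂ, (∀ d, ‖w d‖ ≤ 1) → ‖∑ d ∈ range s, w d‖ ≤ s := by
    intro w hw
    refine (norm_sum_le_of_le _ fun d _ => hw d).trans ?_
    simp
  linarith [this (fun d => z (d + M)) (fun d => hz _), this z hz]

/-- Averaging a bounded sum over short progressions with common difference `q`. -/
lemma norm_sum_le_average (z : ℕ → ℂ) (hz : ∀ d, ‖z d‖ ≤ 1) (M L q : ℕ) :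
    L * ‖∑ d ∈ range M, z d‖ ≤
      ∑ d ∈ range M, ‖∑ t ∈ range L, z (d + q * t)‖ + L * (2 * q * L) := by
  have h1 : (L : ℂ) * ∑ d ∈ range M, z d = ∑ d ∈ range M, ∑ t ∈ range L, z (d + q * t)
      - ∑ t ∈ range L, (∑ d ∈ range M, z (d + q * t) - ∑ d ∈ range M, z d) := by
    rw [sum_sub_distrib, sum_comm]; simp
  have h2 : (L : ℝ) * ‖∑ d ∈ range M, z d‖ = ‖(L : ℂ) * ∑ d ∈ range M, z d‖ := by
    rw [norm_mul]; simp
  rw [h2, h1]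
  refine (norm_sub_le _ _).trans (add_le_add (norm_sum_le _ _) ?_)
  have h3 : ∀ t ∈ range L, ‖∑ d ∈ range M, z (d + q * t) - ∑ d ∈ range M, z d‖ ≤ 2 * q * L := by
    intro t ht
    refine (norm_sum_shift_sub_le z hz M (q * t)).trans ?_
    have : (t : ℝ) ≤ L := by exact_mod_cast (mem_range.1 ht).le
    push_cast
    nlinarith [mul_le_mul_of_nonneg_left this (Nat.cast_nonneg (α := ℝ) q)]
  refine (norm_sum_le_of_le _ h3).trans ?_
  simp

/-- A function on the naturals bounded by a fixed power on arguments `≥ 2`. -/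
def PolyBdd (f : ℕ → ℕ) : Prop := ∃ C : ℕ, ∀ Q : ℕ, 2 ≤ Q → f Q ≤ Q ^ C

lemma PolyBdd.const (c : ℕ) : PolyBdd fun _ => c :=
  ⟨c, fun _ hQ => (Nat.lt_two_pow_self (n := c)).le.trans (Nat.pow_le_pow_left hQ c)⟩

lemma PolyBdd.id : PolyBdd fun Q => Q := ⟨1, fun _ _ => by simp⟩

lemma PolyBdd.mul {f g : ℕ → ℕ} (hf : PolyBdd f) (hg : PolyBdd g) :
    PolyBdd fun Q => f Q * g Q := by
  obtain ⟨a, ha⟩ := hf; obtain ⟨b, hb⟩ := hg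
  exact ⟨a + b, fun Q hQ => (Nat.mul_le_mul (ha Q hQ) (hb Q hQ)).trans (pow_add Q a b).ge⟩

lemma PolyBdd.add {f g : ℕ → ℕ} (hf : PolyBdd f) (hg : PolyBdd g) :
    PolyBdd fun Q => f Q + g Q := by
  obtain ⟨a, ha⟩ := hf; obtain ⟨b, hb⟩ := hg
  refine ⟨max a b + 1, fun Q hQ => ?_⟩
  have h1 := (ha Q hQ).trans (Nat.pow_le_pow_right (by omega) (le_max_left a b))
  have h2 := (hb Q hQ).trans (Nat.pow_le_pow_right (by omega) (le_max_right a b))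
  rw [pow_succ]
  nlinarith [Nat.mul_le_mul_left (Q ^ max a b) hQ]

lemma PolyBdd.pow {f : ℕ → ℕ} (hf : PolyBdd f) (n : ℕ) : PolyBdd fun Q => f Q ^ n := by
  obtain ⟨a, ha⟩ := hf
  exact ⟨a * n, fun Q hQ => (Nat.pow_le_pow_left (ha Q hQ) n).trans (pow_mul Q a n).ge⟩

/-- Many multiples of `γ` being close to integers forces a small multiple to be very close. -/
lemma exists_mul_near_int {M ℓ s A : ℕ} {γ ε : ℝ} (H : Finset ℕ) (hH : H ⊆ range M)
    (hℓ : M + ℓ < #H * ℓ) (hs : ℓ * (2 * A + 1) * s < #H) (hA : 2 * ε * M + ε + 1 ≤ A)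
    (hγ : ∀ h ∈ H, NearInt (γ * h) ε) :
    ∃ (q : ℕ) (n : ℤ), 0 < q ∧ q < ℓ ∧ |q * γ - n| * s ≤ 2 * ε * ℓ := by
  have hℓ0 : 0 < ℓ := by
    rcases Nat.eq_zero_or_pos ℓ with h | h
    · subst h; simp at hℓ
    · exact h
  have step1 : ∃ q : ℕ, 0 < q ∧ q < ℓ ∧ NearInt (q * γ) (2 * ε) := by
    have hc : #(range (M / ℓ + 1)) < #H := by
      rw [card_range]
      by_contra hcon
      push Not at hcon
      have h1 := Nat.mul_le_mul_right ℓ hcon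
      have h2 := Nat.div_mul_le_self M ℓ
      rw [add_mul] at h1; omega
    obtain ⟨x, hx, y, hy, hxy, hxy'⟩ := exists_ne_map_eq_of_card_lt_of_maps_to hc
      (f := fun h => h / ℓ) (fun h hh => by
        have := mem_range.1 (hH hh)
        simp only [coe_range, Set.mem_Iio]
        exact Nat.lt_succ_of_le (Nat.div_le_div_right this.le))
    wlog hlt : x < y generalizing x y
    · exact this y hy x hx hxy.symm hxy'.symm (by omega)
    have h1 := Nat.div_add_mod x ℓ
    have h2 := Nat.div_add_mod y ℓ
    have h3 := Nat.mod_lt x hℓ0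
    have h4 := Nat.mod_lt y hℓ0
    rw [hxy'] at h1
    refine ⟨y - x, by omega, by omega, ?_⟩
    have h5 := (hγ y hy).sub (hγ x hx)
    rw [Nat.cast_sub hlt.le, show ((y : ℝ) - x) * γ = γ * y - γ * x by ring, two_mul]
    exact h5
  obtain ⟨q, hq0, hqℓ, n, hn⟩ := step1
  refine ⟨q, n, hq0, hqℓ, ?_⟩
  have hε : 0 ≤ ε := by linarith [abs_nonneg (q * γ - n)]
  choose! N hN using hγ
  set β := q * γ - n with hβ
  have hβj : ∀ h : ℕ, γ * h = γ * (h % q : ℕ) + (h / q : ℕ) * (n + β) := by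
    intro h
    have : ((h : ℕ) : ℝ) = (q : ℝ) * (h / q : ℕ) + (h % q : ℕ) := by
      exact_mod_cast (Nat.div_add_mod h q).symm
    rw [hβ]; nth_rw 1 [this]; ring
  let f : ℕ → ℕ × ℤ := fun h => (h % q, N h - n * (h / q : ℕ) - ⌊γ * (h % q : ℕ)⌋)
  have hf : ∀ h ∈ H, f h ∈ range q ×ˢ Icc (-(A : ℤ)) A := by
    intro h hh
    simp only [f, mem_product, mem_range, mem_Icc]
    refine ⟨Nat.mod_lt _ hq0, ?_⟩
    have h1 := abs_le.1 (hN h hh)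
    rw [hβj h] at h1
    have h2 := Int.floor_le (γ * (h % q : ℕ))
    have h3 := Int.lt_floor_add_one (γ * (h % q : ℕ))
    have h4 : |((h / q : ℕ) : ℝ) * β| ≤ 2 * ε * M := by
      rw [abs_mul, Nat.abs_cast, mul_comm]
      refine mul_le_mul hn ?_ (by positivity) (by positivity)
      exact_mod_cast (Nat.div_le_self _ _).trans (mem_range.1 (hH hh)).le
    have h5 := abs_le.1 h4
    generalize h / q = j at *
    constructor
    · have : (-(A : ℝ)) ≤ ((N h - n * j - ⌊γ * (h % q : ℕ)⌋ : ℤ) : ℝ) := by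
        push_cast; nlinarith
      exact_mod_cast this
    · have : ((N h - n * j - ⌊γ * (h % q : ℕ)⌋ : ℤ) : ℝ) ≤ A := by
        push_cast; nlinarith
      exact_mod_cast this
  have hcard : #(range q ×ˢ Icc (-(A : ℤ)) A) * s < #H := by
    rw [card_product, card_range, Int.card_Icc]
    refine lt_of_le_of_lt (Nat.mul_le_mul_right s (Nat.mul_le_mul hqℓ.le (le_of_eq ?_))) hs
    omega
  obtain ⟨y, -, hy⟩ := exists_lt_card_fiber_of_mul_lt_card_of_maps_to hf hcard
  set F := H.filter fun x => f x = y with hF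
  have hne : F.Nonempty := card_pos.1 (by omega)
  set a := F.min' hne with ha
  set b := F.max' hne with hb
  have haF := F.min'_mem hne
  have hbF := F.max'_mem hne
  have hab : s ≤ b - a := by
    have : F ⊆ Icc a b := fun x hx => mem_Icc.2 ⟨F.min'_le x hx, F.le_max' x hx⟩
    have := card_le_card this
    rw [Nat.card_Icc] at this
    omega
  have hleab : a ≤ b := F.min'_le b hbF
  rw [← ha] at haF
  rw [← hb] at hbF
  rw [hF, mem_filter] at haF hbF
  have hfab : f a = f b := haF.2.trans hbF.2.symm
  simp only [f, Prod.mk.injEq] at hfab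
  obtain ⟨hmod, hfrac⟩ := hfab
  rw [hmod] at hfrac
  have h1 := abs_le.1 (hN a haF.1)
  have h2 := abs_le.1 (hN b hbF.1)
  rw [hβj a, hmod] at h1
  rw [hβj b] at h2
  have hfrac' : ((N a : ℤ) : ℝ) - n * (a / q : ℕ) = N b - n * (b / q : ℕ) := by
    have h : N a - n * (a / q : ℕ) = N b - n * (b / q : ℕ) := by linarith
    generalize a / q = j at *
    generalize b / q = j' at *
    exact_mod_cast h
  have h3 : |(((b / q : ℕ) : ℝ) - (a / q : ℕ)) * β| ≤ 2 * ε := by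
    rw [abs_le]; constructor <;> nlinarith
  have h4 : (s : ℝ) ≤ q * (((b / q : ℕ) : ℝ) - (a / q : ℕ)) := by
    have e1 : ((a : ℕ) : ℝ) = (q : ℝ) * (a / q : ℕ) + (b % q : ℕ) := by
      rw [← hmod]; exact_mod_cast (Nat.div_add_mod a q).symm
    have e2 : ((b : ℕ) : ℝ) = (q : ℝ) * (b / q : ℕ) + (b % q : ℕ) := by
      exact_mod_cast (Nat.div_add_mod b q).symm
    have e3 : (s : ℝ) ≤ b - a := by
      rw [← Nat.cast_sub hleab]; exact_mod_cast hab
    linarith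
  set J := ((b / q : ℕ) : ℝ) - (a / q : ℕ)
  calc |β| * s ≤ |β| * (q * J) := mul_le_mul_of_nonneg_left h4 (abs_nonneg _)
    _ ≤ |β| * (q * |J|) := by gcongr; exact le_abs_self J
    _ = |J * β| * q := by rw [abs_mul]; ring
    _ ≤ 2 * ε * ℓ := by
      refine mul_le_mul h3 ?_ (by positivity) (by positivity)
      exact_mod_cast hqℓ.le

lemma taylor_coeff_eq_sum {R : Type*} [CommRing R] {p : Polynomial R} {k : ℕ} (hp : p.natDegree ≤ k)
    (r : R) (i : ℕ) :
    (Polynomial.taylor r p).coeff i =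
      ∑ m ∈ range (k + 1), ((m + i).choose i : R) * p.coeff (m + i) * r ^ m := by
  rw [Polynomial.taylor_coeff, Polynomial.eval_eq_sum_range' (n := k + 1)]
  · simp only [Polynomial.hasseDeriv_coeff]
  · have := Polynomial.natDegree_hasseDeriv_le p i
    omega

lemma natDegree_taylor_sub_le {R : Type*} [CommRing R] {p : Polynomial R} {k : ℕ}
    (hp : p.natDegree ≤ k + 1) (r : R) :
    (Polynomial.taylor r p - p).natDegree ≤ k := by
  rw [Polynomial.natDegree_le_iff_coeff_eq_zero]
  intro N hN
  rw [Polynomial.coeff_sub, taylor_coeff_eq_sum hp, sum_eq_single_of_mem 0 (by simp)]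
  · simp
  · intro b _ hb
    rw [Polynomial.coeff_eq_zero_of_natDegree_lt (by omega)]; simp

lemma coeff_taylor_sub {R : Type*} [CommRing R] {p : Polynomial R} {k : ℕ}
    (hp : p.natDegree ≤ k + 1) (r : R) :
    (Polynomial.taylor r p - p).coeff k = (k + 1) * r * p.coeff (k + 1) := by
  rw [Polynomial.coeff_sub, taylor_coeff_eq_sum hp, sum_range_succ', sum_range_succ']
  rw [sum_eq_zero]
  · simp [add_comm 1 k]; ring
  · intro b _
    rw [Polynomial.coeff_eq_zero_of_natDegree_lt (by omega)]; simp

/-- Inverse theorem for Weyl sums of degree at most `k`. -/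
def InverseWeyl (k : ℕ) : Prop := ∃ C : ℕ, ∀ Q : ℕ, 2 ≤ Q → ∀ M : ℕ, 0 < M →
  ∀ p : Polynomial ℝ, p.natDegree ≤ k → (M : ℝ) ≤ Q * ‖weylSum p M‖ →
    ∃ q : ℕ, 0 < q ∧ q ≤ Q ^ C ∧
      ∀ i : ℕ, 1 ≤ i → i ≤ k → NearInt (q * p.coeff i) (Q ^ C / (M : ℝ) ^ i)

lemma InverseWeyl.of_polyBdd {k : ℕ} {F : ℕ → ℕ} (hF : PolyBdd F)
    (h : ∀ Q : ℕ, 2 ≤ Q → ∀ M : ℕ, 0 < M →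
      ∀ p : Polynomial ℝ, p.natDegree ≤ k → (M : ℝ) ≤ Q * ‖weylSum p M‖ →
      ∃ q : ℕ, 0 < q ∧ q ≤ F Q ∧
        ∀ i : ℕ, 1 ≤ i → i ≤ k → NearInt (q * p.coeff i) (F Q / (M : ℝ) ^ i)) :
    InverseWeyl k := by
  obtain ⟨C, hC⟩ := hF
  refine ⟨C, fun Q hQ M hM p hp hw => ?_⟩
  obtain ⟨q, hq, hqF, hi⟩ := h Q hQ M hM p hp hw
  refine ⟨q, hq, hqF.trans (hC Q hQ), fun i h1 h2 => (hi i h1 h2).mono ?_⟩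
  gcongr
  exact_mod_cast hC Q hQ

lemma weylSum_taylor_sub (p : Polynomial ℝ) (h n : ℕ) :
    ∑ d ∈ range n, e (p.eval ((d + h : ℕ) : ℝ)) * (starRingEnd ℂ) (e (p.eval (d : ℝ)))
      = weylSum (Polynomial.taylor (h : ℝ) p - p) n := by
  refine sum_congr rfl fun d _ => ?_
  rw [← e_neg, ← e_add, Polynomial.eval_sub, Polynomial.taylor_eval]
  congr 1
  push_cast; rw [add_comm (d : ℝ)]; ring

/-- Many differences have large exponential sums. -/
lemma exists_large_differences {Q M : ℕ} (hQ : 0 < Q) (hM : 0 < M) {p : Polynomial ℝ}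
    (hw : (M : ℝ) ≤ Q * ‖weylSum p M‖) :
    ∃ H : Finset ℕ, H ⊆ range M ∧ M ≤ 4 * Q ^ 2 * #H ∧ ∀ h ∈ H,
      (M : ℝ) ≤ 4 * Q ^ 2 * ‖weylSum (Polynomial.taylor (h : ℝ) p - p) (M - h)‖ := by
  classical
  set S : ℕ → ℝ := fun h => ‖weylSum (Polynomial.taylor (h : ℝ) p - p) (M - h)‖ with hS
  have h1 := norm_sq_sum_le (fun d : ℕ => e (p.eval (d : ℝ))) M
  simp only [weylSum_taylor_sub] at h1
  change ‖weylSum p M‖ ^ 2 ≤ 2 * ∑ h ∈ range M, S h at h1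
  refine ⟨(range M).filter fun h => (M : ℝ) ≤ 4 * Q ^ 2 * S h, filter_subset _ _, ?_,
    fun h hh => (mem_filter.1 hh).2⟩
  set H := (range M).filter fun h => (M : ℝ) ≤ 4 * Q ^ 2 * S h with hH
  have h2 : 4 * (Q : ℝ) ^ 2 * ∑ h ∈ range M, S h ≤ 4 * Q ^ 2 * (#H * M) + M * M := by
    rw [← sum_filter_add_sum_filter_not (range M) (fun h => (M : ℝ) ≤ 4 * Q ^ 2 * S h), mul_add]
    refine add_le_add ?_ ?_
    · refine mul_le_mul_of_nonneg_left ?_ (by positivity)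
      rw [← nsmul_eq_mul]
      refine sum_le_card_nsmul _ _ _ fun h _ => (norm_weylSum_le _ _).trans ?_
      exact_mod_cast Nat.sub_le _ _
    · rw [mul_sum]
      refine (sum_le_card_nsmul _ _ (M : ℝ) fun h hh => (not_le.1 (mem_filter.1 hh).2).le).trans ?_
      rw [nsmul_eq_mul]
      gcongr
      simpa using card_filter_le (range M) (fun h => ¬ (M : ℝ) ≤ 4 * Q ^ 2 * S h)
  have h3 : (M : ℝ) ^ 2 ≤ Q ^ 2 * ‖weylSum p M‖ ^ 2 := by
    rw [← mul_pow]; exact pow_le_pow_left₀ (by positivity) hw 2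
  have h4 : (M : ℝ) * M ≤ 4 * Q ^ 2 * (#H) * M := by
    nlinarith [mul_le_mul_of_nonneg_left h1 (sq_nonneg (Q : ℝ))]
  have h5 := le_of_mul_le_mul_right h4 (by exact_mod_cast hM)
  exact_mod_cast h5

/-- The leading coefficient of a polynomial with large exponential sum. -/
lemma InverseWeyl.leading {k : ℕ} (hk : 1 ≤ k) (ih : InverseWeyl k) :
    ∃ C : ℕ, ∀ Q : ℕ, 2 ≤ Q → ∀ M : ℕ, 0 < M →
      ∀ p : Polynomial ℝ, p.natDegree ≤ k + 1 → (M : ℝ) ≤ Q * ‖weylSum p M‖ →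
      ∃ q : ℕ, 0 < q ∧ q ≤ Q ^ C ∧ NearInt (q * p.coeff (k + 1)) (Q ^ C / (M : ℝ) ^ (k + 1)) := by
  obtain ⟨C, hC⟩ := ih
  let Q1 : ℕ → ℕ := fun Q => 4 * Q ^ 2
  let ℓ : ℕ → ℕ := fun Q => 2 * Q1 Q ^ (C + 1)
  let E : ℕ → ℕ := fun Q => Q1 Q ^ (C + k)
  let D : ℕ → ℕ := fun Q => Q1 Q ^ (C + 1) * (ℓ Q * (2 * (4 * E Q) + 1))
  let F : ℕ → ℕ := fun Q => (4 * D Q) ^ (k + 1) + (Q1 Q ^ C * ((k + 1) * ℓ Q)) + 8 * ℓ Q * D Q * E Q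
  have hQ1 : PolyBdd Q1 := (PolyBdd.const 4).mul (PolyBdd.id.pow 2)
  have hℓ : PolyBdd ℓ := (PolyBdd.const 2).mul (hQ1.pow _)
  have hE : PolyBdd E := hQ1.pow _
  have hD : PolyBdd D := (hQ1.pow _).mul (hℓ.mul (((PolyBdd.const 2).mul
    ((PolyBdd.const 4).mul hE)).add (PolyBdd.const 1)))
  have hF : PolyBdd F := ((((PolyBdd.const 4).mul hD).pow _).add ((hQ1.pow _).mul
    ((PolyBdd.const (k + 1)).mul hℓ))).add ((((PolyBdd.const 8).mul hℓ).mul hD).mul hE)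
  obtain ⟨C2, hC2⟩ := hF
  refine ⟨C2, fun Q hQ M hM p hp hw => ?_⟩
  suffices h : ∃ q : ℕ, 0 < q ∧ q ≤ F Q ∧
      NearInt (q * p.coeff (k + 1)) (F Q / (M : ℝ) ^ (k + 1)) by
    obtain ⟨q, hq, hqF, hi⟩ := h
    refine ⟨q, hq, hqF.trans (hC2 Q hQ), hi.mono ?_⟩
    gcongr
    exact_mod_cast hC2 Q hQ
  have hM' : (0 : ℝ) < M := by exact_mod_cast hM
  have hQ1pos : 16 ≤ Q1 Q := by simp only [Q1]; nlinarith
  have hQ1p : 0 < Q1 Q := by omega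
  have hℓpos : 0 < ℓ Q := by simp only [ℓ]; positivity
  have hEpos : 0 < E Q := by simp only [E]; positivity
  have hDℓ : ℓ Q ≤ D Q := by
    simp only [D]
    have h1 : 1 ≤ Q1 Q ^ (C + 1) := Nat.one_le_pow _ _ hQ1p
    calc ℓ Q = 1 * (ℓ Q * 1) := by ring
      _ ≤ _ := Nat.mul_le_mul h1 (Nat.mul_le_mul_left _ (by omega))
  have hDpos : 0 < D Q := hℓpos.trans_le hDℓ
  rcases lt_or_ge M (4 * D Q) with hsmall | hbig
  · refine ⟨1, one_pos, ?_, (nearInt_half _).mono ?_⟩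
    · have : 1 ≤ (4 * D Q) ^ (k + 1) := Nat.one_le_pow _ _ (by omega)
      simp only [F]; omega
    · have h1 : (M : ℝ) ^ (k + 1) ≤ F Q := by
        have : M ^ (k + 1) ≤ (4 * D Q) ^ (k + 1) := Nat.pow_le_pow_left hsmall.le _
        have : M ^ (k + 1) ≤ F Q := by simp only [F]; omega
        exact_mod_cast this
      have h2 : 1 ≤ (F Q : ℝ) / (M : ℝ) ^ (k + 1) := by rwa [one_le_div (by positivity)]
      linarith
  obtain ⟨H0, hH0, hH0c, hH0w⟩ := exists_large_differences (by omega) hM hw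
  have hstep : ∀ h ∈ H0, ∃ q ∈ Icc 1 (Q1 Q ^ C),
      NearInt (q * ((k + 1) * p.coeff (k + 1)) * h) (E Q / (M : ℝ) ^ k) := by
    intro h hh
    have hhM := mem_range.1 (hH0 hh)
    have h1 := hH0w h hh
    have h2 : ((M - h : ℕ) : ℝ) ≤ M := by exact_mod_cast Nat.sub_le _ _
    have hcast : ((Q1 Q : ℕ) : ℝ) = 4 * Q ^ 2 := by simp only [Q1]; push_cast; ring
    obtain ⟨q, hq, hqC, hqi⟩ := hC (Q1 Q) (by omega) (M - h) (by omega) _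
      (natDegree_taylor_sub_le hp (h : ℝ)) (by rw [hcast]; exact h2.trans h1)
    refine ⟨q, mem_Icc.2 ⟨hq, hqC⟩, ?_⟩
    have h3 := hqi k hk le_rfl
    rw [coeff_taylor_sub hp] at h3
    rw [show (q : ℝ) * ((k + 1) * p.coeff (k + 1)) * h = q * ((k + 1) * h * p.coeff (k + 1)) by ring]
    refine h3.mono ?_
    have h4 : (M : ℝ) ≤ Q1 Q * (M - h : ℕ) := by
      rw [hcast]
      exact h1.trans (mul_le_mul_of_nonneg_left (norm_weylSum_le _ _) (by positivity))
    have h5 : (0 : ℝ) < (M - h : ℕ) := by exact_mod_cast (by omega : 0 < M - h)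
    rw [div_le_div_iff₀ (by positivity) (by positivity)]
    calc ((Q1 Q : ℕ) : ℝ) ^ C * (M : ℝ) ^ k ≤ (Q1 Q : ℝ) ^ C * (Q1 Q * (M - h : ℕ)) ^ k := by gcongr
      _ = (E Q : ℝ) * ((M - h : ℕ) : ℝ) ^ k := by simp only [E]; push_cast; ring
  choose! f hf hfi using hstep
  have hH0pos : 0 < #H0 := by
    rcases Nat.eq_zero_or_pos #H0 with h | h
    · rw [h] at hH0c; omega
    · exact h
  obtain ⟨q1, hq1, hq1c⟩ := exists_le_card_fiber_of_nsmul_le_card_of_maps_to (M := ℚ)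
    (b := (#H0 : ℚ) / (Q1 Q ^ C : ℕ)) hf (by
      exact (Finset.card_pos.1 hH0pos).elim fun x hx => ⟨_, hf x hx⟩) (by
      rw [Nat.card_Icc, Nat.add_sub_cancel, nsmul_eq_mul]
      have : ((Q1 Q ^ C : ℕ) : ℚ) ≠ 0 := by positivity
      field_simp; exact le_rfl)
  set H := H0.filter fun x => f x = q1 with hH
  have hHc : #H0 ≤ #H * Q1 Q ^ C := by
    rw [div_le_iff₀ (by positivity)] at hq1c
    exact_mod_cast hq1c
  have hMH : M ≤ #H * Q1 Q ^ (C + 1) := by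
    calc M ≤ Q1 Q * #H0 := hH0c
      _ ≤ Q1 Q * (#H * Q1 Q ^ C) := Nat.mul_le_mul_left _ hHc
      _ = _ := by ring
  have hdiv : 2 * D Q * (M / (2 * D Q)) ≤ M := Nat.mul_div_le _ _
  have hHpos : 0 < #H := by
    rcases Nat.eq_zero_or_pos #H with h | h
    · rw [h] at hMH; omega
    · exact h
  obtain ⟨q2, n, hq2, hq2ℓ, hq2n⟩ := exists_mul_near_int (M := M) (ℓ := ℓ Q) (s := M / (2 * D Q))
    (A := 4 * E Q) (γ := q1 * ((k + 1) * p.coeff (k + 1))) (ε := E Q / (M : ℝ) ^ k) H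
    ((filter_subset _ _).trans hH0)
    (by
      have : #H * ℓ Q = 2 * (#H * Q1 Q ^ (C + 1)) := by simp only [ℓ]; ring
      omega)
    (by
      have hlt : ℓ Q * (2 * (4 * E Q) + 1) * (M / (2 * D Q)) * Q1 Q ^ (C + 1) <
          #H * Q1 Q ^ (C + 1) := by
        refine lt_of_lt_of_le ?_ hMH
        have : ℓ Q * (2 * (4 * E Q) + 1) * (M / (2 * D Q)) * Q1 Q ^ (C + 1) =
          D Q * (M / (2 * D Q)) := by simp only [D]; ring
        rw [this]
        nlinarith
      exact lt_of_mul_lt_mul_right hlt (Nat.zero_le _))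
    (by
      have h1 : (1 : ℝ) ≤ M := by exact_mod_cast hM
      have h2 : (E Q : ℝ) / (M : ℝ) ^ k * M ≤ E Q := by
        rw [div_mul_eq_mul_div, div_le_iff₀ (by positivity)]
        exact mul_le_mul_of_nonneg_left (le_self_pow₀ h1 (by omega)) (by positivity)
      have h3 : (E Q : ℝ) / (M : ℝ) ^ k ≤ E Q := div_le_self (by positivity) (one_le_pow₀ h1)
      have h4 : (1 : ℝ) ≤ E Q := by exact_mod_cast hEpos
      push_cast; nlinarith)
    (by
      intro h hh
      have := hfi h (mem_of_mem_filter h hh)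
      rwa [(mem_filter.1 hh).2] at this)
  have hq1' := mem_Icc.1 hq1
  refine ⟨q1 * ((k + 1) * q2), by have := hq1'.1; positivity, ?_, n, ?_⟩
  · have : q1 * ((k + 1) * q2) ≤ Q1 Q ^ C * ((k + 1) * ℓ Q) :=
      Nat.mul_le_mul hq1'.2 (Nat.mul_le_mul_left _ hq2ℓ.le)
    simp only [F]; omega
  · have hs : (M : ℝ) ≤ 4 * D Q * (M / (2 * D Q) : ℕ) := by
      have h1 : M < 2 * D Q * (M / (2 * D Q) + 1) := by
        have := Nat.lt_mul_div_succ M (b := 2 * D Q) (by omega)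
        exact this
      have h2 : M ≤ 4 * D Q * (M / (2 * D Q)) := by nlinarith
      exact_mod_cast h2
    have hspos : (0 : ℝ) < (M / (2 * D Q) : ℕ) := by
      by_contra hcon
      have : ((M / (2 * D Q) : ℕ) : ℝ) = 0 := le_antisymm (not_lt.1 hcon) (by positivity)
      rw [this] at hs; linarith
    set s : ℝ := ((M / (2 * D Q) : ℕ) : ℝ)
    have h3 : (q1 : ℝ) * ((k + 1) * q2) * p.coeff (k + 1) =
        q2 * (q1 * ((k + 1) * p.coeff (k + 1))) := by
      ring
    push_cast
    rw [h3]
    set x := |(q2 : ℝ) * (q1 * ((k + 1) * p.coeff (k + 1))) - n|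
    have hx : 0 ≤ x := abs_nonneg _
    rw [le_div_iff₀ (by positivity)]
    have h4 : x * M ≤ 4 * D Q * (2 * (E Q / (M : ℝ) ^ k) * ℓ Q) := by
      calc x * M ≤ x * (4 * D Q * s) := mul_le_mul_of_nonneg_left hs hx
        _ = 4 * D Q * (x * s) := by ring
        _ ≤ _ := mul_le_mul_of_nonneg_left hq2n (by positivity)
    have h5 : x * (M : ℝ) ^ (k + 1) ≤ 8 * ℓ Q * D Q * E Q := by
      calc x * (M : ℝ) ^ (k + 1) = x * M * (M : ℝ) ^ k := by ring
        _ ≤ 4 * D Q * (2 * (E Q / (M : ℝ) ^ k) * ℓ Q) * (M : ℝ) ^ k :=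
            mul_le_mul_of_nonneg_right h4 (by positivity)
        _ = _ := by field_simp; ring
    refine h5.trans ?_
    have : 8 * ℓ Q * D Q * E Q ≤ F Q := by simp only [F]; omega
    exact_mod_cast this

lemma inverseWeyl_zero : InverseWeyl 0 :=
  ⟨0, fun _ _ _ _ _ _ _ => ⟨1, one_pos, by simp, fun i h1 h2 => by omega⟩⟩

lemma inverseWeyl_one : InverseWeyl 1 := by
  refine ⟨1, fun Q hQ M hM p hp hw => ⟨1, one_pos, by rw [pow_one]; omega, fun i h1 h2 => ?_⟩⟩
  obtain rfl : i = 1 := by omega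
  have hQ' : (0 : ℝ) < Q := by exact_mod_cast (by omega : 0 < Q)
  have h3 : weylSum p M = ∑ d ∈ range M, e (p.coeff 1 * d + p.coeff 0) := by
    refine sum_congr rfl fun d _ => ?_
    rw [Polynomial.eval_eq_sum_range' (n := 2) (by omega), sum_range_succ, sum_range_one]
    congr 1; ring
  have h4 := nearInt_of_norm_geom_sum (a := p.coeff 1) (b := p.coeff 0) (δ := 1 / Q) (M := M)
    (by positivity) hM (by
      rw [← h3, div_mul_eq_mul_div, one_mul, div_le_iff₀ hQ', mul_comm]; exact hw)
  rw [Nat.cast_one, one_mul]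
  refine h4.mono (le_of_eq ?_)
  field_simp

/-- Recovering the coefficients of `p` from those of `p.comp (q₀ X + v)`. -/
lemma nearInt_coeff_of_comp {k q₀ q₁ v M : ℕ} {E : ℝ} (hM : 0 < M) (hq : 0 < q₀) (hE : 0 ≤ E)
    (hv : v ≤ M)
    {p : Polynomial ℝ} (hp : p.natDegree ≤ k)
    (h : ∀ j : ℕ, 1 ≤ j → j ≤ k →
      NearInt (q₁ * ((Polynomial.taylor (v : ℝ) p).coeff j * (q₀ : ℝ) ^ j)) (E / (M : ℝ) ^ j))
    {i : ℕ} (hi : 1 ≤ i) :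
    NearInt (((q₀ ^ k * q₁ : ℕ) : ℝ) * p.coeff i)
      ((k + 1) * 2 ^ (2 * k) * (q₀ : ℝ) ^ k * E / (M : ℝ) ^ i) := by
  have hM' : (0 : ℝ) < M := by exact_mod_cast hM
  set S := Polynomial.taylor (v : ℝ) p with hS
  have hSdeg : S.natDegree ≤ k := by rw [hS, Polynomial.natDegree_taylor]; exact hp
  have hpS : p = Polynomial.taylor (-(v : ℝ)) S := by
    rw [hS, Polynomial.taylor_taylor, neg_add_cancel, Polynomial.taylor_zero]
  rw [hpS, taylor_coeff_eq_sum hSdeg, mul_sum]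
  have hterm : ∀ m ∈ range (k + 1), NearInt (((q₀ ^ k * q₁ : ℕ) : ℝ) *
      (((m + i).choose i : ℝ) * S.coeff (m + i) * (-(v : ℝ)) ^ m))
      (2 ^ (2 * k) * (q₀ : ℝ) ^ k * E / (M : ℝ) ^ i) := by
    intro m _
    rcases lt_or_ge k (m + i) with hlt | hle
    · rw [Polynomial.coeff_eq_zero_of_natDegree_lt (by omega)]
      refine ⟨0, ?_⟩
      simp; positivity
    · have h1 := (h (m + i) (by omega) hle).int_mul
        ((q₀ : ℤ) ^ (k - (m + i)) * (m + i).choose i * (-(v : ℤ)) ^ m)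
      have h2 : ((q₀ ^ k * q₁ : ℕ) : ℝ) * (((m + i).choose i : ℝ) * S.coeff (m + i) * (-(v : ℝ)) ^ m)
          = (((q₀ : ℤ) ^ (k - (m + i)) * (m + i).choose i * (-(v : ℤ)) ^ m : ℤ) : ℝ) *
            (q₁ * (S.coeff (m + i) * (q₀ : ℝ) ^ (m + i))) := by
        push_cast
        have : (q₀ : ℝ) ^ k = q₀ ^ (k - (m + i)) * q₀ ^ (m + i) := by
          rw [← pow_add, Nat.sub_add_cancel hle]
        rw [this]; ring
      rw [h2]
      refine h1.mono ?_
      push_cast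
      rw [abs_mul, abs_mul, abs_pow, abs_pow, abs_neg, Nat.abs_cast, Nat.abs_cast, Nat.abs_cast]
      have h3 : ((m + i).choose i : ℝ) ≤ 2 ^ (2 * k) := by
        have : (m + i).choose i ≤ 2 ^ (m + i) := Nat.choose_le_two_pow _ _
        have h4 : 2 ^ (m + i) ≤ 2 ^ (2 * k) := Nat.pow_le_pow_right (by norm_num) (by omega)
        exact_mod_cast this.trans h4
      have h4 : (q₀ : ℝ) ^ (k - (m + i)) ≤ (q₀ : ℝ) ^ k := by
        exact pow_le_pow_right₀ (by exact_mod_cast hq) (by omega)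
      have h5 : (v : ℝ) ^ m ≤ (M : ℝ) ^ m := by gcongr
      calc (q₀ : ℝ) ^ (k - (m + i)) * ((m + i).choose i : ℝ) * (v : ℝ) ^ m * (E / (M : ℝ) ^ (m + i))
          ≤ (q₀ : ℝ) ^ k * 2 ^ (2 * k) * (M : ℝ) ^ m * (E / (M : ℝ) ^ (m + i)) := by gcongr
        _ = _ := by rw [pow_add]; field_simp
  refine (NearInt.sum _ hterm).mono (le_of_eq ?_)
  rw [sum_const, card_range, nsmul_eq_mul]; push_cast; ring

/-- One of the short progressions carries a large sum of the lower degree part. -/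
lemma exists_progression {k Q M L q₀ E : ℕ} {α : ℝ} {p₁ : Polynomial ℝ} (hM : 0 < M)
    (hQ : 0 < Q) (hL : 0 < L) (hq : 0 < q₀)
    (hw : (M : ℝ) ≤ Q * ‖weylSum (p₁ + Polynomial.C α * Polynomial.X ^ (k + 1)) M‖)
    (hα : NearInt (q₀ * α) (E / (M : ℝ) ^ (k + 1)))
    (hL1 : 4 * Q * q₀ * L ≤ M) (hL2 : 28 * Q * ((k + 1) * 2 ^ k * E) * L ≤ M) :
    ∃ v < M, (L : ℝ) ≤ 4 * Q * ‖weylSum ((Polynomial.taylor (v : ℝ) p₁).comp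
      (Polynomial.C (q₀ : ℝ) * Polynomial.X)) L‖ := by
  have hM' : (0 : ℝ) < M := by exact_mod_cast hM
  have hQ' : (0 : ℝ) < Q := by exact_mod_cast hQ
  have hL' : (0 : ℝ) < L := by exact_mod_cast hL
  set p := p₁ + Polynomial.C α * Polynomial.X ^ (k + 1) with hp
  have havg := norm_sum_le_average (fun d : ℕ => e (p.eval (d : ℝ))) (fun d => (norm_e _).le) M L q₀
  change (L : ℝ) * ‖weylSum p M‖ ≤ _ at havg
  have hex : ∃ v ∈ range M, (L : ℝ) / (2 * Q) ≤ ‖∑ t ∈ range L, e (p.eval ((v + q₀ * t : ℕ) : ℝ))‖ := by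
    by_contra hcon
    push Not at hcon
    have h1 : ∑ d ∈ range M, ‖∑ t ∈ range L, e (p.eval ((d + q₀ * t : ℕ) : ℝ))‖ <
        M * (L / (2 * Q)) := by
      refine (sum_lt_sum_of_nonempty ⟨0, by simpa using hM⟩ hcon).trans_eq ?_
      simp
    have h2 : (4 * Q * q₀ * L : ℝ) ≤ M := by exact_mod_cast hL1
    have h3 : (L : ℝ) * M ≤ Q * (L * ‖weylSum p M‖) := by nlinarith
    have h4 : Q * (M * (L / (2 * Q))) = (M : ℝ) * L / 2 := by field_simp
    have h5 : (Q : ℝ) * (L * (2 * q₀ * L)) ≤ M * L / 2 := by nlinarith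
    nlinarith
  obtain ⟨v, hv, hvw⟩ := hex
  have hvM := mem_range.1 hv
  refine ⟨v, hvM, ?_⟩
  obtain ⟨n, hn⟩ := hα
  have hdiff : ∀ t ∈ range L, ‖e (p.eval ((v + q₀ * t : ℕ) : ℝ)) -
      e (α * (v : ℝ) ^ (k + 1)) * e (((Polynomial.taylor (v : ℝ) p₁).comp
      (Polynomial.C (q₀ : ℝ) * Polynomial.X)).eval (t : ℝ))‖ ≤ 1 / (4 * Q) := by
    intro t ht
    have htL := mem_range.1 ht
    have hgeom : ((v : ℤ) + q₀ * t) ^ (k + 1) - (v : ℤ) ^ (k + 1) =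
        q₀ * (t * ∑ i ∈ range (k + 1), ((v : ℤ) + q₀ * t) ^ i * (v : ℤ) ^ (k - i)) := by
      have := (Commute.all ((v : ℤ) + q₀ * t) (v : ℤ)).mul_geom_sum₂ (k + 1)
      rw [← this, add_sub_cancel_left]
      simp only [Nat.add_sub_cancel]
      ring
    set W : ℤ := t * ∑ i ∈ range (k + 1), ((v : ℤ) + q₀ * t) ^ i * (v : ℤ) ^ (k - i) with hW
    have hWle : |(W : ℝ)| ≤ L * ((k + 1) * 2 ^ k * (M : ℝ) ^ k) := by
      have h0 : 0 ≤ W := by positivity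
      have hx : (v : ℤ) + q₀ * t ≤ 2 * M := by
        have h1 : q₀ * t ≤ M := by
          calc q₀ * t ≤ q₀ * L := Nat.mul_le_mul_left _ htL.le
            _ ≤ 4 * Q * (q₀ * L) := Nat.le_mul_of_pos_left _ (by positivity)
            _ = 4 * Q * q₀ * L := by ring
            _ ≤ M := hL1
        have : (q₀ : ℤ) * t ≤ M := by exact_mod_cast h1
        have : (v : ℤ) < M := by exact_mod_cast hvM
        linarith
      have h1 : W ≤ L * ((k + 1) * 2 ^ k * (M : ℤ) ^ k) := by
        rw [hW]
        refine mul_le_mul (by exact_mod_cast htL.le) ?_ (by positivity) (by positivity)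
        have : ∀ i ∈ range (k + 1), ((v : ℤ) + q₀ * t) ^ i * (v : ℤ) ^ (k - i) ≤
            2 ^ k * (M : ℤ) ^ k := by
          intro i hi
          have hik : i ≤ k := by have := mem_range.1 hi; omega
          calc ((v : ℤ) + q₀ * t) ^ i * (v : ℤ) ^ (k - i) ≤ (2 * M) ^ i * (2 * M) ^ (k - i) := by
                gcongr
                have : (v : ℤ) < M := by exact_mod_cast hvM
                omega
            _ = 2 ^ k * (M : ℤ) ^ k := by rw [← pow_add, Nat.add_sub_cancel' hik, mul_pow]
        refine (sum_le_card_nsmul _ _ _ this).trans (le_of_eq ?_)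
        rw [card_range, nsmul_eq_mul]; push_cast; ring
      rw [abs_of_nonneg (by exact_mod_cast h0)]
      exact_mod_cast h1
    rw [← e_add]
    refine (norm_e_sub_e_le _ _ (W * n)).trans ?_
    have heval : p.eval ((v + q₀ * t : ℕ) : ℝ) - (α * (v : ℝ) ^ (k + 1) +
        ((Polynomial.taylor (v : ℝ) p₁).comp
        (Polynomial.C (q₀ : ℝ) * Polynomial.X)).eval (t : ℝ)) - ((W * n : ℤ) : ℝ) =
        W * (q₀ * α - n) := by
      have hg : ((v : ℝ) + q₀ * t) ^ (k + 1) - (v : ℝ) ^ (k + 1) = q₀ * W := by exact_mod_cast hgeom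
      rw [hp]
      simp only [Polynomial.eval_add, Polynomial.eval_mul, Polynomial.eval_C, Polynomial.eval_pow,
        Polynomial.eval_X, Polynomial.eval_comp, Polynomial.taylor_eval]
      push_cast
      rw [add_comm ((q₀ : ℝ) * t) v]
      linear_combination α * hg
    rw [heval, abs_mul]
    have h2 : (28 * Q * ((k + 1) * 2 ^ k * E) * L : ℝ) ≤ M := by exact_mod_cast hL2
    calc 7 * (|(W : ℝ)| * |q₀ * α - n|)
        ≤ 7 * ((L * ((k + 1) * 2 ^ k * (M : ℝ) ^ k)) * (E / (M : ℝ) ^ (k + 1))) := by gcongr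
      _ = 28 * Q * ((k + 1) * 2 ^ k * E) * L / M * (1 / (4 * Q)) := by
        rw [pow_succ]; field_simp; ring
      _ ≤ 1 * (1 / (4 * Q)) := by
        gcongr
        rwa [div_le_one hM']
      _ = _ := one_mul _
  have hsum : ‖∑ t ∈ range L, e (p.eval ((v + q₀ * t : ℕ) : ℝ)) -
      e (α * (v : ℝ) ^ (k + 1)) * weylSum ((Polynomial.taylor (v : ℝ) p₁).comp
      (Polynomial.C (q₀ : ℝ) * Polynomial.X)) L‖ ≤ L * (1 / (4 * Q)) := by
    rw [weylSum, mul_sum, ← sum_sub_distrib]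
    refine (norm_sum_le_of_le _ hdiff).trans ?_
    simp
  have h1 := norm_sub_norm_le (∑ t ∈ range L, e (p.eval ((v + q₀ * t : ℕ) : ℝ)))
    (e (α * (v : ℝ) ^ (k + 1)) * weylSum ((Polynomial.taylor (v : ℝ) p₁).comp
      (Polynomial.C (q₀ : ℝ) * Polynomial.X)) L)
  rw [norm_mul, norm_e, one_mul] at h1
  have h2 : (L : ℝ) / (2 * Q) = 2 * (L * (1 / (4 * Q))) := by field_simp; norm_num
  have h3 : (L : ℝ) * (1 / (4 * Q)) ≤ ‖weylSum ((Polynomial.taylor (v : ℝ) p₁).comp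
      (Polynomial.C (q₀ : ℝ) * Polynomial.X)) L‖ := by linarith
  have h4 := mul_le_mul_of_nonneg_left h3 (by positivity : 0 ≤ 4 * (Q : ℝ))
  refine le_trans (le_of_eq ?_) h4
  field_simp

lemma InverseWeyl.succ {k : ℕ} (hk : 1 ≤ k) (ih : InverseWeyl k) : InverseWeyl (k + 1) := by
  obtain ⟨C2, hlead⟩ := ih.leading hk
  obtain ⟨C, hC⟩ := ih
  let D : ℕ → ℕ := fun Q => 4 * Q * Q ^ C2 + 28 * Q * ((k + 1) * 2 ^ k * Q ^ C2)
  let F : ℕ → ℕ := fun Q => (2 * D Q) ^ (k + 1) + (Q ^ C2) ^ (k + 1) * (4 * Q) ^ C * Q ^ C2 +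
    ((k + 1) * 2 ^ (2 * k)) * (Q ^ C2) ^ (k + 1) * ((4 * Q) ^ C * (2 * D Q) ^ k)
  have hX := PolyBdd.id.pow C2
  have h4 := ((PolyBdd.const 4).mul PolyBdd.id).pow C
  have hD : PolyBdd D := (((PolyBdd.const 4).mul PolyBdd.id).mul hX).add
    (((PolyBdd.const 28).mul PolyBdd.id).mul ((PolyBdd.const ((k + 1) * 2 ^ k)).mul hX))
  have hF : PolyBdd F := ((((PolyBdd.const 2).mul hD).pow _).add (((hX.pow (k + 1)).mul h4).mul
    hX)).add (((PolyBdd.const ((k + 1) * 2 ^ (2 * k))).mul (hX.pow (k + 1))).mul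
    (h4.mul (((PolyBdd.const 2).mul hD).pow k)))
  refine InverseWeyl.of_polyBdd hF fun Q hQ M hM p hp hw => ?_
  have hM' : (0 : ℝ) < M := by exact_mod_cast hM
  have hQ0 : 0 < Q := by omega
  have hX0 : 0 < Q ^ C2 := by positivity
  have hDpos : 0 < D Q := by simp only [D]; positivity
  rcases lt_or_ge M (2 * D Q) with hsmall | hbig
  · refine ⟨1, one_pos, ?_, fun i _ hi => (nearInt_half _).mono ?_⟩
    · have : 1 ≤ (2 * D Q) ^ (k + 1) := Nat.one_le_pow _ _ (by omega)
      simp only [F]; omega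
    · have h1 : (M : ℝ) ^ i ≤ F Q := by
        have h2 : M ^ i ≤ (2 * D Q) ^ (k + 1) := (Nat.pow_le_pow_left hsmall.le _).trans
          (Nat.pow_le_pow_right (by omega) hi)
        have : M ^ i ≤ F Q := by simp only [F]; omega
        exact_mod_cast this
      have h2 : 1 ≤ (F Q : ℝ) / (M : ℝ) ^ i := by rwa [one_le_div (by positivity)]
      linarith
  obtain ⟨q₀, hq0, hq0C, hq0n⟩ := hlead Q hQ M hM p hp hw
  set α := p.coeff (k + 1) with hα
  set p₁ := p - Polynomial.C α * Polynomial.X ^ (k + 1) with hp1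
  have hp1deg : p₁.natDegree ≤ k := by
    rw [Polynomial.natDegree_le_iff_coeff_eq_zero]
    intro N hN
    rw [hp1, Polynomial.coeff_sub, Polynomial.coeff_C_mul_X_pow]
    split_ifs with h
    · rw [h, hα, sub_self]
    · rw [Polynomial.coeff_eq_zero_of_natDegree_lt (by omega), sub_zero]
  have hpp : p = p₁ + Polynomial.C α * Polynomial.X ^ (k + 1) := by rw [hp1]; ring
  set L := M / D Q with hL
  have hLD : D Q * L ≤ M := Nat.mul_div_le _ _
  have hL0 : 0 < L := Nat.div_pos (by omega) hDpos
  have hML : M ≤ 2 * D Q * L := by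
    have h1 : M < D Q * (L + 1) := Nat.lt_mul_div_succ M hDpos
    nlinarith
  obtain ⟨v, hv, hvw⟩ := exists_progression (k := k) (Q := Q) (M := M) (L := L) (q₀ := q₀)
    (E := Q ^ C2) (α := α) (p₁ := p₁) hM hQ0 hL0 hq0 (by rw [← hpp]; exact hw)
    (by push_cast; exact hq0n)
    (by
      refine le_trans (Nat.mul_le_mul_right L ?_) hLD
      have := Nat.mul_le_mul_left (4 * Q) hq0C
      simp only [D]; omega)
    (by
      refine le_trans (Nat.mul_le_mul_right L ?_) hLD
      simp only [D]; omega)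
  obtain ⟨q₁, hq1, hq1C, hq1n⟩ := hC (4 * Q) (by omega) L hL0
    ((Polynomial.taylor (v : ℝ) p₁).comp (Polynomial.C (q₀ : ℝ) * Polynomial.X)) (by
    refine (Polynomial.natDegree_comp_le).trans ?_
    rw [Polynomial.natDegree_taylor]
    exact (Nat.mul_le_mul hp1deg (Polynomial.natDegree_C_mul_le _ _)).trans
      (by rw [Polynomial.natDegree_X]; omega))
    (by push_cast; exact hvw)
  have hr : ∀ j : ℕ, 1 ≤ j → j ≤ k → NearInt (q₁ * ((Polynomial.taylor (v : ℝ) p₁).coeff j *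
      (q₀ : ℝ) ^ j)) (((4 * Q) ^ C * (2 * D Q) ^ k : ℕ) / (M : ℝ) ^ j) := by
    intro j hj hjk
    have h1 := hq1n j hj hjk
    rw [Polynomial.comp_C_mul_X_coeff] at h1
    refine h1.mono ?_
    have hL' : (0 : ℝ) < L := by exact_mod_cast hL0
    rw [div_le_div_iff₀ (by positivity) (by positivity)]
    push_cast
    have h2 : (M : ℝ) ≤ 2 * D Q * L := by exact_mod_cast hML
    have h3 : (1 : ℝ) ≤ 2 * D Q := by exact_mod_cast (by omega : 1 ≤ 2 * D Q)
    calc (4 * (Q : ℝ)) ^ C * (M : ℝ) ^ j ≤ (4 * (Q : ℝ)) ^ C * (2 * D Q * L) ^ j := by gcongr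
      _ = (4 * (Q : ℝ)) ^ C * (2 * D Q) ^ j * L ^ j := by rw [mul_pow (2 * (D Q : ℝ))]; ring
      _ ≤ _ := by gcongr
  have hcoef : ∀ i, 1 ≤ i → i ≤ k → NearInt (((q₀ ^ k * q₁ : ℕ) : ℝ) * p.coeff i)
      ((k + 1) * 2 ^ (2 * k) * (q₀ : ℝ) ^ k * ((4 * Q) ^ C * (2 * D Q) ^ k : ℕ) / (M : ℝ) ^ i) := by
    intro i hi hik
    have h1 : p.coeff i = p₁.coeff i := by
      rw [hpp, Polynomial.coeff_add, Polynomial.coeff_C_mul_X_pow, if_neg (by omega), add_zero]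
    rw [h1]
    exact nearInt_coeff_of_comp hM hq0 (by positivity) hv.le hp1deg hr hi
  have hq0k : q₀ ^ k ≤ (Q ^ C2) ^ k := Nat.pow_le_pow_left hq0C k
  refine ⟨q₀ * (q₀ ^ k * q₁), by positivity, ?_, fun i hi hik => ?_⟩
  · have h1 : q₀ * (q₀ ^ k * q₁) ≤ (Q ^ C2) ^ (k + 1) * (4 * Q) ^ C * Q ^ C2 := by
      calc q₀ * (q₀ ^ k * q₁) ≤ Q ^ C2 * ((Q ^ C2) ^ k * (4 * Q) ^ C) :=
            Nat.mul_le_mul hq0C (Nat.mul_le_mul hq0k hq1C)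
        _ = (Q ^ C2) ^ (k + 1) * (4 * Q) ^ C * 1 := by ring
        _ ≤ _ := Nat.mul_le_mul_left _ hX0
    simp only [F]; omega
  · rcases Nat.lt_or_ge i (k + 1) with hlt | hge
    · have h1 := (hcoef i hi (by omega)).nat_mul q₀
      rw [← mul_assoc, ← Nat.cast_mul] at h1
      refine h1.mono ?_
      rw [← mul_div_assoc]
      gcongr
      have h2 : q₀ * ((k + 1) * 2 ^ (2 * k) * q₀ ^ k * ((4 * Q) ^ C * (2 * D Q) ^ k)) ≤ F Q := by
        calc q₀ * ((k + 1) * 2 ^ (2 * k) * q₀ ^ k * ((4 * Q) ^ C * (2 * D Q) ^ k))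
            ≤ Q ^ C2 * ((k + 1) * 2 ^ (2 * k) * (Q ^ C2) ^ k * ((4 * Q) ^ C * (2 * D Q) ^ k)) := by
              gcongr
          _ = ((k + 1) * 2 ^ (2 * k)) * (Q ^ C2) ^ (k + 1) * ((4 * Q) ^ C * (2 * D Q) ^ k) := by ring
          _ ≤ _ := by simp only [F]; omega
      exact_mod_cast h2
    · obtain rfl : i = k + 1 := by omega
      have h1 := hq0n.nat_mul (q₀ ^ k * q₁)
      rw [← mul_assoc, ← Nat.cast_mul, mul_comm (q₀ ^ k * q₁)] at h1
      refine h1.mono ?_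
      rw [← mul_div_assoc]
      gcongr
      have h2 : q₀ ^ k * q₁ * Q ^ C2 ≤ F Q := by
        calc q₀ ^ k * q₁ * Q ^ C2 ≤ (Q ^ C2) ^ k * (4 * Q) ^ C * Q ^ C2 := by gcongr
          _ ≤ (Q ^ C2) ^ (k + 1) * (4 * Q) ^ C * Q ^ C2 := by
            gcongr
            omega
          _ ≤ _ := by simp only [F]; omega
      exact_mod_cast h2

/-- The inverse theorem for Weyl sums. -/
theorem inverseWeyl : ∀ k : ℕ, InverseWeyl k
  | 0 => inverseWeyl_zero
  | 1 => inverseWeyl_one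
  | k + 2 => (inverseWeyl (k + 1)).succ (by omega)

section Ring
variable {R S : Type*} [CommRing R] [CommRing S]

/-- The complete exponential sum of the polynomial `∑ aᵢ X ^ (i + 1)`. -/
noncomputable def completeSum [Fintype R] {k : ℕ} (ψ : AddChar R ℂ) (a : Fin k → R) : ℂ :=
  ∑ x : R, ψ (∑ i, a i * x ^ (i.1 + 1))

/-- The annihilator of the entries of `a` is trivial. -/
def Faithful {k : ℕ} (a : Fin k → R) : Prop := ∀ c : R, (∀ i, c * a i = 0) → c = 0

/-- No nonzero multiple of the character is trivial. -/
def PrimChar (ψ : AddChar R ℂ) : Prop := ∀ c : R, (∀ x, ψ (c * x) = 1) → c = 0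

/-- The tuples whose product has vanishing `L`-th power. -/
noncomputable def nilTuples (R : Type*) [CommRing R] [Fintype R] (K L : ℕ) : Finset (Fin K → R) :=
  letI := Classical.decEq R
  univ.filter fun c => (∏ i, c i) ^ L = 0

lemma mem_nilTuples [Fintype R] {K L : ℕ} {c : Fin K → R} :
    c ∈ nilTuples R K L ↔ (∏ i, c i) ^ L = 0 := by simp [nilTuples]

/-- Comparison of complete exponential sums with the density of nilpotent products. -/
def GaussBound (k K L : ℕ) (B : ℝ) (R : Type*) [CommRing R] [Fintype R] : Prop :=
  ∀ ψ : AddChar R ℂ, PrimChar ψ → ∀ a : Fin k → R, Faithful a →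
    ‖completeSum ψ a‖ ^ k * (Fintype.card R : ℝ) ^ K ≤
      B * #(nilTuples R K L) * (Fintype.card R : ℝ) ^ k

lemma norm_completeSum_le [Fintype R] {k : ℕ} (ψ : AddChar R ℂ) (a : Fin k → R) :
    ‖completeSum ψ a‖ ≤ Fintype.card R := by
  refine (norm_sum_le _ _).trans ?_
  simp [AddChar.norm_apply]

variable [Fintype R] [Fintype S]

lemma GaussBound.of_equiv {k K L : ℕ} {B : ℝ} (h : GaussBound k K L B R) (f : R ≃+* S) :
    GaussBound k K L B S := by
  intro ψ hψ a ha
  have h1 := h (ψ.compAddMonoidHom (f : R →+* S).toAddMonoidHom) (by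
    intro c hc
    refine f.injective ?_
    rw [map_zero]
    refine hψ _ fun x => ?_
    have := hc (f.symm x)
    simpa using this) (fun i => f.symm (a i)) (by
    intro c hc
    refine f.injective ?_
    rw [map_zero]
    refine ha _ fun i => ?_
    have := congrArg f (hc i)
    simpa using this)
  have hcard : Fintype.card R = Fintype.card S := Fintype.card_congr f.toEquiv
  have hnil : #(nilTuples R K L) = #(nilTuples S K L) := by
    refine card_bij' (fun c _ i => f (c i)) (fun c _ i => f.symm (c i)) ?_ ?_ ?_ ?_
    · intro c hc
      rw [mem_nilTuples] at hc ⊢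
      rw [← map_prod, ← map_pow, hc, map_zero]
    · intro c hc
      rw [mem_nilTuples] at hc ⊢
      rw [← map_prod, ← map_pow, hc, map_zero]
    · intro c _; simp
    · intro c _; simp
  have hsum : completeSum (ψ.compAddMonoidHom (f : R →+* S).toAddMonoidHom)
      (fun i => f.symm (a i)) = completeSum ψ a := by
    refine Fintype.sum_equiv f.toEquiv _ _ fun x => ?_
    simp
  rwa [hcard, hnil, hsum] at h1

lemma GaussBound.prod {k K L : ℕ} {B B' : ℝ} (hB : 0 ≤ B) (h : GaussBound k K L B R)
    (h' : GaussBound k K L B' S) : GaussBound k K L (B * B') (R × S) := by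
  intro ψ hψ a ha
  set ψ₁ : AddChar R ℂ := ψ.compAddMonoidHom (AddMonoidHom.inl R S) with hψ₁
  set ψ₂ : AddChar S ℂ := ψ.compAddMonoidHom (AddMonoidHom.inr R S) with hψ₂
  have hsplit : ∀ x : R × S, ψ x = ψ₁ x.1 * ψ₂ x.2 := by
    intro x
    rw [hψ₁, hψ₂, AddChar.compAddMonoidHom_apply, AddChar.compAddMonoidHom_apply,
      ← AddChar.map_add_eq_mul]
    simp
  have h1 := h ψ₁ (by
    intro c hc
    have := hψ (c, 0) (by
      intro x
      rw [hsplit]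
      simpa using hc x.1)
    exact congrArg Prod.fst this) (fun i => (a i).1) (by
    intro c hc
    have := ha (c, 0) (by
      intro i
      ext
      · simpa using hc i
      · simp)
    exact congrArg Prod.fst this)
  have h2 := h' ψ₂ (by
    intro c hc
    have := hψ (0, c) (by
      intro x
      rw [hsplit]
      simpa using hc x.2)
    exact congrArg Prod.snd this) (fun i => (a i).2) (by
    intro c hc
    have := ha (0, c) (by
      intro i
      ext
      · simp
      · simpa using hc i)
    exact congrArg Prod.snd this)
  have hsum : completeSum ψ a =
      completeSum ψ₁ (fun i => (a i).1) * completeSum ψ₂ (fun i => (a i).2) := by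
    simp only [completeSum]
    rw [sum_mul_sum, Fintype.sum_prod_type]
    refine sum_congr rfl fun x _ => sum_congr rfl fun y _ => ?_
    rw [hsplit]
    simp [Prod.fst_sum, Prod.snd_sum]
  have hnil : #(nilTuples R K L) * #(nilTuples S K L) = #(nilTuples (R × S) K L) := by
    rw [← card_product]
    refine card_bij' (fun c _ i => (c.1 i, c.2 i)) (fun c _ => (fun i => (c i).1, fun i => (c i).2))
      ?_ ?_ ?_ ?_
    · intro c hc
      rw [mem_product, mem_nilTuples, mem_nilTuples] at hc
      rw [mem_nilTuples]
      ext
      · simpa [Prod.fst_prod] using hc.1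
      · simpa [Prod.snd_prod] using hc.2
    · intro c hc
      rw [mem_nilTuples] at hc
      rw [mem_product, mem_nilTuples, mem_nilTuples]
      constructor
      · simpa [Prod.fst_prod] using congrArg Prod.fst hc
      · simpa [Prod.snd_prod] using congrArg Prod.snd hc
    · intro c _; simp
    · intro c _; simp
  rw [hsum, Fintype.card_prod, ← hnil, norm_mul]
  push_cast
  have h3 := mul_le_mul h1 h2 (by positivity) (by positivity)
  calc _ = _ := by rw [mul_pow, mul_pow]; exact mul_mul_mul_comm _ _ _ _
    _ ≤ _ := h3
    _ = _ := by ring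

end Ring

lemma addChar_map_sum {A ι : Type*} [AddCommMonoid A] (ψ : AddChar A ℂ) (s : Finset ι) (f : ι → A) :
    ψ (∑ i ∈ s, f i) = ∏ i ∈ s, ψ (f i) := by
  classical
  induction s using Finset.induction_on with
  | empty => simp
  | insert i s hi ih => rw [sum_insert hi, prod_insert hi, AddChar.map_add_eq_mul, ih]

lemma PrimChar.isPrimitive {R : Type*} [CommRing R] {ψ : AddChar R ℂ} (hψ : PrimChar ψ) :
    ψ.IsPrimitive := by
  intro c hc h
  refine hc (hψ c fun x => ?_)
  have := DFunLike.congr_fun h x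
  simpa using this

section Newton
variable {F : Type*} [Field F]

/-- Newton's identities: the power sums determine the values. -/
lemma exists_eq_of_power_sums_eq {k : ℕ} (hF : ∀ n : ℕ, 0 < n → n ≤ k → (n : F) ≠ 0)
    {x y : Fin k → F} (h : ∀ n, 0 < n → n ≤ k → ∑ j, x j ^ n = ∑ j, y j ^ n) (j : Fin k) :
    ∃ i, x i = y j := by
  have hes : ∀ n, n ≤ k → MvPolynomial.aeval x (MvPolynomial.esymm (Fin k) F n) =
      MvPolynomial.aeval y (MvPolynomial.esymm (Fin k) F n) := by
    intro n
    induction n using Nat.strong_induction_on with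
    | _ n ih =>
      intro hn
      rcases Nat.eq_zero_or_pos n with h0 | h0
      · subst h0; simp
      · have h1 := congrArg (MvPolynomial.aeval x) (MvPolynomial.mul_esymm_eq_sum (Fin k) F n)
        have h2 := congrArg (MvPolynomial.aeval y) (MvPolynomial.mul_esymm_eq_sum (Fin k) F n)
        simp only [map_mul, map_sum, map_natCast, map_pow, map_neg, map_one] at h1 h2
        refine mul_left_cancel₀ (hF n h0 hn) ?_
        rw [h1, h2]
        congr 1
        refine sum_congr rfl fun a ha => ?_
        rw [mem_filter, HasAntidiagonal.mem_antidiagonal] at ha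
        rw [ih a.1 ha.2 (by omega)]
        congr 1
        simp only [MvPolynomial.psum, map_sum, map_pow, MvPolynomial.aeval_X]
        exact h _ (by omega) (by omega)
  have hprod : ∀ z : Fin k → F, ∀ t : F, ∏ i, (t + z i) = ∑ n ∈ range (k + 1),
      MvPolynomial.aeval z (MvPolynomial.esymm (Fin k) F n) * t ^ (k - n) := by
    intro z t
    have h1 := congrArg (fun q => Polynomial.eval t (Polynomial.map
      (MvPolynomial.aeval z : MvPolynomial (Fin k) F →ₐ[F] F).toRingHom q))
      (MvPolynomial.prod_C_add_X_eq_sum_esymm F (Fin k))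
    simpa [Polynomial.map_prod, Polynomial.eval_prod, Polynomial.map_sum,
      Polynomial.eval_finsetSum] using h1
  have h1 : ∏ i, (-(y j) + x i) = 0 := by
    rw [hprod, sum_congr rfl fun n hn => by rw [hes n (by have := mem_range.1 hn; omega)], ← hprod]
    exact prod_eq_zero (mem_univ j) (by ring)
  obtain ⟨i, -, hi⟩ := prod_eq_zero_iff.1 h1
  exact ⟨i, by linear_combination hi⟩

end Newton

section Mordell
variable {F : Type*} [Field F] [Fintype F]

lemma sum_char_inner [DecidableEq F] {ψ : AddChar F ℂ} (hψ : PrimChar ψ) {k : ℕ} (w : Fin k → F) :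
    ∑ a : Fin k → F, ψ (∑ i, a i * w i) = if w = 0 then (Fintype.card F : ℂ) ^ k else 0 := by
  have h1 : ∀ a : Fin k → F, ψ (∑ i, a i * w i) = ∏ i, ψ (a i * w i) := fun a =>
    addChar_map_sum _ _ _
  simp_rw [h1]
  rw [← Fintype.prod_sum fun i t => ψ (t * w i)]
  simp_rw [AddChar.sum_mulShift _ hψ.isPrimitive]
  split_ifs with h
  · subst h; simp
  · obtain ⟨i, hi⟩ := Function.ne_iff.1 h
    exact prod_eq_zero (mem_univ i) (by simpa using hi)

lemma completeSum_pow (ψ : AddChar F ℂ) {k : ℕ} (a : Fin k → F) (n : ℕ) :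
    completeSum ψ a ^ n = ∑ x : Fin n → F, ψ (∑ i, a i * ∑ j, x j ^ (i.1 + 1)) := by
  rw [completeSum, Fintype.sum_pow]
  refine sum_congr rfl fun x _ => ?_
  rw [← addChar_map_sum]
  congr 1
  rw [sum_comm]
  simp_rw [mul_sum]

lemma sum_norm_completeSum_pow_le {ψ : AddChar F ℂ} (hψ : PrimChar ψ) {k : ℕ}
    (hF : ∀ n : ℕ, 0 < n → n ≤ k → (n : F) ≠ 0) :
    ∑ a : Fin k → F, ‖completeSum ψ a‖ ^ (2 * k) ≤ (k : ℝ) ^ k * (Fintype.card F : ℝ) ^ (2 * k) := by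
  classical
  set s : (Fin k → F) → Fin k → F := fun x i => ∑ j, x j ^ (i.1 + 1) with hs
  have h1 : ∀ a : Fin k → F, ((‖completeSum ψ a‖ ^ (2 * k) : ℝ) : ℂ) =
      ∑ x : Fin k → F, ∑ y : Fin k → F, ψ (∑ i, a i * (s x - s y) i) := by
    intro a
    have : ((‖completeSum ψ a‖ ^ (2 * k) : ℝ) : ℂ) =
        completeSum ψ a ^ k * (starRingEnd ℂ) (completeSum ψ a ^ k) := by
      rw [Complex.mul_conj, Complex.normSq_eq_norm_sq, norm_pow]; push_cast; ring
    rw [this, completeSum_pow, map_sum, sum_mul_sum]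
    refine sum_congr rfl fun x _ => sum_congr rfl fun y _ => ?_
    rw [← AddChar.map_neg_eq_conj, ← AddChar.map_add_eq_mul]
    congr 1
    simp only [hs, Pi.sub_apply, mul_sub, sum_sub_distrib]; ring
  have h2 : ((∑ a : Fin k → F, ‖completeSum ψ a‖ ^ (2 * k) : ℝ) : ℂ) =
      ∑ x : Fin k → F, ∑ y : Fin k → F, if s x - s y = 0 then (Fintype.card F : ℂ) ^ k else 0 := by
    rw [Complex.ofReal_sum, sum_congr rfl fun a _ => h1 a, sum_comm]
    refine sum_congr rfl fun x _ => ?_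
    rw [sum_comm]
    exact sum_congr rfl fun y _ => sum_char_inner hψ _
  have h3 : ∑ a : Fin k → F, ‖completeSum ψ a‖ ^ (2 * k) =
      ∑ x : Fin k → F, ∑ y : Fin k → F, if s x - s y = 0 then (Fintype.card F : ℝ) ^ k else 0 := by
    rw [← Complex.ofReal_inj, h2]
    simp [apply_ite]
  have h4 : ∀ x : Fin k → F, #(univ.filter fun y : Fin k → F => s x - s y = 0) ≤ k ^ k := by
    intro x
    have hsub : (univ.filter fun y : Fin k → F => s x - s y = 0) ⊆
        Fintype.piFinset fun _ : Fin k => univ.image x := by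
      intro y hy
      have hy := sub_eq_zero.1 (mem_filter.1 hy).2
      rw [Fintype.mem_piFinset]
      intro j
      obtain ⟨i, hi⟩ := exists_eq_of_power_sums_eq hF (x := x) (y := y) (by
        intro n hn hnk
        have := congrFun hy ⟨n - 1, by omega⟩
        simp only [hs] at this
        rwa [Nat.sub_add_cancel hn] at this) j
      exact mem_image.2 ⟨i, mem_univ _, hi⟩
    refine (card_le_card hsub).trans ?_
    rw [Fintype.card_piFinset, prod_const, card_univ, Fintype.card_fin]
    refine Nat.pow_le_pow_left ?_ k
    exact card_image_le.trans (by simp)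
  rw [h3]
  calc _ ≤ ∑ x : Fin k → F, (k : ℝ) ^ k * (Fintype.card F : ℝ) ^ k := by
        refine sum_le_sum fun x _ => ?_
        rw [← sum_filter, sum_const, nsmul_eq_mul]
        refine mul_le_mul_of_nonneg_right ?_ (by positivity)
        exact_mod_cast h4 x
    _ = _ := by
        rw [sum_const, card_univ, Fintype.card_fun, Fintype.card_fin, nsmul_eq_mul]
        push_cast; ring

/-- The polynomial `∑ aᵢ X ^ (i + 1)`. -/
noncomputable def curvePoly {R : Type*} [CommRing R] {k : ℕ} (a : Fin k → R) : Polynomial R :=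
  ∑ i, Polynomial.C (a i) * Polynomial.X ^ (i.1 + 1)

lemma eval_curvePoly {R : Type*} [CommRing R] {k : ℕ} (a : Fin k → R) (x : R) :
    (curvePoly a).eval x = ∑ i, a i * x ^ (i.1 + 1) := by
  simp [curvePoly, Polynomial.eval_finsetSum]

lemma coeff_curvePoly {R : Type*} [CommRing R] {k : ℕ} (a : Fin k → R) (i : Fin k) :
    (curvePoly a).coeff (i.1 + 1) = a i := by
  rw [curvePoly, Polynomial.finsetSum_coeff, sum_eq_single i]
  · simp
  · intro j _ hj
    rw [Polynomial.coeff_C_mul_X_pow, if_neg]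
    intro h; exact hj (Fin.ext (by omega))
  · simp

lemma natDegree_curvePoly_le {R : Type*} [CommRing R] {k : ℕ} (a : Fin k → R) :
    (curvePoly a).natDegree ≤ k := by
  refine Polynomial.natDegree_sum_le_of_forall_le _ _ fun i _ => ?_
  exact (Polynomial.natDegree_C_mul_X_pow_le _ _).trans (by omega)

lemma coeff_zero_curvePoly {R : Type*} [CommRing R] {k : ℕ} (a : Fin k → R) :
    (curvePoly a).coeff 0 = 0 := by
  rw [curvePoly, Polynomial.finsetSum_coeff]
  exact sum_eq_zero fun i _ => by rw [Polynomial.coeff_C_mul_X_pow, if_neg (by omega)]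

/-- The coefficients of `f (u X + v) - f v`. -/
noncomputable def affineAct {k : ℕ} (a : Fin k → F) (w : F × F) : Fin k → F :=
  fun i => (Polynomial.taylor w.2 (curvePoly a)).coeff (i.1 + 1) * w.1 ^ (i.1 + 1)

lemma eval_affineAct {F : Type*} [Field F] {k : ℕ} (a : Fin k → F) (w : F × F) (x : F) :
    ∑ i, affineAct a w i * x ^ (i.1 + 1) =
      (curvePoly a).eval (w.1 * x + w.2) - (curvePoly a).eval w.2 := by
  have h1 := Polynomial.taylor_eval w.2 (curvePoly a) (w.1 * x)
  have h2 : (Polynomial.taylor w.2 (curvePoly a)).natDegree < k + 1 := by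
    rw [Polynomial.natDegree_taylor]; exact Nat.lt_succ_of_le (natDegree_curvePoly_le a)
  rw [← h1, Polynomial.eval_eq_sum_range' h2, sum_range_succ', Polynomial.taylor_coeff_zero,
    pow_zero, mul_one, add_sub_cancel_right, ← Fin.sum_univ_eq_sum_range
    (fun i => (Polynomial.taylor w.2 (curvePoly a)).coeff (i + 1) * (w.1 * x) ^ (i + 1))]
  refine sum_congr rfl fun i _ => ?_
  rw [affineAct]; ring

lemma norm_completeSum_affineAct (ψ : AddChar F ℂ) {k : ℕ} (a : Fin k → F) {w : F × F}
    (hw : w.1 ≠ 0) : ‖completeSum ψ (affineAct a w)‖ = ‖completeSum ψ a‖ := by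
  have h : completeSum ψ (affineAct a w) =
      ψ (-(curvePoly a).eval w.2) * completeSum ψ a := by
    simp only [completeSum, eval_affineAct]
    rw [mul_sum]
    let g : F ≃ F := (Equiv.mulLeft₀ w.1 hw).trans (Equiv.addRight w.2)
    refine Fintype.sum_equiv g _ _ fun x => ?_
    rw [← AddChar.map_add_eq_mul, ← eval_curvePoly]
    congr 1
    simp [g]; ring
  rw [h, norm_mul, AddChar.norm_apply, one_mul]

lemma card_affineAct_fiber_le [DecidableEq F] {k m : ℕ} {a : Fin k → F}
    (hF : ∀ n : ℕ, 0 < n → n ≤ k → (n : F) ≠ 0) (hm : (curvePoly a).natDegree = m + 2)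
    (b : Fin k → F) :
    #((univ.filter fun w : F × F => w.1 ≠ 0).filter fun w => affineAct a w = b) ≤ k := by
  have hmk : m + 2 ≤ k := hm ▸ natDegree_curvePoly_le a
  set f := curvePoly a with hf
  have hlead : f.coeff (m + 2) ≠ 0 := by
    rw [← hm]
    refine Polynomial.leadingCoeff_ne_zero.2 fun h => ?_
    rw [h] at hm; simp at hm
  set c := f.coeff (m + 2) with hc
  have htop : ∀ v : F, (Polynomial.taylor v f).coeff (m + 2) = c := by
    intro v
    have h1 := natDegree_taylor_sub_le (k := m + 1) hm.le v
    have h2 : (Polynomial.taylor v f - f).coeff (m + 2) = 0 :=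
      Polynomial.coeff_eq_zero_of_natDegree_lt (by omega)
    rw [Polynomial.coeff_sub, sub_eq_zero] at h2
    exact h2
  have hnext : ∀ v : F, (Polynomial.taylor v f).coeff (m + 1) =
      f.coeff (m + 1) + ((m + 2 : ℕ) : F) * v * c := by
    intro v
    have h1 := coeff_taylor_sub (k := m + 1) hm.le v
    rw [Polynomial.coeff_sub] at h1
    push_cast at h1 ⊢
    linear_combination h1
  have hb1 : ∀ w, affineAct a w = b → c * w.1 ^ (m + 2) = b ⟨m + 1, by omega⟩ := by
    intro w hw
    rw [← hw, affineAct]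
    simp only
    rw [← hf, htop]
  have hb2 : ∀ w, affineAct a w = b → (f.coeff (m + 1) + ((m + 2 : ℕ) : F) * w.2 * c) *
      w.1 ^ (m + 1) = b ⟨m, by omega⟩ := by
    intro w hw
    rw [← hw, affineAct]
    simp only
    rw [← hf, hnext]
  refine (card_le_card_of_injOn (t := (Polynomial.nthRoots (m + 2)
    (b ⟨m + 1, by omega⟩ / c)).toFinset) Prod.fst ?_ ?_).trans ?_
  · intro w hw
    have hw := (mem_filter.1 hw).2
    simp only [mem_coe, Multiset.mem_toFinset]
    rw [Polynomial.mem_nthRoots (by omega), eq_div_iff hlead, mul_comm]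
    exact hb1 w hw
  · intro w hw w' hw' hww
    have h0 := (mem_filter.1 (mem_filter.1 hw).1).2
    have h1 := hb2 w (mem_filter.1 hw).2
    have h2 := hb2 w' (mem_filter.1 hw').2
    rw [← hww, ← h1] at h2
    have h3 := mul_right_cancel₀ (pow_ne_zero _ h0) h2
    have h4 := mul_right_cancel₀ hlead (add_left_cancel h3)
    exact Prod.ext hww (mul_left_cancel₀ (hF (m + 2) (by omega) hmk) h4).symm
  · refine (Multiset.toFinset_card_le _).trans ((Polynomial.card_nthRoots _ _).trans hmk)

/-- Mordell's bound for complete exponential sums over a finite field. -/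
lemma mordell_bound {ψ : AddChar F ℂ} (hψ : PrimChar ψ) {k : ℕ}
    (hF : ∀ n : ℕ, 0 < n → n ≤ k → (n : F) ≠ 0) {a : Fin k → F} (ha : a ≠ 0) :
    (Fintype.card F : ℝ) * (Fintype.card F - 1) * ‖completeSum ψ a‖ ^ (2 * k) ≤
      (k : ℝ) ^ (k + 1) * (Fintype.card F : ℝ) ^ (2 * k) := by
  classical
  obtain ⟨i, hi⟩ := Function.ne_iff.1 ha
  have hk : 0 < k := i.pos
  have hdeg : 1 ≤ (curvePoly a).natDegree := by
    refine le_trans (by omega) (Polynomial.le_natDegree_of_ne_zero (n := i.1 + 1) ?_)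
    rw [coeff_curvePoly]; exact hi
  rcases Nat.eq_or_lt_of_le hdeg with h1 | h2
  · have hz : completeSum ψ a = 0 := by
      rw [completeSum]
      simp_rw [← eval_curvePoly]
      have : ∀ x : F, (curvePoly a).eval x = x * (curvePoly a).coeff 1 := by
        intro x
        rw [Polynomial.eval_eq_sum_range' (n := 2) (by omega), sum_range_succ, sum_range_one,
          coeff_zero_curvePoly]
        ring
      simp_rw [this]
      rw [AddChar.sum_mulShift _ hψ.isPrimitive, if_neg]
      · simp
      · have : (curvePoly a).coeff 1 = (curvePoly a).leadingCoeff := by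
          rw [Polynomial.leadingCoeff, ← h1]
        rw [this]
        refine Polynomial.leadingCoeff_ne_zero.2 fun h => ?_
        rw [h] at h1; simp at h1
    rw [hz, norm_zero, zero_pow (by omega), mul_zero]
    positivity
  · obtain ⟨m, hm⟩ : ∃ m, (curvePoly a).natDegree = m + 2 := ⟨(curvePoly a).natDegree - 2, by omega⟩
    set W := univ.filter fun w : F × F => w.1 ≠ 0 with hW
    have hWcard : (#W : ℝ) = Fintype.card F * (Fintype.card F - 1) := by
      have : W = (univ.erase (0 : F)) ×ˢ (univ : Finset F) := by
        ext w; simp [hW]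
      rw [this, card_product, card_erase_of_mem (mem_univ _), card_univ, Nat.cast_mul,
        Nat.cast_sub Fintype.card_pos]
      push_cast; ring
    have hsum : ∑ w ∈ W, ‖completeSum ψ (affineAct a w)‖ ^ (2 * k) =
        #W * ‖completeSum ψ a‖ ^ (2 * k) := by
      rw [sum_congr rfl fun w hw => by rw [norm_completeSum_affineAct ψ a (mem_filter.1 hw).2]]
      rw [sum_const, nsmul_eq_mul]
    rw [← hWcard, ← hsum, sum_comp (fun b => ‖completeSum ψ b‖ ^ (2 * k)) (affineAct a)]
    calc _ ≤ ∑ b ∈ W.image (affineAct a), (k : ℝ) * ‖completeSum ψ b‖ ^ (2 * k) := by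
          refine sum_le_sum fun b _ => ?_
          rw [nsmul_eq_mul]
          refine mul_le_mul_of_nonneg_right ?_ (by positivity)
          exact_mod_cast card_affineAct_fiber_le hF hm b
      _ ≤ ∑ b : Fin k → F, (k : ℝ) * ‖completeSum ψ b‖ ^ (2 * k) :=
          sum_le_sum_of_subset_of_nonneg (subset_univ _) fun _ _ _ => by positivity
      _ ≤ _ := by
          rw [← mul_sum, pow_succ', mul_assoc]
          exact mul_le_mul_of_nonneg_left (sum_norm_completeSum_pow_le hψ hF) (by positivity)

end Mordell

lemma norm_completeSum_le_card_critical {R : Type*} [CommRing R] [Fintype R] [DecidableEq R]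
    {ψ : AddChar R ℂ} (hψ : PrimChar ψ) {k : ℕ} (a : Fin k → R) {π : R} (hπ : π ^ 2 = 0) :
    ‖completeSum ψ a‖ ≤
      #(univ.filter fun x : R => π * (Polynomial.derivative (curvePoly a)).eval x = 0) := by
  set f' : R → R := fun x => (Polynomial.derivative (curvePoly a)).eval x with hf'
  have h1 : ∀ z : R, completeSum ψ a = ∑ x : R, ψ ((curvePoly a).eval x) * ψ (z * (π * f' x)) := by
    intro z
    rw [completeSum, ← Equiv.sum_comp (Equiv.addRight (π * z))]
    refine sum_congr rfl fun x _ => ?_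
    rw [← AddChar.map_add_eq_mul, Equiv.coe_addRight, ← eval_curvePoly,
      Polynomial.eval_add_of_sq_eq_zero _ _ _ (by rw [mul_pow, hπ, zero_mul])]
    congr 1
    simp only [hf']; ring
  have h2 : (Fintype.card R : ℂ) * completeSum ψ a =
      ∑ x : R, ψ ((curvePoly a).eval x) * if π * f' x = 0 then (Fintype.card R : ℂ) else 0 := by
    calc _ = ∑ _z : R, completeSum ψ a := by rw [sum_const, card_univ, nsmul_eq_mul]
      _ = _ := by
        rw [sum_congr rfl fun z _ => h1 z, sum_comm]
        refine sum_congr rfl fun x _ => ?_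
        rw [← mul_sum, AddChar.sum_mulShift _ hψ.isPrimitive]
        push_cast; rfl
  have h3 : (Fintype.card R : ℝ) * ‖completeSum ψ a‖ ≤
      Fintype.card R * #(univ.filter fun x : R => π * f' x = 0) := by
    have := congrArg norm h2
    rw [norm_mul, Complex.norm_natCast] at this
    rw [this]
    refine (norm_sum_le _ _).trans ?_
    have : ∀ x : R, ‖ψ ((curvePoly a).eval x) *
        (if π * f' x = 0 then (Fintype.card R : ℂ) else 0)‖ =
        if π * f' x = 0 then (Fintype.card R : ℝ) else 0 := by
      intro x
      rw [norm_mul, AddChar.norm_apply, one_mul]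
      split_ifs <;> simp
    rw [sum_congr rfl fun x _ => this x, ← sum_filter, sum_const, nsmul_eq_mul, mul_comm]
  have : (0 : ℝ) < Fintype.card R := by exact_mod_cast Fintype.card_pos
  exact le_of_mul_le_mul_left h3 this

section PrimePower
variable {p j : ℕ}

lemma natCast_pow_mul_eq_zero_iff (hp : 0 < p) (hj : 1 ≤ j) (y : ZMod (p ^ j)) :
    (p : ZMod (p ^ j)) ^ (j - 1) * y = 0 ↔
      ZMod.castHom (dvd_pow_self p (by omega : j ≠ 0)) (ZMod p) y = 0 := by
  have : NeZero (p ^ j) := ⟨by positivity⟩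
  obtain ⟨n, rfl⟩ := ZMod.natCast_zmod_surjective y
  rw [map_natCast, ZMod.natCast_eq_zero_iff, ← Nat.cast_pow, ← Nat.cast_mul,
    ZMod.natCast_eq_zero_iff]
  conv_lhs => rw [show p ^ j = p ^ (j - 1) * p by rw [← pow_succ, Nat.sub_add_cancel hj]]
  exact Nat.mul_dvd_mul_iff_left (by positivity)

lemma card_castHom_fiber_le (hp : 0 < p) (hj : 1 ≤ j) [NeZero (p ^ j)] (b : ZMod p) :
    #(univ.filter fun x : ZMod (p ^ j) =>
      ZMod.castHom (dvd_pow_self p (by omega : j ≠ 0)) (ZMod p) x = b) ≤ p ^ (j - 1) := by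
  rw [← card_range (p ^ (j - 1))]
  refine card_le_card_of_injOn (fun x => x.val / p) ?_ ?_
  · intro x _
    simp only [coe_range, Set.mem_Iio]
    rw [Nat.div_lt_iff_lt_mul hp, ← pow_succ, Nat.sub_add_cancel hj]
    exact ZMod.val_lt x
  · intro x hx y hy hxy
    have hx := (mem_filter.1 hx).2
    have hy := (mem_filter.1 hy).2
    have h1 : ((x.val : ℕ) : ZMod p) = ((y.val : ℕ) : ZMod p) := by
      rw [← ZMod.natCast_zmod_val x, map_natCast] at hx
      rw [← ZMod.natCast_zmod_val y, map_natCast] at hy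
      rw [hx, hy]
    rw [ZMod.natCast_eq_natCast_iff'] at h1
    have h2 : x.val / p = y.val / p := hxy
    refine ZMod.val_injective _ ?_
    rw [← Nat.div_add_mod x.val p, ← Nat.div_add_mod y.val p, h1, h2]

lemma norm_completeSum_primePow_le {k : ℕ} (hp : p.Prime) (hk : k < p) (hj : 2 ≤ j)
    [NeZero (p ^ j)] {ψ : AddChar (ZMod (p ^ j)) ℂ} (hψ : PrimChar ψ) {a : Fin k → ZMod (p ^ j)}
    (ha : Faithful a) : ‖completeSum ψ a‖ ≤ k * (p : ℝ) ^ (j - 1) := by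
  classical
  have := Fact.mk hp
  have hp0 := hp.pos
  set φ := ZMod.castHom (dvd_pow_self p (by omega : j ≠ 0)) (ZMod p) with hφ
  have hπ : ((p : ZMod (p ^ j)) ^ (j - 1)) ^ 2 = 0 := by
    rw [← pow_mul, ← Nat.cast_pow, ZMod.natCast_eq_zero_iff]
    exact pow_dvd_pow _ (by omega)
  refine (norm_completeSum_le_card_critical hψ a hπ).trans ?_
  obtain ⟨i, hi⟩ : ∃ i, φ (a i) ≠ 0 := by
    by_contra! h
    have h0 := ha ((p : ZMod (p ^ j)) ^ (j - 1)) fun i =>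
      (natCast_pow_mul_eq_zero_iff hp0 (by omega) _).2 (h i)
    rw [← Nat.cast_pow, ZMod.natCast_eq_zero_iff] at h0
    have := (Nat.pow_dvd_pow_iff_le_right hp.one_lt).1 h0
    omega
  set g := (Polynomial.derivative (curvePoly a)).map φ with hg
  have hg0 : g ≠ 0 := by
    intro h
    have h1 := congrArg (fun q => Polynomial.coeff q i.1) h
    simp only [hg, Polynomial.coeff_map, Polynomial.coeff_derivative, coeff_curvePoly, map_mul,
      Polynomial.coeff_zero] at h1
    rcases mul_eq_zero.1 h1 with h2 | h2
    · exact hi h2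
    · have : ((i.1 + 1 : ℕ) : ZMod p) = 0 := by push_cast; simpa using h2
      rw [ZMod.natCast_eq_zero_iff] at this
      have := Nat.le_of_dvd (by omega) this
      omega
  have hdeg : g.natDegree ≤ k := by
    refine Polynomial.natDegree_map_le.trans ((Polynomial.natDegree_derivative_le _).trans ?_)
    have := natDegree_curvePoly_le a
    omega
  have hcard : #(univ.filter fun x : ZMod (p ^ j) => (p : ZMod (p ^ j)) ^ (j - 1) *
      (Polynomial.derivative (curvePoly a)).eval x = 0) ≤ p ^ (j - 1) * #g.roots.toFinset := by
    refine card_le_mul_card_image_of_maps_to (f := φ) ?_ _ ?_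
    · intro x hx
      have hx := (natCast_pow_mul_eq_zero_iff hp0 (by omega) _).1 (mem_filter.1 hx).2
      rw [Multiset.mem_toFinset, Polynomial.mem_roots hg0, Polynomial.IsRoot, hg,
        Polynomial.eval_map_apply]
      exact hx
    · intro b _
      refine (card_le_card ?_).trans (card_castHom_fiber_le hp0 (by omega) b)
      intro x hx
      rw [mem_filter] at hx ⊢
      exact ⟨mem_univ _, hx.2⟩
  have h2 : #g.roots.toFinset ≤ k :=
    (Multiset.toFinset_card_le _).trans ((Polynomial.card_roots' g).trans hdeg)
  calc _ ≤ ((p ^ (j - 1) * k : ℕ) : ℝ) := by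
        exact_mod_cast hcard.trans (Nat.mul_le_mul_left _ h2)
    _ = _ := by push_cast; ring

end PrimePower

section WeakDecay
variable {r : ℕ} [NeZero r]

lemma exists_character_eq (ψ : AddChar (ZMod r) ℂ) :
    ∃ u : ℕ, ∀ n : ℕ, ψ (n : ZMod r) = e (u * n / r) := by
  have hr : r ≠ 0 := NeZero.ne r
  have h1 : ψ 1 ^ r = 1 := by
    rw [← AddChar.map_nsmul_eq_pow, nsmul_one, ZMod.natCast_self, AddChar.map_zero_eq_one]
  obtain ⟨u, -, hu⟩ := (Complex.isPrimitiveRoot_exp r hr).eq_pow_of_pow_eq_one h1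
  refine ⟨u, fun n => ?_⟩
  rw [← nsmul_one n, AddChar.map_nsmul_eq_pow, ← hu, ← Complex.exp_nat_mul, ← Complex.exp_nat_mul, e]
  congr 1
  push_cast
  ring

lemma sum_range_zmod (F : ZMod r → ℂ) (ℓ : ℕ) :
    ∑ d ∈ range (ℓ * r), F (d : ZMod r) = ℓ * ∑ x, F x := by
  induction ℓ with
  | zero => simp
  | succ ℓ ih =>
    rw [add_mul, one_mul, sum_range_add, ih]
    have : ∑ x ∈ range r, F ((ℓ * r + x : ℕ) : ZMod r) = ∑ x, F x := by
      refine sum_nbij' (fun d => (d : ZMod r)) ZMod.val ?_ ?_ ?_ ?_ ?_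
      · simp
      · intro x _; exact mem_range.2 (ZMod.val_lt x)
      · intro x hx; exact ZMod.val_cast_of_lt (mem_range.1 hx)
      · intro x _; simp
      · intro x _; simp
    rw [this]; push_cast; ring

lemma completeSum_weak_decay (k : ℕ) : ∃ C : ℕ, ∀ r : ℕ, ∀ [NeZero r], ∀ ψ : AddChar (ZMod r) ℂ,
    PrimChar ψ → ∀ a : Fin k → ZMod r, Faithful a →
    (r : ℝ) * ‖completeSum ψ a‖ ^ (C + 1) ≤ (3 * r) ^ (C + 1) := by
  obtain ⟨C, hC⟩ := inverseWeyl k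
  refine ⟨C, fun r _ ψ hψ a ha => ?_⟩
  have hr : 0 < r := Nat.pos_of_ne_zero (NeZero.ne r)
  have hr' : (0 : ℝ) < r := by exact_mod_cast hr
  set S := ‖completeSum ψ a‖ with hS
  have hSr : S ≤ r := by simpa using norm_completeSum_le ψ a
  rcases eq_or_lt_of_le (norm_nonneg (completeSum ψ a)) with h0 | h0
  · rw [hS, ← h0, zero_pow (by omega), mul_zero]; positivity
  change 0 < S at h0
  set Q := ⌈(r : ℝ) / S⌉₊ + 1 with hQ
  have h1 : 1 ≤ (r : ℝ) / S := by rwa [one_le_div h0]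
  have hQ2 : 2 ≤ Q := by
    have : 0 < ⌈(r : ℝ) / S⌉₊ := Nat.ceil_pos.2 (by positivity)
    omega
  have hQle : (Q : ℝ) ≤ 3 * r / S := by
    have := Nat.ceil_lt_add_one (by positivity : 0 ≤ (r : ℝ) / S)
    rw [hQ, mul_div_assoc]; push_cast; linarith
  have hQge : (r : ℝ) ≤ Q * S := by
    have := Nat.le_ceil ((r : ℝ) / S)
    rw [← div_le_iff₀ h0, hQ]; push_cast; linarith
  obtain ⟨u, hu⟩ := exists_character_eq ψ
  set ℓ := Q ^ C + 1 with hℓ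
  set P : Polynomial ℝ := curvePoly fun i => (u * (a i).val / r : ℝ) with hP
  have hPe : ∀ d : ℕ, e (P.eval (d : ℝ)) = ψ (∑ i, a i * (d : ZMod r) ^ (i.1 + 1)) := by
    intro d
    have h2 : (∑ i, a i * (d : ZMod r) ^ (i.1 + 1)) =
        ((∑ i, (a i).val * d ^ (i.1 + 1) : ℕ) : ZMod r) := by
      push_cast; simp
    rw [h2, hu, hP, eval_curvePoly]
    congr 1
    push_cast
    rw [mul_sum, sum_div]
    exact sum_congr rfl fun i _ => by ring
  have hweyl : weylSum P (ℓ * r) = ℓ * completeSum ψ a := by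
    rw [weylSum, sum_congr rfl fun d _ => hPe d]
    exact sum_range_zmod (fun x => ψ (∑ i, a i * x ^ (i.1 + 1))) ℓ
  obtain ⟨q, hq0, hqC, hq⟩ := hC Q hQ2 (ℓ * r) (by positivity) P (natDegree_curvePoly_le _) (by
    rw [hweyl, norm_mul, Complex.norm_natCast]
    push_cast
    have : (0 : ℝ) ≤ ℓ := by positivity
    nlinarith)
  have hqu : ∀ i, ((q * u : ℕ) : ZMod r) * a i = 0 := by
    intro i
    obtain ⟨n, hn⟩ := hq (i.1 + 1) (by omega) (by omega)
    rw [hP, coeff_curvePoly] at hn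
    have h3 : (Q : ℝ) ^ C / ((ℓ * r : ℕ) : ℝ) ^ (i.1 + 1) < 1 / r := by
      have hl : (1 : ℝ) ≤ ((ℓ * r : ℕ) : ℝ) := by
        exact_mod_cast Nat.succ_le_of_lt (by positivity)
      calc _ ≤ (Q : ℝ) ^ C / ((ℓ * r : ℕ) : ℝ) :=
            div_le_div_of_nonneg_left (by positivity) (by linarith) (le_self_pow₀ hl (by omega))
        _ < _ := by
          rw [div_lt_div_iff₀ (by linarith) hr', hℓ]; push_cast; nlinarith
    have h4 : |((q * u * (a i).val : ℕ) : ℝ) - ((n * r : ℤ) : ℝ)| < 1 := by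
      have h5 : (((q * u * (a i).val : ℕ) : ℝ) - ((n * r : ℤ) : ℝ)) =
          r * (q * (u * (a i).val / r) - n) := by
        push_cast; field_simp
      rw [h5, abs_mul, abs_of_pos hr']
      calc _ < (r : ℝ) * (1 / r) := mul_lt_mul_of_pos_left (hn.trans_lt h3) hr'
        _ = 1 := by field_simp
    have h6 : ((q * u * (a i).val : ℕ) : ℤ) = n * r := by
      rw [← sub_eq_zero, ← Int.abs_lt_one_iff]
      exact_mod_cast h4
    have h7 : ((q * u * (a i).val : ℕ) : ZMod r) = 0 := by
      rw [← Int.cast_natCast, h6]; simp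
    simpa using h7
  have hqu0 := ha _ hqu
  have hrq : (q : ZMod r) = 0 := by
    refine hψ _ fun x => ?_
    obtain ⟨n, rfl⟩ := ZMod.natCast_zmod_surjective x
    rw [← Nat.cast_mul, hu]
    rw [ZMod.natCast_eq_zero_iff] at hqu0
    obtain ⟨m, hm⟩ := hqu0
    have : (u : ℝ) * ((q * n : ℕ) : ℝ) / r = ((m * n : ℤ) : ℝ) := by
      have hm' : (q : ℝ) * u = r * m := by exact_mod_cast hm
      push_cast
      field_simp
      linear_combination n * hm'
    rw [this, e_int]
  rw [ZMod.natCast_eq_zero_iff] at hrq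
  have hrQ : (r : ℝ) ≤ (3 * r / S) ^ C := by
    calc (r : ℝ) ≤ (Q : ℝ) ^ C := by exact_mod_cast (Nat.le_of_dvd hq0 hrq).trans hqC
      _ ≤ _ := pow_le_pow_left₀ (by positivity) hQle C
  rw [div_pow, le_div_iff₀ (by positivity)] at hrQ
  calc (r : ℝ) * S ^ (C + 1) = (r * S ^ C) * S := by ring
    _ ≤ (3 * r) ^ C * (3 * r) := by
      apply mul_le_mul hrQ (by linarith) h0.le (by positivity)
    _ = _ := by ring

end WeakDecay

lemma GaussBound.mono {k K L : ℕ} {B B' : ℝ} {R : Type*} [CommRing R] [Fintype R]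
    (h : GaussBound k K L B R) (hB : B ≤ B') : GaussBound k K L B' R := fun ψ hψ a ha =>
  (h ψ hψ a ha).trans (by gcongr)

lemma card_nilTuples_ge {R : Type*} [CommRing R] [Fintype R] [DecidableEq R] {K L : ℕ} {A : ℝ}
    (hA : A ≤ #(univ.filter fun x : R => x ^ L = 0)) :
    (Fintype.card R : ℝ) ^ K - (Fintype.card R - A) ^ K ≤ #(nilTuples R K L) := by
  set N := univ.filter fun x : R => x ^ L = 0 with hN
  have hsub : (Fintype.piFinset fun _ : Fin K => Nᶜ)ᶜ ⊆ nilTuples R K L := by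
    intro c hc
    rw [mem_compl, Fintype.mem_piFinset] at hc
    push Not at hc
    obtain ⟨i, hi⟩ := hc
    rw [mem_compl, not_not, hN, mem_filter] at hi
    rw [mem_nilTuples, ← prod_pow]
    exact prod_eq_zero (mem_univ i) hi.2
  have h1 := card_le_card hsub
  have h2 := card_compl_add_card (Fintype.piFinset fun _ : Fin K => Nᶜ)
  rw [Fintype.card_piFinset, prod_const, card_univ, Fintype.card_fin, Fintype.card_fun,
    Fintype.card_fin] at h2
  have h3 := card_compl_add_card N
  have h4 : (Fintype.card R : ℝ) ^ K - (#(Nᶜ) : ℝ) ^ K ≤ #(nilTuples R K L) := by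
    have h5 : (#((Fintype.piFinset fun _ : Fin K => Nᶜ)ᶜ) : ℝ) + (#(Nᶜ) : ℝ) ^ K =
        (Fintype.card R : ℝ) ^ K := by exact_mod_cast h2
    have h6 : (#((Fintype.piFinset fun _ : Fin K => Nᶜ)ᶜ) : ℝ) ≤ #(nilTuples R K L) := by
      exact_mod_cast h1
    linarith
  have h7 : (#(Nᶜ) : ℝ) + #N = Fintype.card R := by exact_mod_cast h3
  have h8 : (#(Nᶜ) : ℝ) ^ K ≤ (Fintype.card R - A) ^ K :=
    pow_le_pow_left₀ (by positivity) (by linarith) K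
  linarith

lemma card_nilTuples_primePow_ge {p j n r K L : ℕ} [NeZero r] (hp : 0 < p) (hr : r = p ^ j)
    (hnj : n ≤ j) (hL : j ≤ n * L) :
    (r : ℝ) ^ K * (1 - (1 - 1 / (p : ℝ) ^ n) ^ K) ≤ #(nilTuples (ZMod r) K L) := by
  have hp' : (0 : ℝ) < p := by exact_mod_cast hp
  have hA : p ^ (j - n) ≤ #(univ.filter fun x : ZMod r => x ^ L = 0) := by
    rw [← card_range (p ^ (j - n))]
    refine card_le_card_of_injOn (fun y => ((p ^ n * y : ℕ) : ZMod r)) ?_ ?_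
    · intro y _
      simp only [coe_filter, mem_univ, true_and, Set.mem_ofPred_eq]
      rw [← Nat.cast_pow, ZMod.natCast_eq_zero_iff, mul_pow, ← pow_mul, hr]
      exact (pow_dvd_pow p hL).mul_right _
    · intro y hy z hz hyz
      have hlt : ∀ y ∈ range (p ^ (j - n)), p ^ n * y < r := by
        intro y hy
        have : r = p ^ n * p ^ (j - n) := by rw [hr, ← pow_add, Nat.add_sub_cancel' hnj]
        rw [this]
        exact Nat.mul_lt_mul_of_pos_left (mem_range.1 hy) (by positivity)
      have h1 := congrArg ZMod.val hyz
      simp only at h1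
      rw [ZMod.val_cast_of_lt (hlt y hy), ZMod.val_cast_of_lt (hlt z hz)] at h1
      exact Nat.eq_of_mul_eq_mul_left (by positivity) h1
  have h1 := card_nilTuples_ge (R := ZMod r) (K := K) (L := L) (A := (p : ℝ) ^ (j - n))
    (by exact_mod_cast hA)
  rw [ZMod.card] at h1
  refine le_trans (le_of_eq ?_) h1
  have h2 : (r : ℝ) - (p : ℝ) ^ (j - n) = r * (1 - 1 / (p : ℝ) ^ n) := by
    have : (r : ℝ) = p ^ (j - n) * p ^ n := by
      rw [hr, ← pow_add, Nat.sub_add_cancel hnj]; push_cast; rfl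
    rw [this]; field_simp
  rw [h2, mul_pow]; ring

lemma div_le_one_sub_pow {t : ℝ} (h0 : 0 ≤ t) (h1 : t ≤ 1) (K : ℕ) :
    K * t / (1 + K * t) ≤ 1 - (1 - t) ^ K := by
  have h2 : 1 + K * t ≤ (1 + t) ^ K := one_add_mul_le_pow (by linarith) K
  have h3 : (1 - t) ^ K * (1 + K * t) ≤ 1 := by
    calc _ ≤ (1 - t) ^ K * (1 + t) ^ K :=
          mul_le_mul_of_nonneg_left h2 (pow_nonneg (by linarith) K)
      _ = (1 - t ^ 2) ^ K := by rw [← mul_pow]; ring_nf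
      _ ≤ 1 := pow_le_one₀ (by nlinarith) (by nlinarith)
  rw [div_le_iff₀ (by positivity)]
  nlinarith

lemma gauss_step {S r B Φ N : ℝ} {k K : ℕ} (hr : 0 < r) (hB : 0 ≤ B) (h : (S / r) ^ k ≤ B * Φ)
    (hN : r ^ K * Φ ≤ N) : S ^ k * r ^ K ≤ B * N * r ^ k := by
  rw [div_pow, div_le_iff₀ (by positivity)] at h
  calc _ ≤ B * Φ * r ^ k * r ^ K := by gcongr
    _ = B * (r ^ K * Φ) * r ^ k := by ring
    _ ≤ _ := by gcongr

lemma exists_gaussBound_primePow {k : ℕ} (hk : 1 ≤ k) : ∃ K L : ℕ, 1 ≤ K ∧ 1 ≤ L ∧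
    ∀ p : ℕ, p.Prime → ∀ j : ℕ, 1 ≤ j → ∀ [NeZero (p ^ j)],
      GaussBound k K L (if p ≤ K then 2 else 1) (ZMod (p ^ j)) := by
  obtain ⟨C, hC⟩ := completeSum_weak_decay k
  set D := C + 1 with hD
  set K := 8 * k ^ (k + 1) with hK
  have hKk : 8 * k ≤ K := by
    rw [hK]; exact Nat.mul_le_mul_left _ (Nat.le_self_pow (by omega) k)
  refine ⟨K, 4 * D, by omega, by omega, fun p hp j hj _ => ?_⟩
  have hp0 : (0 : ℝ) < p := by exact_mod_cast hp.pos
  have hp1 : (1 : ℝ) ≤ p := by exact_mod_cast hp.pos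
  have hp2 : (2 : ℝ) ≤ p := by exact_mod_cast hp.two_le
  have hB : (0 : ℝ) ≤ (if p ≤ K then 2 else 1) := by split_ifs <;> norm_num
  have hB1 : (1 : ℝ) ≤ (if p ≤ K then 2 else 1) := by split_ifs <;> norm_num
  have hr0 : (0 : ℝ) < ((p ^ j : ℕ) : ℝ) := by push_cast; positivity
  by_cases hjL : 4 * D < j
  · intro ψ hψ a ha
    rw [ZMod.card]
    set n := j / (4 * D) + 1 with hn
    have hnL : j ≤ n * (4 * D) := by
      have := Nat.lt_div_mul_add (a := j) (b := 4 * D) (by omega)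
      rw [hn]; linarith
    have hn4 : n * (4 * D) ≤ j + 4 * D := by
      have := Nat.div_mul_le_self j (4 * D)
      rw [hn]; linarith
    have hnj : n ≤ j := by nlinarith
    refine gauss_step (Φ := 1 / (p : ℝ) ^ n) hr0 hB ?_ (le_trans ?_
      (card_nilTuples_primePow_ge hp.pos rfl hnj hnL))
    · refine le_trans ?_ (le_mul_of_one_le_left (by positivity) hB1)
      have h1 := hC (p ^ j) ψ hψ a ha
      set S := ‖completeSum ψ a‖
      have h2 : (S / ((p ^ j : ℕ) : ℝ)) ^ D ≤ 3 ^ D / p ^ j := by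
        rw [div_pow, div_le_div_iff₀ (by positivity) (by positivity)]
        rw [mul_pow] at h1
        push_cast at h1 ⊢
        linarith
      refine le_of_pow_le_pow_left₀ (n := D) (by omega) (by positivity) ?_
      calc _ = ((S / ((p ^ j : ℕ) : ℝ)) ^ D) ^ k := by rw [← pow_mul, ← pow_mul, mul_comm]
        _ ≤ (3 ^ D / (p : ℝ) ^ j) ^ k := pow_le_pow_left₀ (by positivity) h2 k
        _ ≤ (((p : ℝ) ^ 2) ^ D / (p : ℝ) ^ j) ^ k := by
          gcongr
          nlinarith
        _ ≤ _ := by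
          rw [div_pow, div_pow, one_pow, div_le_div_iff₀ (by positivity) (by positivity), one_mul,
            ← pow_mul, ← pow_mul, ← pow_mul, ← pow_mul, ← pow_add]
          refine pow_le_pow_right₀ hp1 ?_
          nlinarith
    · refine mul_le_mul_of_nonneg_left ?_ (by positivity)
      have ht : 1 / (p : ℝ) ^ n ≤ 1 := by
        rw [div_le_one (by positivity)]; exact one_le_pow₀ hp1
      have : (1 - 1 / (p : ℝ) ^ n) ^ K ≤ 1 - 1 / (p : ℝ) ^ n :=
        pow_le_of_le_one (by linarith) (by linarith [show 0 ≤ 1 / (p : ℝ) ^ n by positivity])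
          (by omega)
      linarith
  · have hΦ : ∀ r : ℕ, ∀ [NeZero r], r = p ^ j →
        (r : ℝ) ^ K * (K / (p + K)) ≤ #(nilTuples (ZMod r) K (4 * D)) := by
      intro r _ hr
      refine le_trans (mul_le_mul_of_nonneg_left ?_ (by positivity))
        (card_nilTuples_primePow_ge (n := 1) hp.pos hr hj (by omega))
      refine le_trans (le_of_eq ?_) (div_le_one_sub_pow (by positivity) ?_ K)
      · rw [pow_one]; field_simp
      · rw [pow_one, div_le_one hp0]; exact hp1
    by_cases hpK : p ≤ K
    · intro ψ hψ a ha
      rw [if_pos hpK, ZMod.card]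
      refine gauss_step hr0 zero_le_two ?_ (hΦ _ rfl)
      have hpK' : (p : ℝ) ≤ K := by exact_mod_cast hpK
      have h1 := norm_completeSum_le ψ a
      rw [ZMod.card] at h1
      calc _ ≤ (1 : ℝ) := pow_le_one₀ (by positivity) (by rwa [div_le_one hr0])
        _ ≤ _ := by rw [mul_div, le_div_iff₀ (by positivity)]; linarith
    · rw [if_neg hpK]
      have hpK' : (K : ℝ) ≤ p := by exact_mod_cast (not_le.1 hpK).le
      have hK0 : (1 : ℝ) ≤ K := by exact_mod_cast (by omega : 1 ≤ K)
      have hΦ2 : (K : ℝ) / (2 * p) ≤ K / (p + K) := by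
        rw [div_le_div_iff₀ (by positivity) (by positivity)]; nlinarith
      rcases eq_or_lt_of_le hj with h1j | h1j
      · subst h1j
        have := Fact.mk hp
        refine GaussBound.of_equiv (R := ZMod p) ?_ (ZMod.ringEquivCongr (pow_one p).symm)
        intro ψ hψ a ha
        rw [ZMod.card]
        refine gauss_step hp0 zero_le_one ?_ (hΦ p (pow_one p).symm)
        rw [one_mul]
        refine le_trans ?_ hΦ2
        have hm := mordell_bound (k := k) hψ (a := a) (by
          intro n hn hnk h
          rw [ZMod.natCast_eq_zero_iff] at h
          have := Nat.le_of_dvd hn h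
          omega) (by
          rintro rfl
          exact one_ne_zero (ha 1 (by simp)))
        rw [ZMod.card] at hm
        set S := ‖completeSum ψ a‖
        refine le_of_pow_le_pow_left₀ (n := 2) (by omega) (by positivity) ?_
        rw [← pow_mul, mul_comm k 2, div_pow, div_pow, div_le_div_iff₀ (by positivity)
          (by positivity)]
        have h8 : (8 : ℝ) * k ^ (k + 1) = K := by rw [hK]; push_cast; rfl
        have h9 : S ^ (2 * k) * (p : ℝ) ^ 2 ≤ 2 * (p * (p - 1) * S ^ (2 * k)) := by
          have : 0 ≤ S ^ (2 * k) := by positivity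
          have : (0 : ℝ) ≤ p * (p - 2) := by nlinarith
          nlinarith
        calc _ = 4 * (S ^ (2 * k) * (p : ℝ) ^ 2) := by ring
          _ ≤ 4 * (2 * (k ^ (k + 1) * (p : ℝ) ^ (2 * k))) := by linarith
          _ = K * (p : ℝ) ^ (2 * k) := by rw [← h8]; ring
          _ ≤ _ := by
            refine mul_le_mul_of_nonneg_right ?_ (by positivity)
            nlinarith
      · intro ψ hψ a ha
        rw [ZMod.card]
        refine gauss_step hr0 zero_le_one ?_ (hΦ _ rfl)
        rw [one_mul]
        refine le_trans ?_ hΦ2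
        have h1 := norm_completeSum_primePow_le hp (by omega) h1j hψ ha
        have h2 : ‖completeSum ψ a‖ / ((p ^ j : ℕ) : ℝ) ≤ k / p := by
          rw [div_le_div_iff₀ hr0 hp0]
          have : ((p ^ j : ℕ) : ℝ) = p ^ (j - 1) * p := by
            rw [← pow_succ, Nat.sub_add_cancel hj]; push_cast; rfl
          rw [this, ← mul_assoc]
          gcongr
        have h3 : (k : ℝ) / p ≤ 1 := by
          rw [div_le_one hp0]; exact_mod_cast (by omega : k ≤ p)
        calc _ ≤ ‖completeSum ψ a‖ / ((p ^ j : ℕ) : ℝ) :=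
              pow_le_of_le_one (by positivity) (h2.trans h3) (by omega)
          _ ≤ k / p := h2
          _ ≤ _ := by
            rw [div_le_div_iff₀ hp0 (by positivity)]
            have : (8 : ℝ) * k ≤ K := by exact_mod_cast hKk
            nlinarith

theorem exists_gaussBound {k : ℕ} (hk : 1 ≤ k) : ∃ K L : ℕ, 1 ≤ K ∧ 1 ≤ L ∧ ∃ B : ℝ, 0 < B ∧
    ∀ r : ℕ, ∀ [NeZero r], GaussBound k K L B (ZMod r) := by
  obtain ⟨K, L, hK, hL, h⟩ := exists_gaussBound_primePow hk
  refine ⟨K, L, hK, hL, 2 ^ (K + 1), by positivity, ?_⟩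
  have key : ∀ r : ℕ, ∀ [NeZero r],
      GaussBound k K L (2 ^ #(r.primeFactors.filter (· ≤ K))) (ZMod r) := by
    intro r
    induction r using Nat.recOnPosPrimePosCoprime with
    | zero => intro h; exact absurd rfl h.ne
    | one =>
      intro _ ψ hψ a ha
      have h1 := norm_completeSum_le ψ a
      rw [ZMod.card, Nat.cast_one] at h1
      have h2 : (1 : ℝ) ≤ #(nilTuples (ZMod 1) K L) := by
        have : 0 < #(nilTuples (ZMod 1) K L) :=
          card_pos.2 ⟨0, mem_nilTuples.2 (Subsingleton.elim _ _)⟩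
        exact_mod_cast this
      have h3 : ‖completeSum ψ a‖ ^ k ≤ 1 := pow_le_one₀ (norm_nonneg _) h1
      rw [ZMod.card]
      simp
      linarith
    | prime_pow p n hp hn =>
      intro _
      refine (h p hp n hn).mono ?_
      rw [Nat.primeFactors_prime_pow hn.ne' hp, filter_singleton]
      split_ifs <;> simp
    | coprime a b ha hb hab iha ihb =>
      intro _
      have : NeZero a := ⟨by omega⟩
      have : NeZero b := ⟨by omega⟩
      have := (iha.prod (by positivity) ihb).of_equiv (ZMod.chineseRemainder hab).symm
      refine this.mono (le_of_eq ?_)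
      rw [hab.primeFactors_mul, filter_union, card_union_of_disjoint, pow_add]
      exact disjoint_filter_filter hab.disjoint_primeFactors
  intro r _
  refine (key r).mono (pow_le_pow_right₀ one_le_two ?_)
  rw [← card_range (K + 1)]
  refine card_le_card fun x hx => ?_
  have := (mem_filter.1 hx).2
  exact mem_range.2 (by omega)

lemma primChar_stdAddChar (r : ℕ) [NeZero r] : PrimChar (ZMod.stdAddChar (N := r)) := by
  intro c hc
  by_contra h
  refine ZMod.isPrimitive_stdAddChar r h ?_
  ext x
  simpa using hc x

lemma stdAddChar_intCast (r : ℕ) [NeZero r] (n : ℤ) :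
    ZMod.stdAddChar (n : ZMod r) = e (n / r) := by
  rw [ZMod.stdAddChar_coe, e]
  congr 1
  push_cast
  ring

lemma norm_weylSum_le_completeSum {k r M : ℕ} [NeZero r] (hM : 0 < M) (hrM : r ≤ M)
    {θ : Fin k → ℝ} {a : Fin k → ℤ} {E : ℝ} (hE : 0 ≤ E)
    (h : ∀ i, |r * θ i - a i| ≤ E / (M : ℝ) ^ (i.1 + 1)) :
    ‖weylSum (curvePoly θ) M‖ ≤
      M * (‖completeSum (ZMod.stdAddChar (N := r)) fun i => (a i : ZMod r)‖ / r) +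
        (7 * (k ^ 2 * 2 ^ k * E) + 2 * r) := by
  have hr : (0 : ℝ) < r := by exact_mod_cast Nat.pos_of_ne_zero (NeZero.ne r)
  have hM' : (0 : ℝ) < M := by exact_mod_cast hM
  have hrM' : (r : ℝ) ≤ M := by exact_mod_cast hrM
  set P := curvePoly θ
  set G := completeSum (ZMod.stdAddChar (N := r)) fun i => (a i : ZMod r) with hG
  set β : Fin k → ℝ := fun i => θ i - a i / r with hβ
  have hβle : ∀ i, r * |β i| ≤ E / (M : ℝ) ^ (i.1 + 1) := by
    intro i
    have h1 : r * |β i| = |r * β i| := by rw [abs_mul, abs_of_pos hr]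
    rw [h1]
    refine le_trans (le_of_eq ?_) (h i)
    congr 1
    simp only [hβ]; field_simp
  have hper : ∀ d : ℕ, ∑ t ∈ range r,
      e (∑ i, (a i * (d + t : ℝ) ^ (i.1 + 1)) / r) = G := by
    intro d
    have h1 := sum_range_zmod (fun x : ZMod r => ZMod.stdAddChar
      (∑ i, (a i : ZMod r) * ((d : ZMod r) + x) ^ (i.1 + 1))) 1
    rw [Nat.cast_one, one_mul, one_mul] at h1
    rw [hG, completeSum, ← Equiv.sum_comp (Equiv.addLeft (d : ZMod r))]
    simp only [Equiv.coe_addLeft]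
    rw [← h1]
    refine sum_congr rfl fun t _ => ?_
    have h2 : (∑ i, (a i : ZMod r) * ((d : ZMod r) + t) ^ (i.1 + 1)) =
        ((∑ i, a i * ((d : ℤ) + t) ^ (i.1 + 1) : ℤ) : ZMod r) := by push_cast; rfl
    rw [h2, stdAddChar_intCast]
    congr 1
    push_cast
    rw [sum_div]
  have hshort : ∀ d ∈ range M, ‖∑ t ∈ range r, e (P.eval ((d + 1 * t : ℕ) : ℝ))‖ ≤
      ‖G‖ + r * (7 * (k ^ 2 * 2 ^ k * E) / M) := by
    intro d hd
    have hd := mem_range.1 hd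
    have hd' : (d : ℝ) ≤ M := by exact_mod_cast hd.le
    have h1 : ∑ t ∈ range r, e (P.eval ((d + 1 * t : ℕ) : ℝ)) =
        e (∑ i, β i * (d : ℝ) ^ (i.1 + 1)) * G + ∑ t ∈ range r,
          (e (P.eval ((d + 1 * t : ℕ) : ℝ)) - e (∑ i, (a i * (d + t : ℝ) ^ (i.1 + 1)) / r +
            ∑ i, β i * (d : ℝ) ^ (i.1 + 1))) := by
      rw [← hper d, mul_sum, ← sum_add_distrib]
      refine sum_congr rfl fun t _ => ?_
      rw [e_add]; ring
    rw [h1]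
    refine (norm_add_le _ _).trans ?_
    rw [norm_mul, norm_e, one_mul]
    refine add_le_add le_rfl ((norm_sum_le _ _).trans ?_)
    calc _ ≤ ∑ t ∈ range r, 7 * (k ^ 2 * 2 ^ k * E) / (M : ℝ) := by
          refine sum_le_sum fun t ht => ?_
          have ht := mem_range.1 ht
          have ht' : (t : ℝ) ≤ r := by exact_mod_cast ht.le
          refine (norm_e_sub_e_le _ _ 0).trans ?_
          rw [mul_div_assoc]
          refine mul_le_mul_of_nonneg_left ?_ (by norm_num)
          have h2 : P.eval ((d + 1 * t : ℕ) : ℝ) - (∑ i, (a i * (d + t : ℝ) ^ (i.1 + 1)) / r +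
            ∑ i, β i * (d : ℝ) ^ (i.1 + 1)) - ((0 : ℤ) : ℝ) =
              ∑ i, β i * (((d : ℝ) + t) ^ (i.1 + 1) - (d : ℝ) ^ (i.1 + 1)) := by
            rw [eval_curvePoly, Int.cast_zero, sub_zero, ← sum_add_distrib, ← sum_sub_distrib]
            refine sum_congr rfl fun i _ => ?_
            simp only [hβ]; push_cast; ring
          rw [h2]
          refine (abs_sum_le_sum_abs _ _).trans ?_
          calc _ ≤ ∑ _i : Fin k, (k : ℝ) * 2 ^ k * E / M := by
                refine sum_le_sum fun i _ => ?_
                rw [abs_mul]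
                have h3 : |((d : ℝ) + t) ^ (i.1 + 1) - (d : ℝ) ^ (i.1 + 1)| ≤
                    r * k * (2 * M) ^ i.1 := by
                  refine (abs_pow_sub_pow_le _ _ _).trans ?_
                  rw [add_sub_cancel_left, abs_of_nonneg (by positivity), Nat.add_sub_cancel]
                  have hmax : max |(d : ℝ) + t| |(d : ℝ)| ≤ 2 * M := by
                    rw [abs_of_nonneg (by positivity), abs_of_nonneg (by positivity)]
                    exact max_le (by linarith) (by linarith)
                  have hik : ((i.1 + 1 : ℕ) : ℝ) ≤ k := by exact_mod_cast i.2
                  gcongr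
                have h4 : (2 : ℝ) ^ i.1 ≤ 2 ^ k := pow_le_pow_right₀ one_le_two i.2.le
                calc _ ≤ |β i| * (r * k * (2 * M) ^ i.1) := by gcongr
                  _ = r * |β i| * (k * (2 * M) ^ i.1) := by ring
                  _ ≤ E / (M : ℝ) ^ (i.1 + 1) * (k * (2 * M) ^ i.1) := by
                    gcongr; exact hβle i
                  _ = k * 2 ^ i.1 * E / M := by rw [mul_pow, pow_succ]; field_simp
                  _ ≤ _ := by gcongr
            _ = _ := by
                rw [sum_const, card_univ, Fintype.card_fin, nsmul_eq_mul]; ring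
      _ = _ := by rw [sum_const, card_range, nsmul_eq_mul]
  have h1 := norm_sum_le_average (fun d => e (P.eval (d : ℝ))) (fun d => (norm_e _).le) M r 1
  have h2 := h1.trans (add_le_add (sum_le_sum hshort) le_rfl)
  rw [sum_const, card_range, nsmul_eq_mul] at h2
  refine le_of_mul_le_mul_left (h2.trans (le_of_eq ?_)) hr
  push_cast
  field_simp
  ring

lemma exists_faithful_approx {k q : ℕ} (hq : 0 < q) {θ ε : Fin k → ℝ}
    (h : ∀ i, NearInt (q * θ i) (ε i)) :
    ∃ r : ℕ, 0 < r ∧ r ≤ q ∧ ∃ a : Fin k → ℤ, (∀ i, |r * θ i - a i| ≤ ε i) ∧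
      Faithful fun i => (a i : ZMod r) := by
  classical
  have hex : ∃ r : ℕ, 0 < r ∧ ∀ i, NearInt (r * θ i) (ε i) := ⟨q, hq, h⟩
  set r := Nat.find hex with hr
  obtain ⟨hr0, hrn⟩ := Nat.find_spec hex
  choose a ha using hrn
  refine ⟨r, hr0, Nat.find_min' hex ⟨hq, h⟩, a, ha, ?_⟩
  intro c hc
  have : NeZero r := ⟨hr0.ne'⟩
  obtain ⟨n, rfl⟩ := ZMod.natCast_zmod_surjective c
  rw [ZMod.natCast_eq_zero_iff]
  set g := Nat.gcd r n with hg
  have hg0 : 0 < g := Nat.gcd_pos_of_pos_left n hr0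
  obtain ⟨d, hd⟩ : g ∣ r := Nat.gcd_dvd_left r n
  have hd0 : 0 < d := Nat.pos_of_ne_zero fun h0 => by rw [h0, mul_zero] at hd; omega
  suffices hgr : g = r by rw [← hgr]; exact Nat.gcd_dvd_right r n
  refine le_antisymm (Nat.le_of_dvd hr0 ⟨d, hd⟩) (Nat.find_min' hex ⟨hg0, fun i => ?_⟩)
  have h1 : (r : ℤ) ∣ n * a i := by
    rw [← ZMod.intCast_zmod_eq_zero_iff_dvd]
    push_cast
    exact hc i
  have h2 : (d : ℤ) ∣ a i := by
    obtain ⟨m, hm⟩ := Nat.gcd_dvd_right r n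
    rw [← hg] at hm
    have hcop : IsCoprime (d : ℤ) m := by
      rw [Nat.isCoprime_iff_coprime]
      have := Nat.coprime_div_gcd_div_gcd hg0
      rw [← hg] at this
      rwa [Nat.div_eq_of_eq_mul_right hg0 hd, Nat.div_eq_of_eq_mul_right hg0 hm] at this
    refine hcop.dvd_of_dvd_mul_left ?_
    have h3 : (g : ℤ) * d ∣ g * (m * a i) := by
      rw [← mul_assoc]
      have e1 : (g : ℤ) * d = r := by rw [hd]; push_cast; rfl
      have e2 : (g : ℤ) * m = n := by rw [hm]; push_cast; rfl
      rw [e1, e2]; exact h1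
    exact Int.dvd_of_mul_dvd_mul_left (by omega) h3
  obtain ⟨b, hb⟩ := h2
  refine ⟨b, ?_⟩
  have hai := ha i
  have hd1 : (1 : ℝ) ≤ d := by exact_mod_cast hd0
  have h4 : (r : ℝ) * θ i - a i = d * (g * θ i - b) := by
    have e1 : (r : ℝ) = g * d := by exact_mod_cast hd
    have e2 : (a i : ℝ) = d * b := by exact_mod_cast hb
    rw [e1, e2]; ring
  change |(r : ℝ) * θ i - a i| ≤ ε i at hai
  rw [h4, abs_mul, abs_of_pos (by linarith)] at hai
  nlinarith [abs_nonneg ((g : ℝ) * θ i - b)]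

lemma card_dvd_prod_pow_ge {K L r s Y : ℕ} [NeZero r] (hs : r * s ≤ Y) :
    s ^ K * #(nilTuples (ZMod r) K L) ≤
      #((Fintype.piFinset fun _ : Fin K => Icc 1 Y).filter fun m => r ∣ (∏ i, m i) ^ L) := by
  have hr : 0 < r := Nat.pos_of_ne_zero (NeZero.ne r)
  have h1 : s ^ K * #(nilTuples (ZMod r) K L) =
      #((Fintype.piFinset fun _ : Fin K => range s) ×ˢ nilTuples (ZMod r) K L) := by
    rw [card_product, Fintype.card_piFinset]; simp
  rw [h1]
  refine card_le_card_of_injOn (fun w i => r * w.1 i + (w.2 i - 1).val + 1) ?_ ?_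
  · rintro ⟨t, c⟩ hw
    obtain ⟨ht, hc⟩ := mem_product.1 hw
    rw [Fintype.mem_piFinset] at ht
    rw [mem_nilTuples] at hc
    rw [mem_coe, mem_filter, Fintype.mem_piFinset]
    refine ⟨fun i => ?_, ?_⟩
    · rw [mem_Icc]
      refine ⟨Nat.le_add_left 1 _, ?_⟩
      have h2 : (c i - 1).val < r := ZMod.val_lt _
      have h3 : t i < s := mem_range.1 (ht i)
      have h4 : r * (t i + 1) ≤ r * s := Nat.mul_le_mul_left _ h3
      rw [mul_add] at h4
      change r * t i + (c i - 1).val + 1 ≤ Y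
      omega
    · rw [← ZMod.natCast_eq_zero_iff]
      push_cast
      simpa using hc
  · rintro ⟨t, c⟩ _ ⟨t', c'⟩ _ hww
    have h2 : ∀ i, t i = t' i ∧ c i = c' i := by
      intro i
      have h3 := congrFun hww i
      simp only [Nat.add_right_cancel_iff] at h3
      have h4 : t i = t' i := by
        have := congrArg (· / r) h3
        simpa [Nat.mul_add_div hr, Nat.div_eq_of_lt (ZMod.val_lt _)] using this
      refine ⟨h4, ?_⟩
      rw [h4, Nat.add_left_cancel_iff] at h3
      have := ZMod.val_injective r h3
      simpa using this
    exact Prod.ext (funext fun i => (h2 i).1) (funext fun i => (h2 i).2)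

open Classical in
/-- A large Weyl sum is detected by many dilates, in proportion to its size. -/
theorem exists_major_arc {k : ℕ} (hk : 1 ≤ k) : ∃ K L C₀ C₁ : ℕ, ∃ c : ℝ, 0 < c ∧
    ∀ Q : ℕ, 2 ≤ Q → ∀ M : ℕ, Q ^ C₁ ≤ M → ∀ θ : Fin k → ℝ,
      (M : ℝ) ≤ Q * ‖weylSum (curvePoly θ) M‖ →
      c * (‖weylSum (curvePoly θ) M‖ / M) ^ k * ((Q ^ C₀ : ℕ) : ℝ) ^ K ≤
        (((Fintype.piFinset fun _ : Fin K => Icc 1 (Q ^ C₀)).filter fun m : Fin K → ℕ => ∀ i : Fin k,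
          NearInt ((((∏ j, m j) ^ L) ^ (i.1 + 1) : ℕ) * θ i)
            ((Q : ℝ) ^ C₁ / (M : ℝ) ^ (i.1 + 1))).card : ℝ) := by
  obtain ⟨K, L, -, -, B, hB, hG⟩ := exists_gaussBound hk
  obtain ⟨C, hC⟩ := inverseWeyl k
  obtain ⟨D, hD⟩ : PolyBdd fun Q => 2 * Q * (7 * (k ^ 2 * 2 ^ k * Q ^ C) + 2 * Q ^ C) +
      ((Q ^ C) ^ (K * L)) ^ k * Q ^ C :=
    PolyBdd.add (.mul (.mul (.const _) .id) (.add (.mul (.const _) (.mul (.const _) (.pow .id _)))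
      (.mul (.const _) (.pow .id _)))) (.mul (.pow (.pow (.pow .id _) _) _) (.pow .id _))
  refine ⟨K, L, C, D, 1 / (B * 2 ^ k * 2 ^ K), by positivity, fun Q hQ M hM θ hW => ?_⟩
  have hDQ := hD Q hQ
  set W := ‖weylSum (curvePoly θ) M‖ with hWdef
  have hQ0 : 0 < Q := by omega
  have hQ0' : (0 : ℝ) < Q := by exact_mod_cast hQ0
  have hM0 : 0 < M := lt_of_lt_of_le (by positivity) hM
  have hM0' : (0 : ℝ) < M := by exact_mod_cast hM0
  have hDreal : 2 * (Q : ℝ) * (7 * (k ^ 2 * 2 ^ k * (Q : ℝ) ^ C) + 2 * (Q : ℝ) ^ C) ≤ M := by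
    have : 2 * Q * (7 * (k ^ 2 * 2 ^ k * Q ^ C) + 2 * Q ^ C) ≤ M :=
      (Nat.le_add_right _ _).trans (hDQ.trans hM)
    exact_mod_cast this
  obtain ⟨q, hq0, hqC, hq⟩ := hC Q hQ M hM0 (curvePoly θ) (natDegree_curvePoly_le θ) hW
  obtain ⟨r, hr0, hrq, a, ha, hfaith⟩ := exists_faithful_approx hq0
    (θ := θ) (ε := fun i => (Q : ℝ) ^ C / (M : ℝ) ^ (i.1 + 1)) (by
      intro i
      have := hq (i.1 + 1) (by omega) (by omega)
      rwa [coeff_curvePoly] at this)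
  have : NeZero r := ⟨hr0.ne'⟩
  have hr0' : (0 : ℝ) < r := by exact_mod_cast hr0
  have hrC : r ≤ Q ^ C := hrq.trans hqC
  have hrC' : (r : ℝ) ≤ (Q : ℝ) ^ C := by exact_mod_cast hrC
  have hrM : r ≤ M := by
    have h1 : (r : ℝ) ≤ M := by
      have h2 : (1 : ℝ) ≤ Q := by exact_mod_cast hQ0
      have h3 : (0 : ℝ) ≤ 7 * (k ^ 2 * 2 ^ k * (Q : ℝ) ^ C) := by positivity
      nlinarith
    exact_mod_cast h1
  have h1 := norm_weylSum_le_completeSum hM0 hrM (by positivity) ha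
  set S := ‖completeSum (ZMod.stdAddChar (N := r)) fun i => (a i : ZMod r)‖
  have h2 : W / (2 * M) ≤ S / r := by
    have h3 : 2 * (7 * (k ^ 2 * 2 ^ k * (Q : ℝ) ^ C) + 2 * r) ≤ W := by
      refine le_of_mul_le_mul_left (le_trans ?_ (hDreal.trans hW)) hQ0'
      have : (Q : ℝ) * r ≤ Q * (Q : ℝ) ^ C := by gcongr
      linarith
    rw [div_le_iff₀ (by positivity)]
    linarith
  have h4 := hG r _ (primChar_stdAddChar r) _ hfaith
  rw [ZMod.card] at h4
  change S ^ k * _ ≤ _ at h4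
  have h5 : (W / (2 * M)) ^ k * (r : ℝ) ^ K ≤ B * #(nilTuples (ZMod r) K L) := by
    calc _ ≤ (S / r) ^ k * (r : ℝ) ^ K := by gcongr
      _ = S ^ k * (r : ℝ) ^ K / (r : ℝ) ^ k := by rw [div_pow]; ring
      _ ≤ _ := by rw [div_le_iff₀ (by positivity)]; exact h4
  have h6 := card_dvd_prod_pow_ge (K := K) (L := L) (Nat.mul_div_le (Q ^ C) r)
  set s := Q ^ C / r with hs
  have h7 : (Q : ℝ) ^ C / (2 * r) ≤ s := by
    have h8 : Q ^ C < r * s + r := Nat.lt_mul_div_succ _ hr0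
    have h9 : 1 ≤ s := (Nat.one_le_div_iff hr0).2 hrC
    have h10 : Q ^ C ≤ 2 * r * s := by nlinarith
    rw [div_le_iff₀ (by positivity)]
    have : ((Q ^ C : ℕ) : ℝ) ≤ ((2 * r * s : ℕ) : ℝ) := by exact_mod_cast h10
    push_cast at this
    linarith
  calc _ = (1 / B) * ((W / (2 * M)) ^ k * (r : ℝ) ^ K) * ((Q : ℝ) ^ C / (2 * r)) ^ K := by
        rw [div_pow W, div_pow W, div_pow ((Q : ℝ) ^ C), mul_pow, mul_pow]; push_cast; field_simp
    _ ≤ (1 / B) * (B * #(nilTuples (ZMod r) K L)) * (s : ℝ) ^ K := by gcongr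
    _ = ((s ^ K * #(nilTuples (ZMod r) K L) : ℕ) : ℝ) := by push_cast; field_simp
    _ ≤ _ := by
      refine Nat.cast_le.2 (h6.trans (card_le_card fun m hm => ?_))
      rw [mem_filter] at hm ⊢
      refine ⟨hm.1, fun i => ?_⟩
      set n := (∏ j, m j) ^ L with hn
      have hm1 := Fintype.mem_piFinset.1 hm.1
      have hn0 : 0 < n := pow_pos (prod_pos fun j _ => (mem_Icc.1 (hm1 j)).1) L
      have hnY : n ≤ (Q ^ C) ^ (K * L) := by
        rw [hn, pow_mul]
        refine Nat.pow_le_pow_left ?_ L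
        refine (prod_le_pow_card _ _ (Q ^ C) fun j _ => (mem_Icc.1 (hm1 j)).2).trans ?_
        simp
      obtain ⟨b, hb⟩ : r ∣ n ^ (i.1 + 1) := dvd_pow hm.2 (by omega)
      have hb0 : b ≤ ((Q ^ C) ^ (K * L)) ^ k := by
        calc b ≤ n ^ (i.1 + 1) := by rw [hb]; exact Nat.le_mul_of_pos_left b hr0
          _ ≤ n ^ k := Nat.pow_le_pow_right hn0 i.2
          _ ≤ _ := Nat.pow_le_pow_left hnY k
      have h10 : NearInt (r * θ i) ((Q : ℝ) ^ C / (M : ℝ) ^ (i.1 + 1)) := ⟨a i, ha i⟩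
      have h11 := h10.nat_mul b
      have h12 : ((n ^ (i.1 + 1) : ℕ) : ℝ) * θ i = b * (r * θ i) := by
        rw [hb]; push_cast; ring
      rw [h12]
      refine h11.mono ?_
      rw [← mul_div_assoc]
      refine div_le_div_of_nonneg_right ?_ (by positivity)
      have : b * Q ^ C ≤ Q ^ D :=
        (Nat.mul_le_mul_right _ hb0).trans ((Nat.le_add_left _ _).trans hDQ)
      exact_mod_cast this

lemma e_eq_one_iff {x : ℝ} (h : e x = 1) : ∃ n : ℤ, x = n := by
  have h1 := four_mul_abs_sub_round_le x
  rw [h, sub_self, norm_zero] at h1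
  refine ⟨round x, ?_⟩
  have : |x - round x| = 0 := le_antisymm (by linarith) (abs_nonneg _)
  linarith [abs_eq_zero.1 this]

lemma sum_fin_e (P : ℕ) (n : ℤ) (hn : |n| < P) :
    ∑ j : Fin P, e (j.1 / P * n) = if n = 0 then (P : ℂ) else 0 := by
  have hP : (0 : ℝ) < P := by exact_mod_cast (abs_nonneg n).trans_lt hn
  have h1 : ∑ j : Fin P, e (j.1 / P * n) = ∑ j ∈ range P, e (n / P) ^ j := by
    rw [sum_range]
    refine sum_congr rfl fun j _ => ?_
    rw [← e_nat_mul]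
    congr 1
    ring
  rw [h1]
  split_ifs with h
  · subst h; simp [e_zero]
  · have h2 : e (n / P) ≠ 1 := by
      intro h3
      obtain ⟨m, hm⟩ := e_eq_one_iff h3
      rw [div_eq_iff hP.ne'] at hm
      have hm' : n = m * P := by exact_mod_cast hm
      have hm0 : 1 ≤ |m| := Int.one_le_abs (by rintro rfl; exact h (by simpa using hm'))
      have : |n| = |m| * P := by rw [hm', abs_mul, Nat.abs_cast]
      nlinarith
    have h3 := mul_geom_sum (e (n / P)) P
    rw [← e_nat_mul, mul_div_cancel₀ _ hP.ne', e_int, sub_self] at h3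
    exact (mul_eq_zero.1 h3).resolve_left (sub_ne_zero.2 h2)

lemma e_sum {ι : Type*} (s : Finset ι) (f : ι → ℝ) : e (∑ i ∈ s, f i) = ∏ i ∈ s, e (f i) := by
  classical
  induction s using Finset.induction_on with
  | empty => simp [e_zero]
  | insert i s hi ih => rw [sum_insert hi, prod_insert hi, e_add, ih]

/-- Autocorrelations of finitely supported functions have a positive spectral decomposition. -/
lemma exists_spectral {k : ℕ} (S : Finset (Fin k → ℤ)) (g : (Fin k → ℤ) → ℝ)
    (hg : ∀ x, x ∉ S → g x = 0) (W : ℕ) :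
    ∃ (P : ℕ) (μ : (Fin k → Fin P) → ℝ) (θ : (Fin k → Fin P) → Fin k → ℝ), (∀ ξ, 0 ≤ μ ξ) ∧
      ∀ w : Fin k → ℤ, (∀ i, |w i| ≤ W) →
        ∑ ξ, (μ ξ : ℂ) * e (∑ i, θ ξ i * w i) = ((∑ x ∈ S, g x * g (x + w) : ℝ) : ℂ) := by
  set D := ∑ x ∈ S, ∑ i, (x i).natAbs with hD
  have hDx : ∀ x ∈ S, ∀ i, |x i| ≤ D := by
    intro x hx i
    have h1 : (x i).natAbs ≤ ∑ i, (x i).natAbs :=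
      single_le_sum (f := fun i => (x i).natAbs) (fun _ _ => Nat.zero_le _) (mem_univ i)
    have h2 : ∑ i, (x i).natAbs ≤ D :=
      single_le_sum (f := fun x : Fin k → ℤ => ∑ i, (x i).natAbs) (fun _ _ => Nat.zero_le _) hx
    rw [Int.abs_eq_natAbs]
    exact_mod_cast h1.trans h2
  set P := W + 2 * D + 1 with hP
  have hP0 : (P : ℂ) ^ k ≠ 0 := pow_ne_zero _ (by exact_mod_cast (by omega : P ≠ 0))
  set θ : (Fin k → Fin P) → Fin k → ℝ := fun ξ i => (ξ i).1 / P with hθ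
  set G : (Fin k → Fin P) → ℂ := fun ξ => ∑ x ∈ S, g x * e (∑ i, θ ξ i * x i) with hG
  refine ⟨P, fun ξ => ‖G ξ‖ ^ 2 / (P : ℝ) ^ k, θ, fun ξ => by positivity, fun w hw => ?_⟩
  have horth : ∀ n : Fin k → ℤ, (∀ i, |n i| < P) →
      ∑ ξ : Fin k → Fin P, e (∑ i, θ ξ i * n i) = if n = 0 then (P : ℂ) ^ k else 0 := by
    intro n hn
    simp_rw [e_sum, hθ]
    rw [← Fintype.prod_sum fun (i : Fin k) (j : Fin P) => e ((j.1 : ℝ) / P * n i)]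
    rw [prod_congr rfl fun i _ => sum_fin_e P (n i) (hn i)]
    split_ifs with h
    · subst h; simp
    · obtain ⟨i, hi⟩ := Function.ne_iff.1 h
      exact prod_eq_zero (mem_univ i) (if_neg hi)
  have h1 : ∀ ξ, ((‖G ξ‖ ^ 2 / (P : ℝ) ^ k : ℝ) : ℂ) * e (∑ i, θ ξ i * w i) =
      (∑ x ∈ S, ∑ y ∈ S, g x * g y * e (∑ i, θ ξ i * ((x - y + w) i : ℤ))) / (P : ℂ) ^ k := by
    intro ξ
    have h2 : ((‖G ξ‖ ^ 2 : ℝ) : ℂ) = G ξ * (starRingEnd ℂ) (G ξ) := by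
      rw [Complex.mul_conj, Complex.normSq_eq_norm_sq]
    rw [Complex.ofReal_div, h2, div_mul_eq_mul_div]
    push_cast
    congr 1
    simp only [hG, map_sum, map_mul, Complex.conj_ofReal, ← e_neg]
    rw [sum_mul_sum, sum_mul]
    refine sum_congr rfl fun x _ => ?_
    rw [sum_mul]
    refine sum_congr rfl fun y _ => ?_
    have h3 : ∑ i, θ ξ i * ((x - y + w) i : ℤ) =
        ∑ i, θ ξ i * x i + -∑ i, θ ξ i * y i + ∑ i, θ ξ i * w i := by
      rw [← sum_neg_distrib, ← sum_add_distrib, ← sum_add_distrib]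
      refine sum_congr rfl fun i _ => ?_
      simp only [Pi.add_apply, Pi.sub_apply]; push_cast; ring
    have h4 : ∑ i, θ ξ i * ((x i : ℝ) - y i + w i) = ∑ i, θ ξ i * ((x - y + w) i : ℤ) := by
      refine sum_congr rfl fun i _ => ?_
      simp only [Pi.add_apply, Pi.sub_apply]; push_cast; ring
    simp only [Pi.add_apply, Pi.sub_apply]
    push_cast
    rw [h4, h3, e_add, e_add]
    ring
  rw [sum_congr rfl fun ξ _ => h1 ξ, ← sum_div, sum_comm, div_eq_iff hP0]
  rw [Complex.ofReal_sum, sum_mul]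
  refine sum_congr rfl fun x hx => ?_
  rw [sum_comm]
  have h5 : ∀ y ∈ S, ∑ ξ, (g x : ℂ) * g y * e (∑ i, θ ξ i * ((x - y + w) i : ℤ)) =
      if y = x + w then (g x : ℂ) * g (x + w) * (P : ℂ) ^ k else 0 := by
    intro y hy
    rw [← mul_sum, horth]
    · have : x - y + w = 0 ↔ y = x + w := by
        constructor
        · intro h; have := sub_eq_zero.1 (show x + w - y = 0 by rw [← h]; abel); exact this.symm
        · rintro rfl; abel
      by_cases h : y = x + w
      · rw [if_pos h, if_pos (this.2 h), h]
      · rw [if_neg h, if_neg (fun h' => h (this.1 h')), mul_zero]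
    · intro i
      have e1 := abs_le.1 (hDx x hx i)
      have e2 := abs_le.1 (hDx y hy i)
      have e3 := abs_le.1 (hw i)
      rw [Pi.add_apply, Pi.sub_apply, abs_lt, hP]
      push_cast
      constructor <;> linarith
  rw [sum_congr rfl h5, sum_ite_eq']
  split_ifs with h
  · push_cast; ring
  · rw [hg _ h]; simp

/-- The anisotropic box `∏ [0, M ^ (i + 1))`. -/
noncomputable def box (k M : ℕ) : Finset (Fin k → ℤ) :=
  Fintype.piFinset fun i : Fin k => Ico 0 ((M : ℤ) ^ (i.1 + 1))

lemma mem_box {k M : ℕ} {x : Fin k → ℤ} :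
    x ∈ box k M ↔ ∀ i, 0 ≤ x i ∧ x i < (M : ℤ) ^ (i.1 + 1) := by
  simp [box, Fintype.mem_piFinset]

lemma card_box (k M : ℕ) : #(box k M) = ∏ i : Fin k, M ^ (i.1 + 1) := by
  rw [box, Fintype.card_piFinset]
  refine prod_congr rfl fun i _ => ?_
  rw [Int.card_Ico, sub_zero]
  exact_mod_cast Int.toNat_natCast (M ^ (i.1 + 1))

lemma card_box_pos {k M : ℕ} (hM : 0 < M) : 0 < #(box k M) := by
  rw [card_box]; exact prod_pos fun i _ => by positivity

lemma card_Ico_shift_le (n w : ℤ) :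
    (#((Ico 0 n).filter fun x => ¬ (0 ≤ x + w ∧ x + w < n)) : ℤ) ≤ |w| := by
  rcases le_total 0 w with h | h
  · have : ((Ico 0 n).filter fun x => ¬ (0 ≤ x + w ∧ x + w < n)) ⊆ Ico (n - w) n := by
      intro x hx
      rw [mem_filter, mem_Ico] at hx
      rw [mem_Ico]
      omega
    have := card_le_card this
    rw [Int.card_Ico] at this
    rw [abs_of_nonneg h]
    omega
  · have : ((Ico 0 n).filter fun x => ¬ (0 ≤ x + w ∧ x + w < n)) ⊆ Ico 0 (-w) := by
      intro x hx
      rw [mem_filter, mem_Ico] at hx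
      rw [mem_Ico]
      omega
    have := card_le_card this
    rw [Int.card_Ico] at this
    rw [abs_of_nonpos h]
    omega

lemma card_box_shift_le {k M : ℕ} {τ : ℝ} {w : Fin k → ℤ}
    (hw : ∀ i, |(w i : ℝ)| ≤ τ * (M : ℝ) ^ (i.1 + 1)) :
    (#((box k M).filter fun x => x + w ∉ box k M) : ℝ) ≤ k * τ * #(box k M) := by
  set I : Fin k → Finset ℤ := fun i => Ico 0 ((M : ℤ) ^ (i.1 + 1)) with hI
  set A : Fin k → Finset ℤ := fun i =>
    (I i).filter fun x => ¬ (0 ≤ x + w i ∧ x + w i < (M : ℤ) ^ (i.1 + 1)) with hA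
  have hsub : ((box k M).filter fun x => x + w ∉ box k M) ⊆
      univ.biUnion fun i => Fintype.piFinset (Function.update I i (A i)) := by
    intro x hx
    obtain ⟨hx1, hx2⟩ := mem_filter.1 hx
    rw [mem_box] at hx2
    push Not at hx2
    obtain ⟨i, hi⟩ := hx2
    rw [mem_biUnion]
    refine ⟨i, mem_univ i, ?_⟩
    rw [Fintype.mem_piFinset]
    intro j
    have hxj : x j ∈ I j := (Fintype.mem_piFinset.1 hx1) j
    by_cases h : j = i
    · subst h
      rw [Function.update_self, hA, mem_filter]
      refine ⟨hxj, ?_⟩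
      rintro ⟨h1, h2⟩
      exact absurd (hi h1) (not_le.2 h2)
    · rw [Function.update_of_ne h]; exact hxj
  have hcard : ∀ i, (#(Fintype.piFinset (Function.update I i (A i))) : ℝ) ≤ τ * #(box k M) := by
    intro i
    have h1 : #(Fintype.piFinset (Function.update I i (A i))) =
        #(A i) * ∏ j ∈ univ.erase i, #(I j) := by
      rw [Fintype.card_piFinset, ← mul_prod_erase univ _ (mem_univ i), Function.update_self]
      congr 1
      exact prod_congr rfl fun j hj => by rw [Function.update_of_ne (ne_of_mem_erase hj)]
    have h2 : #(box k M) = #(I i) * ∏ j ∈ univ.erase i, #(I j) := by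
      rw [box, Fintype.card_piFinset, ← mul_prod_erase univ _ (mem_univ i)]
    have h3 : #(I i) = M ^ (i.1 + 1) := by
      rw [hI, Int.card_Ico, sub_zero]
      exact_mod_cast Int.toNat_natCast (M ^ (i.1 + 1))
    have h4 : (#(A i) : ℝ) ≤ τ * #(I i) := by
      rw [h3]
      refine le_trans ?_ ((hw i).trans (le_of_eq (by push_cast; rfl)))
      have := card_Ico_shift_le ((M : ℤ) ^ (i.1 + 1)) (w i)
      exact_mod_cast this
    rw [h1, h2, Nat.cast_mul, Nat.cast_mul, ← mul_assoc]
    exact mul_le_mul_of_nonneg_right h4 (Nat.cast_nonneg _)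
  calc _ ≤ ((∑ i, #(Fintype.piFinset (Function.update I i (A i))) : ℕ) : ℝ) :=
        Nat.cast_le.2 ((card_le_card hsub).trans card_biUnion_le)
    _ ≤ ∑ _i : Fin k, τ * #(box k M) := by
        rw [Nat.cast_sum]
        exact sum_le_sum fun i _ => hcard i
    _ = _ := by rw [sum_const, card_univ, Fintype.card_fin, nsmul_eq_mul]; ring

/-- The point `(d, d², …, dᵏ)`. -/
def curvePoint (k : ℕ) (d : ℤ) : Fin k → ℤ := fun j => d ^ (j.1 + 1)

/-- No two points differ by a nontrivial point of the curve. -/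
def CurveFree {k : ℕ} (B : Finset (Fin k → ℤ)) : Prop :=
  ∀ d : ℤ, d ≠ 0 → ∀ x ∈ B, x + curvePoint k d ∉ B

/-- There is a curve-free subset of the box of scale `M` of density at least `δ`. -/
def HasDensity (k M : ℕ) (δ : ℝ) : Prop :=
  ∃ B ⊆ box k M, CurveFree B ∧ δ * #(box k M) ≤ #B

section Correlation
variable {k : ℕ}

/-- The number of `x ∈ S` with `x + w ∈ T`. -/
noncomputable def overlap (S T : Finset (Fin k → ℤ)) (w : Fin k → ℤ) : ℕ :=
  #(S.filter fun x => x + w ∈ T)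

lemma overlap_comm (S T : Finset (Fin k → ℤ)) (w : Fin k → ℤ) :
    overlap S T w = overlap T S (-w) := by
  refine card_nbij' (· + w) (· + -w) ?_ ?_ ?_ ?_
  · intro x hx
    have hx := mem_filter.1 hx
    refine mem_coe.2 (mem_filter.2 ⟨hx.2, ?_⟩)
    simpa using hx.1
  · intro x hx
    have hx := mem_filter.1 hx
    refine mem_coe.2 (mem_filter.2 ⟨hx.2, ?_⟩)
    simpa using hx.1
  · intro x _; simp
  · intro x _; simp

lemma overlap_box_ge {M : ℕ} {τ : ℝ} {w : Fin k → ℤ}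
    (hw : ∀ i, |(w i : ℝ)| ≤ τ * (M : ℝ) ^ (i.1 + 1)) {S : Finset (Fin k → ℤ)}
    (hS : S ⊆ box k M) : (#S : ℝ) - k * τ * #(box k M) ≤ overlap S (box k M) w := by
  have h1 := card_box_shift_le hw
  have h2 := card_filter_add_card_filter_not (s := S) fun x => x + w ∈ box k M
  have h3 : #(S.filter fun x => ¬ x + w ∈ box k M) ≤
      #((box k M).filter fun x => x + w ∉ box k M) := card_le_card (filter_subset_filter _ hS)
  have h4 : (overlap S (box k M) w : ℝ) + #(S.filter fun x => ¬ x + w ∈ box k M) = #S := by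
    exact_mod_cast h2
  have h5 : (#(S.filter fun x => ¬ x + w ∈ box k M) : ℝ) ≤
      #((box k M).filter fun x => x + w ∉ box k M) := by exact_mod_cast h3
  linarith

lemma sum_indicator_mul {A S T : Finset (Fin k → ℤ)} (hS : S ⊆ A) (w : Fin k → ℤ) :
    ∑ x ∈ A, (if x ∈ S then (1 : ℝ) else 0) * (if x + w ∈ T then 1 else 0) = overlap S T w := by
  have : ∀ x, (if x ∈ S then (1 : ℝ) else 0) * (if x + w ∈ T then 1 else 0) =
      if x ∈ S ∧ x + w ∈ T then 1 else 0 := by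
    intro x; by_cases h : x ∈ S <;> simp [h]
  simp_rw [this]
  rw [sum_boole, overlap]
  congr 2
  ext x
  simp only [mem_filter]
  exact ⟨fun h => h.2, fun h => ⟨hS h.1, h⟩⟩

/-- The balanced indicator function of `B` in `A`. -/
noncomputable def balanced (A B : Finset (Fin k → ℤ)) (x : Fin k → ℤ) : ℝ :=
  (if x ∈ B then 1 else 0) - (#B : ℝ) / #A * if x ∈ A then 1 else 0

lemma balanced_eq_zero {A B : Finset (Fin k → ℤ)} (hB : B ⊆ A) {x : Fin k → ℤ} (hx : x ∉ A) :
    balanced A B x = 0 := by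
  rw [balanced, if_neg fun h => hx (hB h), if_neg hx]; simp

/-- The autocorrelation of the balanced function. -/
noncomputable def autocorr (A B : Finset (Fin k → ℤ)) (w : Fin k → ℤ) : ℝ :=
  ∑ x ∈ A, balanced A B x * balanced A B (x + w)

lemma autocorr_eq {A B : Finset (Fin k → ℤ)} (hB : B ⊆ A) (w : Fin k → ℤ) :
    autocorr A B w = overlap B B w - (#B : ℝ) / #A * overlap B A w -
      (#B : ℝ) / #A * overlap A B w + ((#B : ℝ) / #A) ^ 2 * overlap A A w := by
  rw [← sum_indicator_mul hB, ← sum_indicator_mul hB, ← sum_indicator_mul (subset_refl A),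
    ← sum_indicator_mul (subset_refl A), mul_sum, mul_sum, mul_sum, ← sum_sub_distrib,
    ← sum_sub_distrib, ← sum_add_distrib, autocorr]
  refine sum_congr rfl fun x _ => ?_
  simp only [balanced]
  ring

lemma autocorr_le {M : ℕ} (hM : 0 < M) {B : Finset (Fin k → ℤ)} (hB : B ⊆ box k M) {τ : ℝ}
    {w : Fin k → ℤ} (hw : ∀ i, |(w i : ℝ)| ≤ τ * (M : ℝ) ^ (i.1 + 1)) {δ : ℝ}
    (hδ : (#B : ℝ) = δ * #(box k M)) :
    autocorr (box k M) B w ≤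
      overlap B B w - δ ^ 2 * #(box k M) + 2 * δ * (k * τ) * #(box k M) := by
  have hV : (0 : ℝ) < #(box k M) := by exact_mod_cast card_box_pos hM
  have hδ' : (#B : ℝ) / #(box k M) = δ := by rw [hδ]; field_simp
  have hδ0 : 0 ≤ δ := by rw [← hδ']; positivity
  rw [autocorr_eq hB, hδ']
  have h1 := overlap_box_ge hw hB
  have h2 := overlap_box_ge (w := -w) (by intro i; simpa using hw i) hB
  rw [← overlap_comm] at h2
  have h3 : (overlap (box k M) (box k M) w : ℝ) ≤ #(box k M) := by
    exact_mod_cast card_filter_le _ _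
  rw [hδ] at h1 h2
  have e1 := mul_le_mul_of_nonneg_left h1 hδ0
  have e2 := mul_le_mul_of_nonneg_left h2 hδ0
  have e3 := mul_le_mul_of_nonneg_left h3 (sq_nonneg δ)
  linarith

lemma autocorr_zero_le {M : ℕ} (hM : 0 < M) {B : Finset (Fin k → ℤ)} (hB : B ⊆ box k M) :
    autocorr (box k M) B 0 ≤ #B := by
  have hV : (0 : ℝ) < #(box k M) := by exact_mod_cast card_box_pos hM
  have h0 := autocorr_le hM hB (τ := 0) (w := 0) (by simp)
    (δ := (#B : ℝ) / #(box k M)) (by field_simp)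
  have h1 : (overlap B B 0 : ℝ) ≤ #B := by exact_mod_cast card_filter_le _ _
  have h2 : 0 ≤ ((#B : ℝ) / #(box k M)) ^ 2 * #(box k M) := by positivity
  simp only [mul_zero, zero_mul, add_zero] at h0
  linarith

lemma CurveFree.overlap_eq_zero {B : Finset (Fin k → ℤ)} (hB : CurveFree B) {d : ℤ} (hd : d ≠ 0) :
    overlap B B (curvePoint k d) = 0 := by
  rw [overlap, card_eq_zero, filter_eq_empty_iff]
  exact fun x hx => hB d hd x hx

end Correlation

section Dilate
variable {k : ℕ}

/-- The anisotropic dilation of `t` by `q`. -/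
def dilate (q : ℕ) (t : Fin k → ℤ) : Fin k → ℤ := fun i => (q : ℤ) ^ (i.1 + 1) * t i

lemma card_dilate_le {B : Finset (Fin k → ℤ)} (hB : CurveFree B) {M q : ℕ} (hq : 0 < q) {D : ℝ}
    (hD : ¬ HasDensity k M D) (x : Fin k → ℤ) :
    (#((box k M).filter fun t => x + dilate q t ∈ B) : ℝ) ≤ D * #(box k M) := by
  by_contra! h
  refine hD ⟨_, filter_subset _ _, ?_, h.le⟩
  intro d hd t ht ht'
  have h1 := (mem_filter.1 ht).2
  have h2 := (mem_filter.1 ht').2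
  refine hB (q * d) (mul_ne_zero (by omega) hd) _ h1 ?_
  convert h2 using 1
  ext i
  simp only [Pi.add_apply, dilate, curvePoint]
  ring

lemma sum_overlap_dilate_le {B : Finset (Fin k → ℤ)} (hB : CurveFree B) {M q : ℕ} (hq : 0 < q)
    {D : ℝ} (hD : ¬ HasDensity k M D) :
    ∑ t ∈ box k M, ∑ t' ∈ box k M, (overlap B B (dilate q t - dilate q t') : ℝ) ≤
      #(box k M) * (#B * (D * #(box k M))) := by
  rw [sum_comm]
  have h1 : ∀ t' ∈ box k M, ∑ t ∈ box k M, (overlap B B (dilate q t - dilate q t') : ℝ) ≤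
      #B * (D * #(box k M)) := by
    intro t' _
    have h2 : ∀ t, (overlap B B (dilate q t - dilate q t') : ℝ) =
        ∑ x ∈ B, if (x - dilate q t') + dilate q t ∈ B then (1 : ℝ) else 0 := by
      intro t
      rw [sum_boole, overlap]
      congr 2
      refine filter_congr fun x _ => ?_
      rw [show x + (dilate q t - dilate q t') = x - dilate q t' + dilate q t by abel]
    rw [sum_congr rfl fun t _ => h2 t, sum_comm]
    calc _ ≤ ∑ _x ∈ B, D * #(box k M) := by
          refine sum_le_sum fun x _ => ?_
          rw [sum_boole]
          exact card_dilate_le hB hq hD _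
      _ = _ := by rw [sum_const, nsmul_eq_mul]
  calc _ ≤ ∑ _t' ∈ box k M, #B * (D * #(box k M)) := sum_le_sum h1
    _ = _ := by rw [sum_const, nsmul_eq_mul]

lemma dilate_sub_le {M M' q : ℕ} (hM : 0 < M) (hqM : q * M' ≤ M) {t t' : Fin k → ℤ}
    (ht : t ∈ box k M') (ht' : t' ∈ box k M') (i : Fin k) :
    |((dilate q t - dilate q t') i : ℝ)| ≤ ((q * M' : ℕ) : ℝ) / M * (M : ℝ) ^ (i.1 + 1) := by
  have hM' : (0 : ℝ) < M := by exact_mod_cast hM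
  have h1 := mem_box.1 ht i
  have h2 := mem_box.1 ht' i
  have h3 : |(t i - t' i : ℤ)| ≤ (M' : ℤ) ^ (i.1 + 1) := by rw [abs_le]; constructor <;> linarith
  have h4 : |((t i - t' i : ℤ) : ℝ)| ≤ (M' : ℝ) ^ (i.1 + 1) := by exact_mod_cast h3
  have h5 : ((dilate q t - dilate q t') i : ℝ) = (q : ℝ) ^ (i.1 + 1) * ((t i - t' i : ℤ) : ℝ) := by
    simp only [Pi.sub_apply, dilate]; push_cast; ring
  rw [h5, abs_mul, abs_of_nonneg (by positivity)]
  have h6 : ((q * M' : ℕ) : ℝ) / M ≤ 1 := by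
    rw [div_le_one hM']; exact_mod_cast hqM
  calc _ ≤ (q : ℝ) ^ (i.1 + 1) * (M' : ℝ) ^ (i.1 + 1) := by gcongr
    _ = (((q * M' : ℕ) : ℝ) / M) ^ (i.1 + 1) * (M : ℝ) ^ (i.1 + 1) := by
      rw [div_pow, div_mul_cancel₀ _ (by positivity)]; push_cast; ring
    _ ≤ _ := by
      refine mul_le_mul_of_nonneg_right ?_ (by positivity)
      exact pow_le_of_le_one (by positivity) h6 (by omega)

end Dilate

section Spectral
variable {k : ℕ} {Ξ : Type*} [Fintype Ξ]

lemma sum_mul_norm_sq_eq {μ : Ξ → ℝ} {θ : Ξ → Fin k → ℝ} {R : (Fin k → ℤ) → ℝ} {W : ℕ}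
    (h : ∀ w : Fin k → ℤ, (∀ i, |w i| ≤ W) → ∑ ξ, (μ ξ : ℂ) * e (∑ i, θ ξ i * w i) = (R w : ℂ))
    {T : Finset (Fin k → ℤ)} {v : (Fin k → ℤ) → Fin k → ℤ}
    (hv : ∀ t ∈ T, ∀ t' ∈ T, ∀ i, |(v t - v t') i| ≤ W) :
    ∑ ξ, μ ξ * ‖∑ t ∈ T, e (∑ i, θ ξ i * v t i)‖ ^ 2 = ∑ t ∈ T, ∑ t' ∈ T, R (v t - v t') := by
  rw [← Complex.ofReal_inj]
  have h1 : ∀ ξ, ((‖∑ t ∈ T, e (∑ i, θ ξ i * v t i)‖ ^ 2 : ℝ) : ℂ) =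
      ∑ t ∈ T, ∑ t' ∈ T, e (∑ i, θ ξ i * ((v t - v t') i : ℤ)) := by
    intro ξ
    rw [← Complex.normSq_eq_norm_sq, ← Complex.mul_conj, map_sum, sum_mul_sum]
    refine sum_congr rfl fun t _ => sum_congr rfl fun t' _ => ?_
    rw [← e_neg, ← e_add]
    congr 1
    rw [← sum_neg_distrib, ← sum_add_distrib]
    refine sum_congr rfl fun i _ => ?_
    simp only [Pi.sub_apply]; push_cast; ring
  rw [Complex.ofReal_sum, Complex.ofReal_sum]
  simp_rw [Complex.ofReal_mul, h1, Complex.ofReal_sum, mul_sum]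
  rw [sum_comm]
  refine sum_congr rfl fun t ht => ?_
  rw [sum_comm]
  exact sum_congr rfl fun t' ht' => h _ (hv t ht t' ht')

/-- Mass carried by large values of `T`. -/
lemma sum_large_ge {μ : Ξ → ℝ} (hμ : ∀ ξ, 0 ≤ μ ξ) {T : Ξ → ℂ} {m η ρ : ℝ} (hρ : 0 ≤ ρ)
    (hm : ∑ ξ, μ ξ ≤ m) (hη : η ≤ ‖∑ ξ, (μ ξ : ℂ) * T ξ‖) {k : ℕ} (hk : 1 ≤ k) :
    ρ ^ (k - 1) * (η - ρ * m) ≤ ∑ ξ with ρ ≤ ‖T ξ‖, μ ξ * ‖T ξ‖ ^ k := by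
  have h1 : η ≤ ∑ ξ, μ ξ * ‖T ξ‖ := by
    refine hη.trans ((norm_sum_le _ _).trans (sum_le_sum fun ξ _ => ?_))
    rw [norm_mul, Complex.norm_real, Real.norm_of_nonneg (hμ ξ)]
  have h2 : ∑ ξ with ¬ ρ ≤ ‖T ξ‖, μ ξ * ‖T ξ‖ ≤ ρ * m := by
    calc _ ≤ ∑ ξ with ¬ ρ ≤ ‖T ξ‖, μ ξ * ρ := by
          refine sum_le_sum fun ξ hξ => ?_
          exact mul_le_mul_of_nonneg_left (not_le.1 (mem_filter.1 hξ).2).le (hμ ξ)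
      _ ≤ ∑ ξ, μ ξ * ρ := sum_le_sum_of_subset_of_nonneg (subset_univ _)
          fun ξ _ _ => mul_nonneg (hμ ξ) hρ
      _ = ρ * ∑ ξ, μ ξ := by rw [← sum_mul, mul_comm]
      _ ≤ _ := mul_le_mul_of_nonneg_left hm hρ
  have h3 := sum_filter_add_sum_filter_not univ (fun ξ => ρ ≤ ‖T ξ‖) fun ξ => μ ξ * ‖T ξ‖
  calc _ ≤ ρ ^ (k - 1) * ∑ ξ with ρ ≤ ‖T ξ‖, μ ξ * ‖T ξ‖ :=
        mul_le_mul_of_nonneg_left (by linarith) (by positivity)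
    _ ≤ _ := by
      rw [mul_sum]
      refine sum_le_sum fun ξ hξ => ?_
      have h4 : ρ ^ (k - 1) ≤ ‖T ξ‖ ^ (k - 1) := pow_le_pow_left₀ hρ (mem_filter.1 hξ).2 _
      have h5 : ‖T ξ‖ ^ k = ‖T ξ‖ ^ (k - 1) * ‖T ξ‖ := by rw [← pow_succ, Nat.sub_add_cancel hk]
      rw [h5]
      have := mul_le_mul_of_nonneg_right h4 (mul_nonneg (hμ ξ) (norm_nonneg (T ξ)))
      linarith

open Classical in
/-- If every point of weight lies in many sets of a family, some set has large weight. -/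
lemma exists_heavy {ι Ξ : Type*} {I : Finset ι} (hI : I.Nonempty) {X : Finset Ξ} {μ f : Ξ → ℝ}
    (hμ : ∀ ξ, 0 ≤ μ ξ) {p : ι → Ξ → Prop} (h : ∀ ξ ∈ X, f ξ * #I ≤ #(I.filter fun m => p m ξ)) :
    ∃ m ∈ I, ∑ ξ ∈ X, μ ξ * f ξ ≤ ∑ ξ ∈ X.filter (p m), μ ξ := by
  by_contra! hcon
  have h1 : ∑ m ∈ I, ∑ ξ ∈ X.filter (p m), μ ξ < ∑ _m ∈ I, ∑ ξ ∈ X, μ ξ * f ξ :=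
    sum_lt_sum_of_nonempty hI hcon
  refine absurd h1 (not_lt.2 ?_)
  rw [sum_const, nsmul_eq_mul, mul_sum]
  simp_rw [sum_filter]
  rw [sum_comm]
  refine sum_le_sum fun ξ hξ => ?_
  rw [← sum_filter, sum_const, nsmul_eq_mul]
  have := mul_le_mul_of_nonneg_right (h ξ hξ) (hμ ξ)
  linarith

end Spectral

/-- If all the dilated frequencies are nearly integral, the short sum has no cancellation. -/
lemma half_card_le_norm_sum_dilate {k M M' q : ℕ} (hM : 0 < M) {E : ℝ} (hE : 1 ≤ E)
    (hEM : 14 * k * E * M' ≤ M) {θ : Fin k → ℝ}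
    (h : ∀ i, NearInt ((q ^ (i.1 + 1) : ℕ) * θ i) (E / (M : ℝ) ^ (i.1 + 1))) :
    (#(box k M') : ℝ) / 2 ≤ ‖∑ t ∈ box k M', e (∑ i, θ i * dilate q t i)‖ := by
  choose n hn using h
  have hM0 : (0 : ℝ) < M := by exact_mod_cast hM
  have h1 : ∀ t ∈ box k M', ‖e (∑ i, θ i * dilate q t i) - 1‖ ≤ 1 / 2 := by
    intro t ht
    rw [← e_zero]
    refine (norm_e_sub_e_le _ _ (∑ i, n i * t i)).trans ?_
    have h2 : ∑ i, θ i * (dilate q t i : ℤ) - 0 - ((∑ i, n i * t i : ℤ) : ℝ) =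
        ∑ i, ((q ^ (i.1 + 1) : ℕ) * θ i - n i) * t i := by
      push_cast
      rw [sub_zero, ← sum_sub_distrib]
      refine sum_congr rfl fun i _ => ?_
      simp only [dilate]; push_cast; ring
    rw [h2]
    have h3 : |∑ i, ((q ^ (i.1 + 1) : ℕ) * θ i - n i) * (t i : ℝ)| ≤
        ∑ _i : Fin k, E * M' / M := by
      refine (abs_sum_le_sum_abs _ _).trans (sum_le_sum fun i _ => ?_)
      rw [abs_mul]
      have h4 := mem_box.1 ht i
      have h5 : |(t i : ℝ)| ≤ (M' : ℝ) ^ (i.1 + 1) := by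
        rw [abs_of_nonneg (by exact_mod_cast h4.1)]
        exact_mod_cast h4.2.le
      have hMM : (M' : ℝ) / M ≤ 1 := by
        rw [div_le_one hM0]
        have hk1 : (1 : ℝ) ≤ k := by exact_mod_cast (by have := i.2; omega : 1 ≤ k)
        have : (1 : ℝ) ≤ 14 * k * E := by nlinarith
        nlinarith [(Nat.cast_nonneg M' : (0 : ℝ) ≤ M')]
      calc _ ≤ E / (M : ℝ) ^ (i.1 + 1) * (M' : ℝ) ^ (i.1 + 1) :=
            mul_le_mul (hn i) h5 (abs_nonneg _) (by positivity)
        _ = E * ((M' : ℝ) / M) ^ (i.1 + 1) := by rw [div_pow]; ring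
        _ ≤ E * ((M' : ℝ) / M) := by
          refine mul_le_mul_of_nonneg_left ?_ (by linarith)
          exact pow_le_of_le_one (by positivity) hMM (by omega)
        _ = _ := by ring
    rw [sum_const, card_univ, Fintype.card_fin, nsmul_eq_mul] at h3
    have h6 : (k : ℝ) * (E * M' / M) ≤ 1 / 14 := by
      rw [← mul_div_assoc, div_le_iff₀ hM0]; linarith
    linarith
  have h7 : (#(box k M') : ℂ) = ∑ t ∈ box k M', e (∑ i, θ i * dilate q t i) -
      ∑ t ∈ box k M', (e (∑ i, θ i * dilate q t i) - 1) := by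
    rw [sum_sub_distrib, sum_const, nsmul_eq_mul, mul_one]; ring
  have h8 := norm_sub_le (∑ t ∈ box k M', e (∑ i, θ i * dilate q t i))
    (∑ t ∈ box k M', (e (∑ i, θ i * dilate q t i) - 1))
  rw [← h7, Complex.norm_natCast] at h8
  have h9 : ‖∑ t ∈ box k M', (e (∑ i, θ i * dilate q t i) - 1)‖ ≤ #(box k M') * (1 / 2) := by
    refine (norm_sum_le _ _).trans ((sum_le_sum h1).trans ?_)
    rw [sum_const, nsmul_eq_mul]
  linarith

section Increment
variable {k : ℕ} {Ξ : Type*} [Fintype Ξ]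

lemma sum_autocorr_curvePoint_le {M M₁ R : ℕ} (hM : 0 < M) (hM₁ : 0 < M₁) (hR : 0 < R)
    (hMR : M₁ * R ≤ M) {B : Finset (Fin k → ℤ)} (hB : B ⊆ box k M) (hfree : CurveFree B) {δ : ℝ}
    (hδ : (#B : ℝ) = δ * #(box k M)) :
    ∑ d ∈ range M₁, autocorr (box k M) B (curvePoint k d) ≤
      #B + M₁ * (2 * δ * (k * (1 / R)) * #(box k M) - δ ^ 2 * #(box k M)) := by
  have hMR' : (M₁ : ℝ) * R ≤ M := by exact_mod_cast hMR
  have hR' : (0 : ℝ) < R := by exact_mod_cast hR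
  have hR1 : (1 : ℝ) ≤ R := by exact_mod_cast hR
  have key : ∀ d ∈ range M₁, autocorr (box k M) B (curvePoint k d) ≤
      (if d = 0 then (#B : ℝ) else 0) +
        (2 * δ * (k * (1 / R)) * #(box k M) - δ ^ 2 * #(box k M)) := by
    intro d hd
    have hd' : (d : ℝ) ≤ M₁ := by exact_mod_cast (mem_range.1 hd).le
    have hdM : (d : ℝ) ≤ 1 / R * M := by
      rw [one_div, inv_mul_eq_div, le_div_iff₀ hR']
      exact (mul_le_mul_of_nonneg_right hd' hR'.le).trans hMR'
    have hdM2 : (d : ℝ) ≤ M := by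
      refine hd'.trans (le_trans ?_ hMR')
      exact le_mul_of_one_le_right (Nat.cast_nonneg _) hR1
    have hw : ∀ i : Fin k, |(curvePoint k d i : ℝ)| ≤ 1 / R * (M : ℝ) ^ (i.1 + 1) := by
      intro i
      simp only [curvePoint, Int.cast_pow, Int.cast_natCast]
      rw [abs_of_nonneg (by positivity), pow_succ, pow_succ]
      calc (d : ℝ) ^ i.1 * d ≤ (M : ℝ) ^ i.1 * (1 / R * M) := by gcongr
        _ = _ := by ring
    have h := autocorr_le hM hB hw hδ
    have h2 : (overlap B B (curvePoint k d) : ℝ) ≤ if d = 0 then (#B : ℝ) else 0 := by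
      split_ifs with h0
      · exact_mod_cast card_le_card (filter_subset _ _)
      · rw [hfree.overlap_eq_zero (by exact_mod_cast h0)]; simp
    linarith
  refine (sum_le_sum key).trans ?_
  rw [sum_add_distrib, sum_ite_eq' (range M₁) 0, if_pos (mem_range.2 hM₁), sum_const, card_range,
    nsmul_eq_mul]

lemma sum_mul_weylSum {μ : Ξ → ℝ} {θ : Ξ → Fin k → ℝ} {R : (Fin k → ℤ) → ℝ} {M M₁ : ℕ}
    (hM : 0 < M) (hMM : M₁ ≤ M)
    (h : ∀ w : Fin k → ℤ, (∀ i, |w i| ≤ (M ^ k : ℕ)) →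
      ∑ ξ, (μ ξ : ℂ) * e (∑ i, θ ξ i * w i) = (R w : ℂ)) :
    ∑ ξ, (μ ξ : ℂ) * weylSum (curvePoly (θ ξ)) M₁ =
      ((∑ d ∈ range M₁, R (curvePoint k d) : ℝ) : ℂ) := by
  simp only [weylSum, mul_sum]
  rw [sum_comm, Complex.ofReal_sum]
  refine sum_congr rfl fun d hd => ?_
  rw [← h]
  · refine sum_congr rfl fun ξ _ => ?_
    rw [eval_curvePoly]
    simp [curvePoint]
  · intro i
    have hd' : d ≤ M := (mem_range.1 hd).le.trans hMM
    simp only [curvePoint]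
    rw [abs_of_nonneg (by positivity)]
    exact_mod_cast (Nat.pow_le_pow_left hd' _).trans (Nat.pow_le_pow_right hM i.2)

lemma large_spectrum (hk : 1 ≤ k) {M M₁ Q R : ℕ} (hM : 0 < M) (hQ : 0 < Q) (hR : 2 * k * Q ≤ R)
    (hMR : M₁ * R ≤ M) (hQM : Q ≤ M₁) {B : Finset (Fin k → ℤ)} (hB : B ⊆ box k M)
    (hfree : CurveFree B) {δ : ℝ} (hδ : (#B : ℝ) = δ * #(box k M)) (hδQ : 4 ≤ Q * δ)
    {μ : Ξ → ℝ} (hμ : ∀ ξ, 0 ≤ μ ξ) {θ : Ξ → Fin k → ℝ}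
    (h : ∀ w : Fin k → ℤ, (∀ i, |w i| ≤ (M ^ k : ℕ)) →
      ∑ ξ, (μ ξ : ℂ) * e (∑ i, θ ξ i * w i) = (autocorr (box k M) B w : ℂ)) :
    δ ^ (k + 1) * #(box k M) / 4 ^ k ≤
      ∑ ξ with δ / 4 ≤ ‖weylSum (curvePoly (θ ξ)) M₁ / M₁‖,
        μ ξ * ‖weylSum (curvePoly (θ ξ)) M₁ / M₁‖ ^ k := by
  have hV : (0 : ℝ) < #(box k M) := by exact_mod_cast card_box_pos hM
  have hM₁ : 0 < M₁ := hQ.trans_le hQM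
  have hR0 : 0 < R := lt_of_lt_of_le (by positivity) hR
  have hQ' : (0 : ℝ) < Q := by exact_mod_cast hQ
  have hR' : (0 : ℝ) < R := by exact_mod_cast hR0
  have hM₁' : (0 : ℝ) < M₁ := by exact_mod_cast hM₁
  have hδ0 : 0 < δ := by
    by_contra hcon
    nlinarith
  have hMM : M₁ ≤ M := (Nat.le_mul_of_pos_right _ hR0).trans hMR
  have hm : ∑ ξ, μ ξ ≤ δ * #(box k M) := by
    have h0 := h 0 (fun i => by simp)
    simp only [Pi.zero_apply, Int.cast_zero, mul_zero, sum_const_zero, e_zero, mul_one] at h0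
    have h1 : ∑ ξ, μ ξ = autocorr (box k M) B 0 := by exact_mod_cast h0
    rw [h1, ← hδ]; exact autocorr_zero_le hM hB
  have hsum : ∑ ξ, (μ ξ : ℂ) * (weylSum (curvePoly (θ ξ)) M₁ / M₁) =
      (((∑ d ∈ range M₁, autocorr (box k M) B (curvePoint k d)) / M₁ : ℝ) : ℂ) := by
    rw [Complex.ofReal_div, ← sum_mul_weylSum hM hMM h, sum_div, Complex.ofReal_natCast]
    exact sum_congr rfl fun ξ _ => by ring
  have hη : δ ^ 2 * #(box k M) / 2 ≤
      ‖∑ ξ, (μ ξ : ℂ) * (weylSum (curvePoly (θ ξ)) M₁ / M₁)‖ := by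
    rw [hsum, Complex.norm_real, Real.norm_eq_abs]
    refine le_trans ?_ (neg_le_abs _)
    rw [le_neg, div_le_iff₀ hM₁']
    refine (sum_autocorr_curvePoint_le hM hM₁ hR0 hMR hB hfree hδ).trans ?_
    have h1 : (2 * k * Q : ℝ) ≤ R := by exact_mod_cast hR
    have h2 : (k : ℝ) * (1 / R) ≤ δ / 8 := by
      rw [mul_one_div, div_le_iff₀ hR']
      nlinarith [(Nat.cast_nonneg k : (0 : ℝ) ≤ k)]
    have h3 : (Q : ℝ) ≤ M₁ := by exact_mod_cast hQM
    have h4 : (1 : ℝ) ≤ M₁ * δ / 4 := by nlinarith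
    rw [hδ]
    have h5 : 2 * δ * (k * (1 / R)) ≤ 2 * δ * (δ / 8) := by gcongr
    have h6 : δ + M₁ * (2 * δ * (k * (1 / R)) - δ ^ 2) ≤ -(δ ^ 2 / 2) * M₁ := by nlinarith
    have := mul_le_mul_of_nonneg_right h6 hV.le
    linarith
  have hmain := sum_large_ge hμ (ρ := δ / 4) (by positivity) hm hη hk
  refine le_trans (le_of_eq ?_) hmain
  obtain ⟨j, rfl⟩ : ∃ j, k = j + 1 := ⟨k - 1, by omega⟩
  simp only [Nat.add_sub_cancel, div_pow, pow_succ]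
  field_simp
  ring

lemma sum_weight_le {M M' q : ℕ} (hM : 0 < M) (hM' : 0 < M') (hq : 0 < q) (hqM : q * M' ≤ M)
    {B : Finset (Fin k → ℤ)} (hB : B ⊆ box k M) (hfree : CurveFree B) {δ D : ℝ}
    (hδ : (#B : ℝ) = δ * #(box k M)) (hD : ¬ HasDensity k M' D)
    {μ : Ξ → ℝ} (hμ : ∀ ξ, 0 ≤ μ ξ) {θ : Ξ → Fin k → ℝ}
    (h : ∀ w : Fin k → ℤ, (∀ i, |w i| ≤ (M ^ k : ℕ)) →
      ∑ ξ, (μ ξ : ℂ) * e (∑ i, θ ξ i * w i) = (autocorr (box k M) B w : ℂ))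
    {X : Finset Ξ}
    (hX : ∀ ξ ∈ X, (#(box k M') : ℝ) / 2 ≤ ‖∑ t ∈ box k M', e (∑ i, θ ξ i * dilate q t i)‖) :
    ∑ ξ ∈ X, μ ξ ≤
      4 * (δ * #(box k M) * (D - δ + 2 * (k * (((q * M' : ℕ) : ℝ) / M)))) := by
  have hV' : (0 : ℝ) < #(box k M') := by exact_mod_cast card_box_pos hM'
  have hM0 : (0 : ℝ) < M := by exact_mod_cast hM
  set τ : ℝ := ((q * M' : ℕ) : ℝ) / M with hτ
  have hτ1 : τ ≤ 1 := by
    rw [hτ, div_le_one hM0]; exact_mod_cast hqM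
  have hv : ∀ t ∈ box k M', ∀ t' ∈ box k M', ∀ i,
      |(dilate q t - dilate q t') i| ≤ (M ^ k : ℕ) := by
    intro t ht t' ht' i
    have h1 := dilate_sub_le hM hqM ht ht' i
    have h2 : |((dilate q t - dilate q t') i : ℝ)| ≤ (M : ℝ) ^ (i.1 + 1) :=
      h1.trans (mul_le_of_le_one_left (by positivity) hτ1)
    have h3 : |(dilate q t - dilate q t') i| ≤ (M ^ (i.1 + 1) : ℕ) := by
      rw [← Int.cast_abs] at h2
      exact_mod_cast h2
    refine h3.trans ?_
    exact_mod_cast Nat.pow_le_pow_right hM i.2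
  have h1 := sum_mul_norm_sq_eq h hv
  have h2 : ∑ ξ ∈ X, μ ξ * ((#(box k M') : ℝ) / 2) ^ 2 ≤
      ∑ ξ, μ ξ * ‖∑ t ∈ box k M', e (∑ i, θ ξ i * dilate q t i)‖ ^ 2 := by
    refine (sum_le_sum fun ξ hξ => ?_).trans
      (sum_le_sum_of_subset_of_nonneg (subset_univ X) fun ξ _ _ => by have := hμ ξ; positivity)
    have := hμ ξ
    have := hX ξ hξ
    gcongr
  have h3 : ∑ t ∈ box k M', ∑ t' ∈ box k M', autocorr (box k M) B (dilate q t - dilate q t') ≤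
      ∑ t ∈ box k M', ∑ t' ∈ box k M', ((overlap B B (dilate q t - dilate q t') : ℝ) +
        (2 * δ * (k * τ) * #(box k M) - δ ^ 2 * #(box k M))) := by
    refine sum_le_sum fun t ht => sum_le_sum fun t' ht' => ?_
    have := autocorr_le hM hB (fun i => dilate_sub_le hM hqM ht ht' i) hδ
    linarith
  have h4 := sum_overlap_dilate_le hfree hq hD
  simp only [sum_add_distrib, sum_const, nsmul_eq_mul] at h3
  rw [← sum_mul] at h2
  rw [h1] at h2
  rw [hδ] at h4
  have h5 := h2.trans h3
  have h6 : (∑ ξ ∈ X, μ ξ) * (#(box k M') : ℝ) ^ 2 ≤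
      4 * (δ * #(box k M) * (D - δ + 2 * (k * τ))) * (#(box k M') : ℝ) ^ 2 := by
    nlinarith
  exact le_of_mul_le_mul_right h6 (by positivity)

end Increment

theorem density_increment {k : ℕ} (hk : 1 ≤ k) :
    ∃ c : ℝ, 0 < c ∧ ∃ C : ℕ, ∀ Q : ℕ, 2 ≤ Q → ∀ δ : ℝ, 4 ≤ Q * δ → ∀ M : ℕ, Q ^ C ≤ M →
      HasDensity k M δ →
      ∃ M' : ℕ, 0 < M' ∧ M ≤ M' * Q ^ C ∧ HasDensity k M' (δ + c * δ ^ k) := by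
  classical
  obtain ⟨K, L, C₀, C₁, c₀, hc₀, hmajor⟩ := exists_major_arc hk
  set c' : ℝ := c₀ / 4 ^ (k + 1) with hc'
  have hc'0 : 0 < c' := by positivity
  obtain ⟨n₀, hn₀⟩ := exists_nat_gt (1 / c')
  rw [div_lt_iff₀ hc'0] at hn₀
  have hn₀1 : 1 ≤ n₀ := by
    rcases Nat.eq_zero_or_pos n₀ with h | h
    · subst h; norm_num at hn₀
    · exact h
  obtain ⟨a, ha⟩ : PolyBdd fun Q => 2 * k * Q := .mul (.const _) .id
  obtain ⟨b, hb⟩ : PolyBdd fun Q => 14 * k * (Q ^ C₁ * Q ^ (a + 1)) +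
      4 * k * n₀ * (((Q ^ C₀) ^ K) ^ L * Q ^ k) :=
    .add (.mul (.const _) (.mul (.pow .id _) (.pow .id _)))
      (.mul (.const _) (.mul (.pow (.pow (.pow .id _) _) _) (.pow .id _)))
  refine ⟨c' / 2, by positivity, a + b + C₁ + 1, fun Q hQ δ hδQ M hM hdens => ?_⟩
  have hQ0 : 0 < Q := by omega
  have hQ' : (0 : ℝ) < Q := by exact_mod_cast hQ0
  have hMpos : 0 < M := lt_of_lt_of_le (by positivity) hM
  obtain ⟨B, hB, hfree, hBδ⟩ := hdens
  have hpow : ∀ n, n ≤ a + b + C₁ + 1 → Q ^ n ≤ M := fun n hn =>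
    (Nat.pow_le_pow_right hQ0 hn).trans hM
  set M₁ := M / Q ^ a with hM₁
  set M₂ := M / Q ^ b with hM₂
  have hM₁C : Q ^ C₁ ≤ M₁ := by
    rw [hM₁, Nat.le_div_iff_mul_le (by positivity), ← pow_add]
    exact hpow _ (by omega)
  have hM₁Q : Q ≤ M₁ := by
    rw [hM₁, Nat.le_div_iff_mul_le (by positivity), ← pow_succ']
    exact hpow _ (by omega)
  have hM₂0 : 0 < M₂ := by
    rw [hM₂]; exact Nat.div_pos (hpow _ (by omega)) (by positivity)
  have hM₁M : M₁ * Q ^ a ≤ M := Nat.div_mul_le_self _ _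
  have hM₂M : M₂ * Q ^ b ≤ M := Nat.div_mul_le_self _ _
  have hMM : ∀ n, 0 < M / Q ^ n → M ≤ M / Q ^ n * Q ^ (n + 1) := by
    intro n hn
    have h1 := Nat.lt_div_mul_add (a := M) (b := Q ^ n) (by positivity)
    have h2 : Q ^ n ≤ M / Q ^ n * Q ^ n := Nat.le_mul_of_pos_left _ hn
    have h3 : M / Q ^ n * Q ^ n * 2 ≤ M / Q ^ n * Q ^ n * Q := Nat.mul_le_mul_left _ hQ
    rw [pow_succ, ← mul_assoc]
    omega
  have hbQ := hb Q hQ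
  refine ⟨M₂, hM₂0, (hMM b hM₂0).trans
    (Nat.mul_le_mul_left _ (Nat.pow_le_pow_right hQ0 (by omega))), ?_⟩
  by_contra hD
  have hV : (0 : ℝ) < #(box k M) := by exact_mod_cast card_box_pos hMpos
  obtain ⟨δ₀, hδ₀⟩ : ∃ δ₀ : ℝ, (#B : ℝ) = δ₀ * #(box k M) :=
    ⟨#B / #(box k M), by field_simp⟩
  have hδδ₀ : δ ≤ δ₀ := by
    rw [hδ₀] at hBδ
    exact le_of_mul_le_mul_right hBδ hV
  have hδ0 : 0 < δ := by
    by_contra hcon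
    nlinarith
  have hδ₀0 : 0 < δ₀ := hδ0.trans_le hδδ₀
  have hδ₀Q : 4 ≤ Q * δ₀ := hδQ.trans (by gcongr)
  obtain ⟨P, μ, θ, hμ, hs⟩ := exists_spectral (box k M) (balanced (box k M) B)
    (fun x hx => balanced_eq_zero hB hx) (M ^ k)
  change ∀ w : Fin k → ℤ, (∀ i, |w i| ≤ (M ^ k : ℕ)) →
      ∑ ξ, (μ ξ : ℂ) * e (∑ i, θ ξ i * w i) = (autocorr (box k M) B w : ℂ) at hs
  have hlarge := large_spectrum hk hMpos hQ0 (ha Q hQ) hM₁M hM₁Q hB hfree hδ₀ hδ₀Q hμ hs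
  have hM₁' : (0 : ℝ) < M₁ := by exact_mod_cast hQ0.trans_le hM₁Q
  set X := univ.filter fun ξ => δ₀ / 4 ≤ ‖weylSum (curvePoly (θ ξ)) M₁ / M₁‖ with hX
  set I := Fintype.piFinset fun _ : Fin K => Icc 1 (Q ^ C₀) with hI
  have hIne : I.Nonempty := ⟨fun _ => 1, by
    rw [hI, Fintype.mem_piFinset]
    intro _
    exact mem_Icc.2 ⟨le_rfl, Nat.one_le_pow _ _ hQ0⟩⟩
  have hIcard : #I = (Q ^ C₀) ^ K := by rw [hI, Fintype.card_piFinset]; simp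
  obtain ⟨m, hm, hheavy⟩ := exists_heavy (I := I) hIne (X := X)
    (f := fun ξ => c₀ * ‖weylSum (curvePoly (θ ξ)) M₁ / M₁‖ ^ k) hμ
    (p := fun m ξ => ∀ i : Fin k, NearInt ((((∏ j, m j) ^ L) ^ (i.1 + 1) : ℕ) * θ ξ i)
      ((Q : ℝ) ^ C₁ / (M₁ : ℝ) ^ (i.1 + 1))) (by
    intro ξ hξ
    have hξ' : δ₀ / 4 ≤ ‖weylSum (curvePoly (θ ξ)) M₁ / M₁‖ := (mem_filter.1 hξ).2
    rw [norm_div, Complex.norm_natCast] at hξ' ⊢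
    have h1 : (M₁ : ℝ) ≤ Q * ‖weylSum (curvePoly (θ ξ)) M₁‖ := by
      rw [le_div_iff₀ hM₁'] at hξ'
      have h2 := mul_le_mul_of_nonneg_left hξ' hQ'.le
      nlinarith
    have h2 := hmajor Q hQ M₁ hM₁C (θ ξ) h1
    rw [← Nat.cast_pow, ← hIcard] at h2
    convert h2)
  set q := (∏ j, m j) ^ L with hq
  have hmj : ∀ j, 1 ≤ m j ∧ m j ≤ Q ^ C₀ := fun j =>
    mem_Icc.1 (Fintype.mem_piFinset.1 hm j)
  have hq0 : 0 < q := pow_pos (prod_pos fun j _ => (hmj j).1) _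
  have hqle : q ≤ ((Q ^ C₀) ^ K) ^ L := by
    refine Nat.pow_le_pow_left ?_ _
    refine (prod_le_prod' fun j _ => (hmj j).2).trans ?_
    simp
  have hsmall : 4 * k * n₀ * (q * Q ^ k) * M₂ ≤ M := by
    refine le_trans ?_ hM₂M
    rw [mul_comm M₂]
    refine Nat.mul_le_mul_right _ (le_trans ?_ hbQ)
    refine le_trans ?_ (Nat.le_add_left _ _)
    gcongr
  have hqM : q * M₂ ≤ M := by
    refine le_trans ?_ hsmall
    refine Nat.mul_le_mul_right _ ?_
    have h1 : 0 < 4 * k * n₀ * Q ^ k := by positivity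
    calc q ≤ 4 * k * n₀ * Q ^ k * q := Nat.le_mul_of_pos_left _ h1
      _ = _ := by ring
  have hEM : 14 * (k : ℝ) * (Q : ℝ) ^ C₁ * M₂ ≤ M₁ := by
    have h1 : 14 * k * Q ^ C₁ * M₂ * Q ^ (a + 1) ≤ M₁ * Q ^ (a + 1) := by
      refine le_trans ?_ (hMM a (hQ0.trans_le hM₁Q))
      refine le_trans ?_ hM₂M
      rw [mul_comm M₂]
      refine le_trans (le_of_eq ?_) (Nat.mul_le_mul_right _ ((Nat.le_add_right _ _).trans hbQ))
      ring
    exact_mod_cast Nat.le_of_mul_le_mul_right h1 (by positivity)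
  have hupper := sum_weight_le hMpos hM₂0 hq0 hqM hB hfree hδ₀ hD hμ hs
    (X := X.filter fun ξ => ∀ i : Fin k, NearInt ((q ^ (i.1 + 1) : ℕ) * θ ξ i)
      ((Q : ℝ) ^ C₁ / (M₁ : ℝ) ^ (i.1 + 1))) (fun ξ hξ =>
      half_card_le_norm_sum_dilate (hQ0.trans_le hM₁Q)
        (one_le_pow₀ (by exact_mod_cast hQ0)) hEM (mem_filter.1 hξ).2)
  set τ : ℝ := ((q * M₂ : ℕ) : ℝ) / M with hτ
  have hτs : 4 * k * n₀ * τ * Q ^ k ≤ 1 := by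
    have h1 : (4 * k * n₀ * (q * Q ^ k) * M₂ : ℝ) ≤ M := by exact_mod_cast hsmall
    rw [hτ, Nat.cast_mul]
    have hM' : (0 : ℝ) < M := by exact_mod_cast hMpos
    calc 4 * (k : ℝ) * n₀ * (q * M₂ / M) * Q ^ k = (4 * k * n₀ * (q * Q ^ k) * M₂) / M := by ring
      _ ≤ 1 := by rwa [div_le_one hM']
  have hlow : c₀ * (δ₀ ^ (k + 1) * #(box k M) / 4 ^ k) ≤
      4 * (δ₀ * #(box k M) * (δ + c' / 2 * δ ^ k - δ₀ + 2 * (k * τ))) := by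
    refine le_trans ?_ (hheavy.trans (le_trans (le_of_eq (by congr!)) hupper))
    refine (mul_le_mul_of_nonneg_left hlarge hc₀.le).trans (le_of_eq ?_)
    rw [mul_sum]
    exact sum_congr rfl fun ξ _ => by ring
  have hpowle : δ ^ k ≤ δ₀ ^ k := by gcongr
  have h1 : c' * δ₀ ^ k ≤ δ + c' / 2 * δ ^ k - δ₀ + 2 * (k * τ) := by
    have h2 : c₀ * (δ₀ ^ (k + 1) * #(box k M) / 4 ^ k) =
        4 * (δ₀ * #(box k M)) * (c' * δ₀ ^ k) := by
      rw [hc', pow_succ, pow_succ]; field_simp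
    rw [h2, ← mul_assoc 4 (δ₀ * (#(box k M) : ℝ))] at hlow
    exact le_of_mul_le_mul_left hlow (by positivity)
  have h2 : c' * δ₀ ^ k ≤ 4 * k * τ := by nlinarith
  have h3 : c' * n₀ * (Q * δ₀) ^ k ≤ 1 := by
    refine le_trans ?_ hτs
    have := mul_le_mul_of_nonneg_right h2 (by positivity : (0 : ℝ) ≤ n₀ * Q ^ k)
    rw [mul_pow]; linarith
  have h4 : (1 : ℝ) ≤ (Q * δ₀) ^ k := one_le_pow₀ (by linarith)
  nlinarith

lemma HasDensity.le_one {k M : ℕ} {δ : ℝ} (hM : 0 < M) (h : HasDensity k M δ) : δ ≤ 1 := by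
  obtain ⟨B, hB, -, hδ⟩ := h
  have hV : (0 : ℝ) < #(box k M) := by exact_mod_cast card_box_pos hM
  have h1 : (#B : ℝ) ≤ #(box k M) := by exact_mod_cast card_le_card hB
  exact le_of_mul_le_mul_right (by linarith) hV

lemma inv_pow_increment_le {r : ℕ} (hr : 1 ≤ r) {c δ : ℝ} (hc : 0 < c) (hδ : 0 < δ) (hδ1 : δ ≤ 1) :
    ((δ + c * δ ^ (r + 1)) ^ r)⁻¹ ≤ (δ ^ r)⁻¹ - c / (1 + c) := by
  set y := δ ^ r with hy
  have hy0 : 0 < y := by positivity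
  have hy1 : y ≤ 1 := pow_le_one₀ hδ.le hδ1
  have h1 : y * (1 + c * y) ≤ (δ + c * δ ^ (r + 1)) ^ r := by
    have h2 : δ + c * δ ^ (r + 1) = δ * (1 + c * y) := by rw [hy]; ring
    rw [h2, mul_pow, ← hy]
    exact mul_le_mul_of_nonneg_left (le_self_pow₀ (by nlinarith) (by omega)) hy0.le
  refine (inv_anti₀ (by positivity) h1).trans ?_
  have h3 : y⁻¹ - c / (1 + c) - (y * (1 + c * y))⁻¹ =
      c ^ 2 * (1 - y) / ((1 + c) * (1 + c * y)) := by
    field_simp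
    ring
  have h4 : 0 ≤ c ^ 2 * (1 - y) / ((1 + c) * (1 + c * y)) :=
    div_nonneg (mul_nonneg (sq_nonneg c) (by linarith)) (by positivity)
  linarith

theorem scale_le_pow {k : ℕ} (hk : 2 ≤ k) :
    ∃ c : ℝ, 0 < c ∧ ∃ C : ℕ, ∀ Q : ℕ, 2 ≤ Q → ∀ n : ℕ, ∀ M : ℕ, 0 < M → ∀ δ : ℝ, 4 ≤ Q * δ →
      HasDensity k M δ → (δ ^ (k - 1))⁻¹ ≤ c * n → M ≤ Q ^ (C * n) := by
  obtain ⟨c, hc, C, h⟩ := density_increment (k := k) (by omega)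
  refine ⟨c / (1 + c), by positivity, C, fun Q hQ n => ?_⟩
  have hQ' : (0 : ℝ) < Q := by exact_mod_cast (by omega : 0 < Q)
  induction n with
  | zero =>
    intro M _ δ hδQ _ hδ
    have hδ0 : 0 < δ := by
      by_contra hcon
      nlinarith
    have : 0 < (δ ^ (k - 1))⁻¹ := by positivity
    simp only [Nat.cast_zero, mul_zero] at hδ
    linarith
  | succ n ih =>
    intro M hM δ hδQ hdens hδ
    have hδ0 : 0 < δ := by
      by_contra hcon
      nlinarith
    rcases lt_or_ge M (Q ^ C) with hlt | hge
    · refine hlt.le.trans (Nat.pow_le_pow_right (by omega) ?_)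
      exact Nat.le_mul_of_pos_right _ (by omega)
    · obtain ⟨M', hM', hMM', hdens'⟩ := h Q hQ δ hδQ M hge hdens
      have h1 := inv_pow_increment_le (r := k - 1) (by omega) hc hδ0 (hdens.le_one hM)
      rw [Nat.sub_add_cancel (by omega : 1 ≤ k)] at h1
      have h2 := ih M' hM' (δ + c * δ ^ k)
        (hδQ.trans (mul_le_mul_of_nonneg_left (by simp; positivity) hQ'.le)) hdens' (by
          push_cast at hδ; linarith)
      refine hMM'.trans ((Nat.mul_le_mul_right _ h2).trans (le_of_eq ?_))
      rw [← pow_add]; ring_nf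

lemma exists_hasDensity {k M N : ℕ} (hM : 0 < M) (hMN : M ^ k ≤ N) {B : Finset (Fin k → ℤ)}
    (hB : B ⊆ Fintype.piFinset (fun _ : Fin k => Finset.Icc 1 (N : ℤ)))
    (hfree : ∀ d : ℤ, d ≠ 0 → (fun j : Fin k => d ^ (j.1 + 1)) ∉ B - B) :
    HasDensity k M ((#B : ℝ) / (N : ℝ) ^ k / 2 ^ k) := by
  have hN : 0 < N := lt_of_lt_of_le (by positivity) hMN
  set t : Finset (Fin k → ℤ) := Fintype.piFinset fun i : Fin k =>
    Finset.Icc 0 ((N / M ^ (i.1 + 1) : ℕ) : ℤ) with ht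
  have hmaps : ∀ x ∈ B, (fun i : Fin k => x i / (M : ℤ) ^ (i.1 + 1)) ∈ t := by
    intro x hx
    rw [ht, Fintype.mem_piFinset]
    intro i
    have h1 := Finset.mem_Icc.1 (Fintype.mem_piFinset.1 (hB hx) i)
    rw [Finset.mem_Icc]
    refine ⟨Int.ediv_nonneg (by omega) (by positivity), ?_⟩
    push_cast
    exact Int.ediv_le_ediv (by positivity) h1.2
  have htne : t.Nonempty := ⟨0, by
    rw [ht, Fintype.mem_piFinset]
    intro i
    exact Finset.mem_Icc.2 ⟨le_rfl, Int.natCast_nonneg _⟩⟩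
  have ht0 : (0 : ℝ) < #t := by exact_mod_cast htne.card_pos
  obtain ⟨y, hy, hcard⟩ := exists_le_card_fiber_of_nsmul_le_card_of_maps_to
    (b := (#B : ℝ) / #t) hmaps htne (by rw [nsmul_eq_mul]; field_simp; rfl)
  have htcard : #t * #(box k M) ≤ (2 * N) ^ k := by
    rw [card_box, ht, Fintype.card_piFinset, ← prod_mul_distrib]
    refine (prod_le_prod' (g := fun _ => 2 * N) fun i _ => ?_).trans (by simp)
    rw [Int.card_Icc, sub_zero]
    have h1 : M ^ (i.1 + 1) ≤ N := (Nat.pow_le_pow_right hM i.2).trans hMN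
    have h2 := Nat.div_mul_le_self N (M ^ (i.1 + 1))
    have h3 : (((N / M ^ (i.1 + 1) : ℕ) : ℤ) + 1).toNat = N / M ^ (i.1 + 1) + 1 := by
      rw [← Nat.cast_succ, Int.toNat_natCast]
    rw [h3, add_mul, one_mul]
    omega
  set s : Fin k → ℤ := fun i => (M : ℤ) ^ (i.1 + 1) * y i with hs
  refine ⟨(B.filter fun x => (fun i : Fin k => x i / (M : ℤ) ^ (i.1 + 1)) = y).image
    fun x => x - s, ?_, ?_, ?_⟩
  · intro z hz
    obtain ⟨x, hx, rfl⟩ := mem_image.1 hz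
    rw [mem_box]
    intro i
    have h1 := congrFun (mem_filter.1 hx).2 i
    have hpos : (0 : ℤ) < (M : ℤ) ^ (i.1 + 1) := by positivity
    have h2 : (x - s) i = x i % (M : ℤ) ^ (i.1 + 1) := by
      simp only [Pi.sub_apply, hs]
      rw [← h1, Int.emod_def]
    rw [h2]
    exact ⟨Int.emod_nonneg _ hpos.ne', Int.emod_lt_of_pos _ hpos⟩
  · intro d hd z hz hz'
    obtain ⟨x, hx, rfl⟩ := mem_image.1 hz
    obtain ⟨x', hx', heq⟩ := mem_image.1 hz'
    refine hfree d hd (mem_sub.2 ⟨x', (mem_filter.1 hx').1, x, (mem_filter.1 hx).1, ?_⟩)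
    have : x' - x = curvePoint k d := by
      rw [sub_eq_iff_eq_add] at heq ⊢
      rw [heq]; abel
    exact this
  · rw [card_image_of_injective _ (sub_left_injective)]
    refine le_trans ?_ hcard
    rw [le_div_iff₀ ht0, div_div, ← mul_pow, div_mul_eq_mul_div, div_mul_eq_mul_div,
      div_le_iff₀ (by positivity), mul_assoc]
    refine mul_le_mul_of_nonneg_left ?_ (Nat.cast_nonneg _)
    rw [mul_comm (#(box k M) : ℝ), mul_comm (N : ℝ)]
    exact_mod_cast htcard

lemma exists_log_le {k : ℕ} (hk : 2 ≤ k) :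
    ∃ C : ℝ, 0 < C ∧ ∀ M : ℕ, 0 < M → ∀ δ : ℝ, 0 < δ → HasDensity k M δ →
      Real.log M ≤ C * (δ ^ (k - 1))⁻¹ * (2 + Real.log (δ ^ (k - 1))⁻¹) := by
  obtain ⟨c, hc, C, h⟩ := scale_le_pow hk
  refine ⟨C * (1 / c + 1) + 1, by positivity, fun M hM δ hδ hdens => ?_⟩
  have hδ1 := hdens.le_one hM
  set x := (δ ^ (k - 1))⁻¹ with hx
  have hx1 : 1 ≤ x := (one_le_inv₀ (by positivity)).2 (pow_le_one₀ hδ.le hδ1)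
  have hδx : δ⁻¹ ≤ x := by
    rw [hx, ← inv_pow]
    exact le_self_pow₀ ((one_le_inv₀ hδ).2 hδ1) (by omega)
  obtain ⟨n, hn⟩ : ∃ n, n = ⌈x / c⌉₊ := ⟨_, rfl⟩
  obtain ⟨Q, hQ⟩ : ∃ Q, Q = ⌈4 / δ⌉₊ := ⟨_, rfl⟩
  have hn1 : x / c ≤ n := hn ▸ Nat.le_ceil _
  have hn2 : (n : ℝ) ≤ x / c + 1 := hn ▸ (Nat.ceil_lt_add_one (by positivity)).le
  have hQ1 : 4 / δ ≤ Q := hQ ▸ Nat.le_ceil _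
  have hQ2 : (Q : ℝ) ≤ 4 / δ + 1 := hQ ▸ (Nat.ceil_lt_add_one (by positivity)).le
  have hQ4 : (4 : ℝ) ≤ Q := by
    refine le_trans ?_ hQ1
    rw [le_div_iff₀ hδ]; linarith
  have hM1 := h Q (by exact_mod_cast (by linarith : (2 : ℝ) ≤ Q)) n M hM δ
    (by rwa [div_le_iff₀ hδ] at hQ1) hdens (by rwa [div_le_iff₀ hc, mul_comm] at hn1)
  have hM2 : (M : ℝ) ≤ (Q : ℝ) ^ (C * n) := by exact_mod_cast hM1
  have hlog : Real.log M ≤ C * n * Real.log Q := by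
    refine (Real.log_le_log (by exact_mod_cast hM) hM2).trans (le_of_eq ?_)
    rw [Real.log_pow]; push_cast; ring
  have hlogx : 0 ≤ Real.log x := Real.log_nonneg hx1
  have hlogQ : Real.log Q ≤ 2 + Real.log x := by
    have h1 : (Q : ℝ) ≤ 5 * x := by
      rw [div_eq_mul_inv] at hQ2
      linarith
    have h2 : Real.log 5 ≤ 2 := by
      rw [Real.log_le_iff_le_exp (by norm_num)]
      have := Real.exp_one_gt_d9
      rw [show (2 : ℝ) = 1 + 1 by norm_num, Real.exp_add]
      nlinarith
    have h3 := Real.log_le_log (by linarith) h1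
    rw [Real.log_mul (by norm_num) (by linarith)] at h3
    linarith
  have hnx : (n : ℝ) ≤ (1 / c + 1) * x := by
    refine hn2.trans ?_
    rw [add_mul, one_mul, div_mul_eq_mul_div, one_mul]
    linarith
  calc Real.log M ≤ C * n * Real.log Q := hlog
    _ ≤ C * ((1 / c + 1) * x) * (2 + Real.log x) := by
      have : 0 ≤ Real.log Q := Real.log_nonneg (by linarith)
      gcongr
    _ ≤ _ := by
      have : 0 ≤ x * (2 + Real.log x) := by positivity
      nlinarith

lemma le_of_le_mul_log {A lam₀ x ℓ : ℝ} (hA : 0 < A) (hlam₀ : 0 < lam₀) (hx : 0 < x)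
    (hlam : lam₀ ≤ Real.log ℓ) (h : ℓ ≤ A * x * (2 + Real.log x)) :
    ℓ ≤ (1 / lam₀ + A * (2 / lam₀ + 1)) * x * Real.log ℓ := by
  have hlog : 0 < Real.log ℓ := hlam₀.trans_le hlam
  have h1 : 1 ≤ 1 / lam₀ * Real.log ℓ := by
    rw [one_div, inv_mul_eq_div, one_le_div hlam₀]; exact hlam
  have h0 : 0 ≤ A * (2 / lam₀ + 1) * (x * Real.log ℓ) := by positivity
  rcases le_total ℓ x with hc | hc
  · nlinarith
  · have h2 := Real.log_le_log hx hc
    have h3 : 2 + Real.log x ≤ (2 / lam₀ + 1) * Real.log ℓ := by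
      have : 2 / lam₀ = 2 * (1 / lam₀) := by ring
      rw [this]; linarith
    have h4 : A * x * (2 + Real.log x) ≤ A * x * ((2 / lam₀ + 1) * Real.log ℓ) := by gcongr
    have h5 : 0 ≤ 1 / lam₀ * (x * Real.log ℓ) := by positivity
    linarith

theorem exists_density_bound {k : ℕ} (hk : 2 ≤ k) :
    ∃ C : ℝ, 0 < C ∧ ∀ N : ℕ, 3 ≤ N → ∀ B : Finset (Fin k → ℤ),
      B ⊆ Fintype.piFinset (fun _ : Fin k => Finset.Icc 1 (N : ℤ)) →
      (∀ d : ℤ, d ≠ 0 → (fun j : Fin k => d ^ (j.1 + 1)) ∉ B - B) →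
      ((#B : ℝ) / (N : ℝ) ^ k) ^ (k - 1) ≤ C * (Real.log (Real.log N) / Real.log N) := by
  obtain ⟨C, hC, h⟩ := exists_log_le hk
  have hlog3 : 1 < Real.log 3 := by
    rw [Real.lt_log_iff_exp_lt (by norm_num)]
    linarith [Real.exp_one_lt_d9]
  set lam₀ := Real.log (Real.log 3) with hlam₀
  have hlam₀0 : 0 < lam₀ := Real.log_pos hlog3
  set A : ℝ := k + k * C with hA
  have hA0 : 0 < A := by
    have : (0 : ℝ) < k := by exact_mod_cast (by omega : 0 < k)
    positivity
  set C' : ℝ := 1 / lam₀ + A * (2 / lam₀ + 1) with hC'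
  refine ⟨(2 ^ k) ^ (k - 1) * C', by positivity, fun N hN B hB hfree => ?_⟩
  have hN3 : (3 : ℝ) ≤ N := by exact_mod_cast hN
  have hℓ3 : Real.log 3 ≤ Real.log N := Real.log_le_log (by norm_num) hN3
  have hℓ0 : 0 < Real.log N := by linarith
  have hlamN : lam₀ ≤ Real.log (Real.log N) := Real.log_le_log (by linarith) hℓ3
  rcases B.eq_empty_or_nonempty with rfl | hne
  · rw [card_empty, Nat.cast_zero, zero_div, zero_pow (by omega)]
    have : 0 ≤ Real.log (Real.log N) := hlam₀0.le.trans hlamN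
    positivity
  obtain ⟨M, hM, hMN, hNM⟩ : ∃ M : ℕ, 0 < M ∧ M ^ k ≤ N ∧ N < (M + 1) ^ k := by
    have hex : ∃ m : ℕ, N < (m + 1) ^ k :=
      ⟨N, (Nat.lt_succ_self N).trans_le (Nat.le_self_pow (by omega) _)⟩
    classical
    have h1 := Nat.find_spec hex
    have h2 : 0 < Nat.find hex := by
      rcases Nat.eq_zero_or_pos (Nat.find hex) with h0 | h0
      · rw [h0] at h1; simp at h1; omega
      · exact h0
    have h3 := Nat.find_min hex (Nat.sub_one_lt h2.ne')
    rw [Nat.sub_add_cancel h2] at h3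
    exact ⟨Nat.find hex, h2, not_lt.1 h3, h1⟩
  set η : ℝ := (#B : ℝ) / (N : ℝ) ^ k with hη
  have hη0 : 0 < η := by
    have : (0 : ℝ) < #B := by exact_mod_cast hne.card_pos
    have : (0 : ℝ) < N := by linarith
    positivity
  have hdens := exists_hasDensity hM hMN hB hfree
  rw [← hη] at hdens
  have hδ1 := hdens.le_one hM
  have hlogM := h M hM _ (by positivity) hdens
  set x := ((η / 2 ^ k) ^ (k - 1))⁻¹ with hx
  have hx1 : 1 ≤ x := (one_le_inv₀ (by positivity)).2 (pow_le_one₀ (by positivity) hδ1)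
  have hlogx : 0 ≤ Real.log x := Real.log_nonneg hx1
  have hM0 : (0 : ℝ) < M := by exact_mod_cast hM
  have hlogN : Real.log N ≤ A * x * (2 + Real.log x) := by
    have h1 : (N : ℝ) ≤ (2 * M : ℝ) ^ k := by
      exact_mod_cast hNM.le.trans (Nat.pow_le_pow_left (by omega) k)
    have h2 := Real.log_le_log (by linarith) h1
    rw [Real.log_pow, Real.log_mul (by norm_num) hM0.ne'] at h2
    have h3 : Real.log 2 ≤ 1 := by linarith [Real.log_two_lt_d9]
    have h4 : (1 : ℝ) ≤ x * (2 + Real.log x) := by nlinarith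
    calc Real.log N ≤ k * (Real.log 2 + Real.log M) := h2
      _ ≤ k * (x * (2 + Real.log x) + C * x * (2 + Real.log x)) := by gcongr; linarith
      _ = _ := by rw [hA]; ring
  have hfin := le_of_le_mul_log hA0 hlam₀0 (by linarith) hlamN hlogN
  rw [← hC', hx, div_pow, inv_div] at hfin
  rw [mul_div_assoc', le_div_iff₀ hℓ0]
  have hηpos : 0 < η ^ (k - 1) := by positivity
  have := mul_le_mul_of_nonneg_left hfin hηpos.le
  refine this.trans (le_of_eq ?_)
  field_simp

end CurveDiff

/-- **Theorem 2 (Lyall–Magyar).** If `B ⊆ [1,N]^k` and `(d,d²,…,d^k) ∉ B - B` for every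
nonzero `d`, then `|B|/N^k ≤ C (log log N / log N)^(1/(k-1))`. -/
theorem stmt_2 (k : ℕ) (hk : 2 ≤ k) :
    ∃ C : ℝ, 0 < C ∧ ∀ N : ℕ, 3 ≤ N → ∀ B : Finset (Fin k → ℤ),
      B ⊆ Fintype.piFinset (fun _ : Fin k => Finset.Icc 1 (N : ℤ)) →
      (∀ d : ℤ, d ≠ 0 → (fun j : Fin k => d ^ (j.1 + 1)) ∉ B - B) →
      (B.card : ℝ) / (N : ℝ) ^ k ≤
        C * (Real.log (Real.log N) / Real.log N) ^ ((1 : ℝ) / ((k - 1 : ℕ) : ℝ)) := by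
  obtain ⟨C, hC, h⟩ := CurveDiff.exists_density_bound hk
  refine ⟨C ^ ((1 : ℝ) / ((k - 1 : ℕ) : ℝ)), by positivity, fun N hN B hB hfree => ?_⟩
  have h1 := h N hN B hB hfree
  have hlog3 : 1 < Real.log 3 := by
    rw [Real.lt_log_iff_exp_lt (by norm_num)]
    linarith [Real.exp_one_lt_d9]
  have hℓ : 1 < Real.log N :=
    hlog3.trans_le (Real.log_le_log (by norm_num) (by exact_mod_cast hN))
  have h2 : 0 ≤ Real.log (Real.log N) / Real.log N :=
    div_nonneg (Real.log_pos hℓ).le (by linarith)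
  rw [← Real.mul_rpow hC.le h2]
  have h3 : (0 : ℝ) ≤ (B.card : ℝ) / (N : ℝ) ^ k := by positivity
  have h4 := Real.rpow_le_rpow (by positivity) h1
    (by positivity : (0 : ℝ) ≤ (1 : ℝ) / ((k - 1 : ℕ) : ℝ))
  rwa [one_div, Real.pow_rpow_inv_natCast h3 (by omega), ← one_div] at h4
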